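/- arXiv:2604.22412 — 3 statements merged into one kernel-verified Lean document; each statement's English description precedes it below -/
import Mathlib

section
/- The class of uniformly exact groups is closed under free products, with modulus depending only on the given modulus: for every k : ℕ → ℕ there exists k' : ℕ → ℕ such that whenever groups G and H both have k as a modulus of uniform exactness, their free product G ∗ H has k' as a modulus of uniform exactness. -/
open scoped Pointwise

/-- A group `Γ` has `k : ℕ → ℕ` as a modulus of uniform exactness (`Γ ∈ UE(k)`). -/
def IsUEModulus (k : ℕ → ℕ) (Γ : Type*) [Group Γ] : Prop :=
  ∀ F : Finset Γ, (1 : Γ) ∈ F → (∀ t ∈ F, t⁻¹ ∈ F) →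
    ∃ η : Γ → Γ → ℝ,
      (∀ x t, 0 ≤ η x t) ∧
      (∀ x, Function.support (η x) ⊆ (F : Set Γ) ^ k F.card) ∧
      (∀ x, ∑ᶠ t, η x t = 1) ∧
      (∑ s ∈ F, ⨆ x : Γ, ∑ᶠ t, |η (s * x) t - η x (s⁻¹ * t)|) ≤ 1 / (F.card : ℝ)

namespace FreeProductExactness

/-! ### Finitely supported probability vectors and the `ℓ¹`-norm -/

section L1

variable {α β : Type*}

/-- The `ℓ¹`-norm of a finitely supported function. -/
noncomputable def l1 (f : α →₀ ℝ) : ℝ := f.sum fun _ c => |c|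

/-- A finitely supported probability vector. -/
structure IsProb (f : α →₀ ℝ) : Prop where
  nonneg : ∀ t, 0 ≤ f t
  sum_eq_one : (f.sum fun _ c => c) = 1

lemma l1_eq_sum (f : α →₀ ℝ) {s : Finset α} (hs : f.support ⊆ s) : l1 f = ∑ t ∈ s, |f t| :=
  Finsupp.sum_of_support_subset f hs _ (by simp)

lemma l1_nonneg (f : α →₀ ℝ) : 0 ≤ l1 f := Finset.sum_nonneg fun _ _ => abs_nonneg _

@[simp] lemma l1_zero : l1 (0 : α →₀ ℝ) = 0 := by simp [l1]

@[simp] lemma l1_single (a : α) (c : ℝ) : l1 (Finsupp.single a c) = |c| := by simp [l1]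

lemma l1_add_le (f g : α →₀ ℝ) : l1 (f + g) ≤ l1 f + l1 g := by
  classical
  rw [l1_eq_sum (f + g) Finsupp.support_add, l1_eq_sum f Finset.subset_union_left,
    l1_eq_sum g Finset.subset_union_right, ← Finset.sum_add_distrib]
  exact Finset.sum_le_sum fun t _ => abs_add_le _ _

lemma l1_neg (f : α →₀ ℝ) : l1 (-f) = l1 f := by
  rw [l1_eq_sum (-f) (s := f.support) (by simp), l1_eq_sum f subset_rfl]; simp

lemma l1_sub_le (f g : α →₀ ℝ) : l1 (f - g) ≤ l1 f + l1 g := by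
  rw [sub_eq_add_neg, ← l1_neg g]; exact l1_add_le _ _

lemma l1_sub_comm (f g : α →₀ ℝ) : l1 (f - g) = l1 (g - f) := by
  rw [← neg_sub, l1_neg]

lemma l1_sub_le_add (f g h : α →₀ ℝ) : l1 (f - h) ≤ l1 (f - g) + l1 (g - h) := by
  rw [← sub_add_sub_cancel f g h]; exact l1_add_le _ _

lemma l1_smul (c : ℝ) (f : α →₀ ℝ) : l1 (c • f) = |c| * l1 f := by
  rw [l1_eq_sum (c • f) Finsupp.support_smul, l1_eq_sum f subset_rfl, Finset.mul_sum]
  simp [abs_mul]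

lemma l1_sum_le {ι : Type*} (s : Finset ι) (f : ι → α →₀ ℝ) :
    l1 (∑ i ∈ s, f i) ≤ ∑ i ∈ s, l1 (f i) := by
  classical
  induction s using Finset.induction_on with
  | empty => simp
  | insert a s ha ih =>
    rw [Finset.sum_insert ha, Finset.sum_insert ha]
    exact (l1_add_le _ _).trans (by gcongr)

lemma l1_mapDomain_le (φ : α → β) (f : α →₀ ℝ) : l1 (f.mapDomain φ) ≤ l1 f := by
  unfold Finsupp.mapDomain
  exact (l1_sum_le _ _).trans (Finset.sum_congr rfl fun a _ => l1_single _ _).le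

lemma finsum_abs_eq_l1 (f : α →₀ ℝ) : ∑ᶠ t, |f t| = l1 f := by
  rw [l1, Finsupp.sum]
  refine finsum_eq_sum_of_support_subset _ fun t ht => ?_
  simpa using ht

lemma mapDomain_mul_left_apply {Γ : Type*} [Group Γ] (s t : Γ) (f : Γ →₀ ℝ) :
    f.mapDomain (s * ·) t = f (s⁻¹ * t) := by
  conv_lhs => rw [show t = s * (s⁻¹ * t) by group]
  exact Finsupp.mapDomain_apply (mul_right_injective s) f (s⁻¹ * t)

lemma IsProb.l1_eq {f : α →₀ ℝ} (hf : IsProb f) : l1 f = 1 := by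
  rw [← hf.sum_eq_one, l1]
  exact Finset.sum_congr rfl fun t _ => abs_of_nonneg (hf.nonneg t)

lemma IsProb.mapDomain {f : α →₀ ℝ} (hf : IsProb f) (φ : α → β) : IsProb (f.mapDomain φ) := by
  constructor
  · intro t
    classical
    rw [Finsupp.mapDomain, Finsupp.sum_apply]
    refine Finset.sum_nonneg fun a _ => ?_
    change 0 ≤ Finsupp.single (φ a) (f a) t
    rw [Finsupp.single_apply]
    split_ifs
    · exact hf.nonneg _
    · exact le_rfl
  · rw [Finsupp.sum_mapDomain_index (fun _ => rfl) (fun _ _ _ => rfl)]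
    exact hf.sum_eq_one

lemma mem_support_mapDomain {φ : α → β} {f : α →₀ ℝ} {b : β}
    (hb : b ∈ (f.mapDomain φ).support) : ∃ a ∈ f.support, φ a = b := by
  classical
  simpa using Finsupp.mapDomain_support hb

/-- The mixture of the vectors `Θ q` with weights `ζ q`. -/
noncomputable def mix (ζ : α →₀ ℝ) (Θ : α → β →₀ ℝ) : β →₀ ℝ := ζ.sum fun q c => c • Θ q

lemma mix_eq_sum (ζ : α →₀ ℝ) (Θ : α → β →₀ ℝ) {s : Finset α} (hs : ζ.support ⊆ s) :
    mix ζ Θ = ∑ q ∈ s, ζ q • Θ q :=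
  Finsupp.sum_of_support_subset ζ hs _ (by simp)

lemma IsProb.mix {ζ : α →₀ ℝ} (hζ : IsProb ζ) {Θ : α → β →₀ ℝ}
    (hΘ : ∀ q ∈ ζ.support, IsProb (Θ q)) : IsProb (mix ζ Θ) := by
  constructor
  · intro t
    rw [FreeProductExactness.mix, Finsupp.sum_apply]
    exact Finset.sum_nonneg fun q hq => mul_nonneg (hζ.nonneg q) ((hΘ q hq).nonneg t)
  · rw [FreeProductExactness.mix, Finsupp.sum_sum_index (fun _ => rfl) (fun _ _ _ => rfl)]
    rw [← hζ.sum_eq_one]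
    refine Finset.sum_congr rfl fun q hq => ?_
    change (ζ q • Θ q).sum (fun _ c => c) = ζ q
    rw [Finsupp.sum_smul_index (fun _ => rfl)]
    rw [← Finsupp.mul_sum, (hΘ q hq).sum_eq_one, mul_one]

lemma mem_support_mix {ζ : α →₀ ℝ} {Θ : α → β →₀ ℝ} {t : β} (ht : t ∈ (mix ζ Θ).support) :
    ∃ q ∈ ζ.support, t ∈ (Θ q).support := by
  classical
  obtain ⟨q, hq, h⟩ := Finset.mem_biUnion.1 (Finsupp.support_sum ht)
  exact ⟨q, hq, Finsupp.support_smul h⟩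

lemma mix_sub (ζ ζ' : α →₀ ℝ) (Θ : α → β →₀ ℝ) :
    mix (ζ - ζ') Θ = mix ζ Θ - mix ζ' Θ :=
  Finsupp.sum_sub_index fun _ _ _ => sub_smul _ _ _

lemma l1_mix_le {ζ : α →₀ ℝ} {Θ : α → β →₀ ℝ} {c : ℝ} (h : ∀ q ∈ ζ.support, l1 (Θ q) ≤ c) :
    l1 (mix ζ Θ) ≤ l1 ζ * c := by
  refine (l1_sum_le _ _).trans ?_
  rw [l1, Finsupp.sum, Finset.sum_mul]
  refine Finset.sum_le_sum fun q hq => ?_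
  rw [l1_smul]
  exact mul_le_mul_of_nonneg_left (h q hq) (abs_nonneg _)

lemma mix_mapDomain {γ : Type*} (φ : γ → α) (ζ : γ →₀ ℝ) (Θ : α → β →₀ ℝ) :
    mix (ζ.mapDomain φ) Θ = mix ζ fun q => Θ (φ q) :=
  Finsupp.sum_mapDomain_index (fun _ => zero_smul _ _) fun _ _ _ => add_smul _ _ _

lemma mapDomain_mix {γ : Type*} (ψ : β → γ) (ζ : α →₀ ℝ) (Θ : α → β →₀ ℝ) :
    (mix ζ Θ).mapDomain ψ = mix ζ fun q => (Θ q).mapDomain ψ := by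
  simp only [mix, Finsupp.sum, Finsupp.mapDomain_finsetSum, Finsupp.mapDomain_smul]

/-- Mixtures of almost equivariant families along almost equivariant weights are almost
equivariant. -/
lemma l1_mix_sub_mapDomain_le {α' : Type*} {ζ : α →₀ ℝ} {ζ' : α' →₀ ℝ} {Θ : α → β →₀ ℝ}
    {Θ' : α' → β →₀ ℝ} (φ : α → α') (ψ : β → β) {δ ε : ℝ} (hζ : IsProb ζ)
    (hδ : l1 (ζ' - ζ.mapDomain φ) ≤ δ)
    (hΘ' : ∀ q ∈ (ζ' - ζ.mapDomain φ).support, IsProb (Θ' q))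
    (h : ∀ q ∈ ζ.support, l1 (Θ' (φ q) - (Θ q).mapDomain ψ) ≤ ε) :
    l1 (mix ζ' Θ' - (mix ζ Θ).mapDomain ψ) ≤ δ + ε := by
  refine (l1_sub_le_add _ (mix (ζ.mapDomain φ) Θ') _).trans (add_le_add ?_ ?_)
  · rw [← mix_sub]
    refine (l1_mix_le (c := 1) fun q hq => (hΘ' q hq).l1_eq.le).trans ?_
    rwa [mul_one]
  · rw [mix_mapDomain, mapDomain_mix]
    have : (mix ζ fun q => Θ' (φ q)) - (mix ζ fun q => (Θ q).mapDomain ψ)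
        = mix ζ fun q => Θ' (φ q) - (Θ q).mapDomain ψ := by
      simp only [mix, Finsupp.sum, smul_sub, Finset.sum_sub_distrib]
    rw [this]
    refine (l1_mix_le h).trans ?_
    rw [hζ.l1_eq, one_mul]

/-- The uniform probability vector on a finite set. -/
noncomputable def unif (s : Finset α) : α →₀ ℝ := ∑ a ∈ s, Finsupp.single a (1 / (s.card : ℝ))

lemma unif_apply [DecidableEq α] (s : Finset α) (a : α) :
    unif s a = if a ∈ s then 1 / (s.card : ℝ) else 0 := by
  simp [unif, Finsupp.finsetSum_apply, Finsupp.single_apply]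

lemma support_unif_subset (s : Finset α) : (unif s).support ⊆ s := by
  classical
  intro a ha
  by_contra h
  simp [unif_apply, h] at ha

lemma isProb_unif {s : Finset α} (hs : s.Nonempty) : IsProb (unif s) := by
  classical
  constructor
  · intro t
    rw [unif_apply]; split_ifs <;> positivity
  · rw [Finsupp.sum_of_support_subset _ (support_unif_subset s) _ (fun _ _ => rfl)]
    rw [Finset.sum_congr rfl fun a ha => by rw [unif_apply, if_pos ha]]
    have : (s.card : ℝ) ≠ 0 := by simpa using hs.ne_empty
    simp [this]

lemma mapDomain_unif [DecidableEq β] {φ : α → β} {s : Finset α} (hφ : Set.InjOn φ s) :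
    (unif s).mapDomain φ = unif (s.image φ) := by
  simp only [unif, Finsupp.mapDomain_finsetSum, Finsupp.mapDomain_single]
  rw [Finset.sum_image hφ, Finset.card_image_of_injOn hφ]

lemma l1_unif_sub_unif {s t : Finset α} (hs : s.Nonempty) (hst : s ⊆ t) :
    l1 (unif s - unif t) = 2 * (1 - (s.card : ℝ) / t.card) := by
  classical
  have h0 : (0 : ℝ) < s.card := by exact_mod_cast hs.card_pos
  have h1 : (s.card : ℝ) ≤ t.card := by exact_mod_cast Finset.card_le_card hst
  have h2 : (0 : ℝ) < t.card := h0.trans_le h1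
  have hsup : (unif s - unif t).support ⊆ t := by
    refine Finsupp.support_sub.trans (Finset.union_subset ?_ (support_unif_subset t))
    exact (support_unif_subset s).trans hst
  rw [l1_eq_sum _ hsup, ← Finset.sum_sdiff hst]
  rw [Finset.sum_congr (s₁ := t \ s) rfl (g := fun _ => 1 / (t.card : ℝ))]
  · rw [Finset.sum_congr (s₁ := s) rfl (g := fun _ => 1 / (s.card : ℝ) - 1 / t.card)]
    · simp only [Finset.sum_const, nsmul_eq_mul]
      rw [Finset.card_sdiff_of_subset hst, Nat.cast_sub (Finset.card_le_card hst)]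
      field_simp
      ring
    · intro a ha
      rw [Finsupp.sub_apply, unif_apply, unif_apply, if_pos ha, if_pos (hst ha)]
      refine abs_of_nonneg (sub_nonneg.2 ?_)
      exact one_div_le_one_div_of_le h0 h1
  · intro a ha
    rw [Finset.mem_sdiff] at ha
    rw [Finsupp.sub_apply, unif_apply, unif_apply, if_pos ha.1, if_neg ha.2, zero_sub, abs_neg]
    exact abs_of_nonneg (by positivity)

/-- Two images of a uniform vector are close when the maps agree, up to a permutation, off a small
set. -/
lemma l1_mapDomain_unif_sub_le {Ω : Type*} [Fintype Ω] [DecidableEq β] (f g : Ω → β)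
    (σ : Equiv.Perm Ω) {B : Finset Ω} (hB : ∀ ω, ω ∉ B → f (σ ω) = g ω) :
    l1 ((unif Finset.univ).mapDomain f - (unif Finset.univ).mapDomain g)
      ≤ 2 * B.card / Fintype.card Ω := by
  classical
  simp only [unif, Finsupp.mapDomain_finsetSum, Finsupp.mapDomain_single]
  rw [← Equiv.sum_comp σ, ← Finset.sum_sub_distrib]
  rw [← Finset.sum_subset (Finset.subset_univ B)]
  · refine (l1_sum_le _ _).trans ?_
    refine (Finset.sum_le_card_nsmul B _ (2 / Fintype.card Ω : ℝ) fun ω _ => ?_).trans ?_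
    · refine (l1_sub_le _ _).trans (le_of_eq ?_)
      rw [l1_single, l1_single, abs_of_nonneg (by positivity)]
      simp only [Finset.card_univ]; ring
    · rw [nsmul_eq_mul]; apply le_of_eq; ring
  · intro ω _ hω
    rw [hB ω hω, sub_self]

end L1

/-! ### Two-parameter moduli -/

section UnifExact

/-- A two-parameter version of uniform exactness: symmetric sets of at most `m` elements admit
almost invariant families with error `1 / (j + 1)` supported in balls of radius `K m j`. -/
def UnifExact (K : ℕ → ℕ → ℕ) (Γ : Type*) [Group Γ] : Prop :=
  ∀ (m j : ℕ) (F : Finset Γ), (1 : Γ) ∈ F → (∀ t ∈ F, t⁻¹ ∈ F) → F.card ≤ m →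
    ∃ η : Γ → Γ →₀ ℝ, (∀ x, IsProb (η x)) ∧
      (∀ x, ∀ t ∈ (η x).support, t ∈ (F : Set Γ) ^ K m j) ∧
      ∀ s ∈ F, ∀ x, l1 (η (s * x) - (η x).mapDomain (s * ·)) ≤ 1 / ((j : ℝ) + 1)

variable {Γ : Type*} [Group Γ]

lemma inv_mem_pow {F : Set Γ} (hF : ∀ t ∈ F, t⁻¹ ∈ F) {n : ℕ} {t : Γ} (ht : t ∈ F ^ n) :
    t⁻¹ ∈ F ^ n := by
  have : F⁻¹ = F := by
    ext x
    exact ⟨fun hx => by simpa using hF _ (Set.mem_inv.1 hx), fun hx => Set.mem_inv.2 (hF _ hx)⟩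
  rw [← this, inv_pow, Set.mem_inv, inv_inv]
  exact ht

lemma exists_pow_eq_pow_succ [DecidableEq Γ] {F : Finset Γ} (h1 : 1 ∈ F) {q : ℕ}
    (hq : (F ^ q).card ≤ q) : ∃ i ≤ q, F ^ i = F ^ (i + 1) := by
  by_contra! h
  have key : ∀ i ≤ q + 1, i + 1 ≤ (F ^ i).card := by
    intro i
    induction i with
    | zero => simp
    | succ i ih =>
      intro hi
      have h2 := h i (by omega)
      have h3 : F ^ i ⊂ F ^ (i + 1) :=
        (Finset.pow_subset_pow_right h1 (Nat.le_succ i)).ssubset_of_ne h2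
      have := Finset.card_lt_card h3
      have := ih (by omega)
      omega
  have := key q (by omega)
  omega

lemma IsUEModulus.unifExact {k : ℕ → ℕ} (h : IsUEModulus k Γ) :
    UnifExact (fun m j => (j + 1) * (Finset.range (m ^ (j + 1) + 1)).sup k + (j + 1)) Γ := by
  classical
  intro m j F h1 hinv hm
  by_cases hq : (F ^ (j + 1)).card ≤ j + 1
  · obtain ⟨i, hi, hFi⟩ := exists_pow_eq_pow_succ h1 hq
    have hne : (F ^ i).Nonempty := ⟨1, Finset.one_mem_pow h1⟩
    refine ⟨fun _ => unif (F ^ i), fun _ => isProb_unif hne, fun x t ht => ?_, fun s hs x => ?_⟩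
    · have := support_unif_subset _ ht
      rw [← Finset.coe_pow, Finset.mem_coe]
      exact Finset.pow_subset_pow_right h1 (show i ≤ (j + 1) * _ + (j + 1) by omega) this
    · rw [mapDomain_unif (mul_right_injective s).injOn]
      have : (F ^ i).image (s * ·) = F ^ i := by
        refine Finset.eq_of_subset_of_card_le ?_ ?_
        · intro t ht
          obtain ⟨u, hu, rfl⟩ := Finset.mem_image.1 ht
          rw [hFi, pow_succ']
          exact Finset.mul_mem_mul hs hu
        · rw [Finset.card_image_of_injective _ (mul_right_injective s)]
      rw [this, sub_self, l1_zero]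
      positivity
  · push Not at hq
    set E := F ^ (j + 1) with hE
    obtain ⟨η, h0, hsupp, hsum, herr⟩ := h E (Finset.one_mem_pow h1) (fun t ht => by
      rw [← Finset.mem_coe, hE, Finset.coe_pow] at ht ⊢
      exact inv_mem_pow hinv ht)
    have hfin : ∀ x, (Function.support (η x)).Finite := fun x =>
      (E ^ k E.card).finite_toSet.subset (by simpa using hsupp x)
    let θ : Γ → Γ →₀ ℝ := fun x => Finsupp.ofSupportFinite (η x) (hfin x)
    have hθ : ∀ x t, θ x t = η x t := fun _ _ => rfl
    have hθp : ∀ x, IsProb (θ x) := fun x => by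
      refine ⟨h0 x, ?_⟩
      rw [← hsum x, Finsupp.sum]
      symm
      exact finsum_eq_sum_of_support_subset _ (fun t ht => by simpa [hθ] using ht)
    have hl1 : ∀ s x, ∑ᶠ t, |η (s * x) t - η x (s⁻¹ * t)|
        = l1 (θ (s * x) - (θ x).mapDomain (s * ·)) := by
      intro s x
      rw [← finsum_abs_eq_l1]
      refine finsum_congr fun t => ?_
      rw [Finsupp.sub_apply, mapDomain_mul_left_apply, hθ, hθ]
    refine ⟨θ, hθp, fun x t ht => ?_, fun s hs x => ?_⟩
    · have h2 : t ∈ (E : Set Γ) ^ k E.card := hsupp x (by simpa [hθ] using ht)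
      rw [hE, Finset.coe_pow, ← pow_mul] at h2
      refine Set.pow_subset_pow_right (by exact_mod_cast h1) ?_ h2
      have h3 : E.card ≤ m ^ (j + 1) := Finset.card_pow_le.trans (Nat.pow_le_pow_left hm _)
      have h4 : k E.card ≤ (Finset.range (m ^ (j + 1) + 1)).sup k :=
        Finset.le_sup (f := k) (Finset.mem_range.2 (by omega))
      have := Nat.mul_le_mul_left (j + 1) h4
      exact this.trans (Nat.le_add_right _ _)
    · have hsE : s ∈ E := by
        have := Finset.pow_subset_pow_right h1 (show 1 ≤ j + 1 by omega)
        rw [pow_one] at this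
        exact this hs
      have hb : BddAbove (Set.range fun x => ∑ᶠ t, |η (s * x) t - η x (s⁻¹ * t)|) := by
        refine ⟨2, ?_⟩
        rintro _ ⟨x, rfl⟩
        simp only [hl1]
        refine (l1_sub_le _ _).trans ?_
        rw [(hθp _).l1_eq, ((hθp _).mapDomain _).l1_eq]; norm_num
      rw [← hl1]
      refine (le_ciSup hb x).trans ?_
      refine (Finset.single_le_sum (f := fun s => ⨆ x, ∑ᶠ t, |η (s * x) t - η x (s⁻¹ * t)|)
        (fun s _ => Real.iSup_nonneg fun x => ?_) hsE).trans ?_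
      · rw [hl1]; exact l1_nonneg _
      · refine herr.trans (one_div_le_one_div_of_le (by positivity) ?_)
        exact_mod_cast hq.le

lemma UnifExact.isUEModulus {K : ℕ → ℕ → ℕ} (h : UnifExact K Γ) :
    IsUEModulus (fun m => K m (m * m)) Γ := by
  intro F h1 hinv
  obtain ⟨η, hp, hsupp, herr⟩ := h F.card (F.card * F.card) F h1 hinv le_rfl
  refine ⟨fun x t => η x t, fun x => (hp x).nonneg, fun x t ht => hsupp x t (by simpa using ht),
    fun x => ?_, ?_⟩
  · rw [← (hp x).sum_eq_one, Finsupp.sum]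
    exact finsum_eq_sum_of_support_subset _ (fun t ht => by simpa using ht)
  · have hl1 : ∀ s x, ∑ᶠ t, |η (s * x) t - η x (s⁻¹ * t)|
        = l1 (η (s * x) - (η x).mapDomain (s * ·)) := by
      intro s x
      rw [← finsum_abs_eq_l1]
      refine finsum_congr fun t => ?_
      rw [Finsupp.sub_apply, mapDomain_mul_left_apply]
    have hpos : (0 : ℝ) < F.card := by exact_mod_cast Finset.card_pos.2 ⟨1, h1⟩
    refine (Finset.sum_le_card_nsmul F _ (1 / ((F.card * F.card : ℕ) + 1 : ℝ)) fun s hs => ?_).trans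
      ?_
    · refine ciSup_le fun x => ?_
      rw [hl1]
      exact herr s hs x
    · rw [nsmul_eq_mul, mul_one_div, div_le_div_iff₀ (by positivity) hpos]
      push_cast
      linarith

lemma UnifExact.of_injective {K : ℕ → ℕ → ℕ} {Λ : Type*} [Group Λ] (h : UnifExact K Γ)
    (φ : Λ →* Γ) (hφ : Function.Injective φ) : UnifExact K Λ := by
  classical
  intro m j F h1 hinv hm
  obtain ⟨η, hp, hsupp, herr⟩ := h m j (F.image φ)
    (Finset.mem_image.2 ⟨1, h1, map_one φ⟩)
    (fun t ht => by
      obtain ⟨u, hu, rfl⟩ := Finset.mem_image.1 ht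
      exact Finset.mem_image.2 ⟨u⁻¹, hinv u hu, map_inv φ u⟩)
    (Finset.card_image_le.trans hm)
  have hsupp' : ∀ x, ∀ t ∈ (η x).support, ∃ u ∈ (F : Set Λ) ^ K m j, φ u = t := by
    intro x t ht
    have := hsupp x t ht
    rw [Finset.coe_image, ← Set.image_pow] at this
    exact this
  let ρ : Γ → Λ := Function.invFun φ
  have hρ : ∀ u, ρ (φ u) = u := Function.leftInverse_invFun hφ
  refine ⟨fun x => (η (φ x)).mapDomain ρ, fun x => (hp _).mapDomain _, fun x t ht => ?_,
    fun s hs x => ?_⟩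
  · obtain ⟨u, hu, rfl⟩ := mem_support_mapDomain ht
    obtain ⟨v, hv, rfl⟩ := hsupp' _ u hu
    rwa [hρ]
  · have : ((η (φ x)).mapDomain ρ).mapDomain (s * ·)
        = ((η (φ x)).mapDomain (φ s * ·)).mapDomain ρ := by
      rw [← Finsupp.mapDomain_comp, ← Finsupp.mapDomain_comp]
      refine Finsupp.mapDomain_congr fun t ht => ?_
      obtain ⟨v, hv, rfl⟩ := hsupp' _ t ht
      simp only [Function.comp]
      rw [← map_mul, hρ, hρ]
    simp only [this, map_mul]
    rw [← Finsupp.mapDomain_sub]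
    exact (l1_mapDomain_le _ _).trans (herr _ (Finset.mem_image_of_mem _ hs) _)

end UnifExact

/-- The modulus for extensions. -/
def extensionModulus (K₁ K₂ : ℕ → ℕ → ℕ) (m j : ℕ) : ℕ :=
  K₂ m (2 * j + 1) + 1 + (2 * K₂ m (2 * j + 1) + 3) *
    K₁ (m ^ (2 * K₂ m (2 * j + 1) + 3)) (2 * j + 1)

/-- Uniform exactness passes to extensions of `Q` by `N`. -/
lemma UnifExact.extension {K₁ K₂ : ℕ → ℕ → ℕ} {Γ N Q : Type*} [Group Γ] [Group N] [Group Q]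
    (hN : UnifExact K₁ N) (hQ : UnifExact K₂ Q) (i : N →* Γ) (hi : Function.Injective i)
    (π : Γ →* Q) (hπi : ∀ u, π (i u) = 1) (hker : ∀ g, π g = 1 → ∃ u, i u = g) :
    UnifExact (extensionModulus K₁ K₂) Γ := by
  classical
  intro m j F h1 hinv hm
  set n := K₂ m (2 * j + 1) with hn
  have h1S : (1 : Γ) ∈ (F : Set Γ) := h1
  obtain ⟨ζ, hζp, hζs, hζe⟩ := hQ m (2 * j + 1) (F.image π)
    (Finset.mem_image.2 ⟨1, h1, map_one π⟩)
    (fun t ht => by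
      obtain ⟨u, hu, rfl⟩ := Finset.mem_image.1 ht
      exact Finset.mem_image.2 ⟨u⁻¹, hinv u hu, map_inv π u⟩)
    (Finset.card_image_le.trans hm)
  have hlift : ∀ q : Q, ∃ g : Γ, q ∈ ((F.image π : Finset Q) : Set Q) ^ (n + 1) →
      g ∈ (F : Set Γ) ^ (n + 1) ∧ π g = q := by
    intro q
    by_cases hq : q ∈ ((F.image π : Finset Q) : Set Q) ^ (n + 1)
    · have h2 := hq
      rw [Finset.coe_image, ← Set.image_pow] at h2
      obtain ⟨g, hg, hgq⟩ := h2
      exact ⟨g, fun _ => ⟨hg, hgq⟩⟩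
    · exact ⟨1, fun h => absurd h hq⟩
  choose g hg using hlift
  have h1im : (1 : Q) ∈ ((F.image π : Finset Q) : Set Q) := by
    simpa using ⟨1, h1, map_one π⟩
  let E : Finset N := (F ^ (2 * n + 3)).preimage i hi.injOn
  have hE : ∀ u, u ∈ E ↔ i u ∈ (F : Set Γ) ^ (2 * n + 3) := fun u => by
    rw [Finset.mem_preimage, ← Finset.mem_coe, Finset.coe_pow]
  have hEcard : E.card ≤ m ^ (2 * n + 3) := by
    refine le_trans ?_ (Finset.card_pow_le.trans (Nat.pow_le_pow_left hm _))
    exact Finset.card_le_card_of_injOn i (fun u hu => Finset.mem_preimage.1 hu) hi.injOn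
  obtain ⟨ν, hνp, hνs, hνe⟩ := hN (m ^ (2 * n + 3)) (2 * j + 1) E
    ((hE 1).2 (by rw [map_one]; exact Set.one_mem_pow h1S))
    (fun t ht => (hE _).2 (by
      rw [map_inv]; exact inv_mem_pow (fun t ht => hinv t ht) ((hE t).1 ht))) hEcard
  set l := K₁ (m ^ (2 * n + 3)) (2 * j + 1) with hl
  let r : Q → Γ := Function.invFun π
  have hr : ∀ x, π (r (π x)) = π x := fun x => Function.invFun_eq ⟨x, rfl⟩
  have hpart : ∀ x, ∃ u, i u = x * (r (π x))⁻¹ := fun x =>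
    hker _ (by rw [map_mul, map_inv, hr, mul_inv_cancel])
  choose ρ hρ using hpart
  have hρmul : ∀ u x, ρ (i u * x) = u * ρ x := fun u x => hi (by
    rw [hρ, map_mul i, hρ, map_mul π, hπi, one_mul, mul_assoc])
  let Θ : Γ → Q → Γ →₀ ℝ := fun x q =>
    (ν (ρ ((g q)⁻¹ * x))).mapDomain (fun u => g q * i u)
  have hΘp : ∀ x q, IsProb (Θ x q) := fun x q => (hνp _).mapDomain _
  have hδ : 1 / (((2 * j + 1 : ℕ) : ℝ) + 1) + 1 / (((2 * j + 1 : ℕ) : ℝ) + 1)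
      = 1 / ((j : ℝ) + 1) := by
    push_cast
    field_simp
    ring
  refine ⟨fun x => mix (ζ (π x)) (Θ x), fun x => (hζp _).mix fun q _ => hΘp x q,
    fun x t ht => ?_, fun s hs x => ?_⟩
  · obtain ⟨q, hq, htq⟩ := mem_support_mix ht
    obtain ⟨v, hv, rfl⟩ := mem_support_mapDomain htq
    have hq' := Set.pow_subset_pow_right h1im (Nat.le_succ n) (hζs _ q hq)
    have h2 : i v ∈ (F : Set Γ) ^ ((2 * n + 3) * l) := by
      rw [pow_mul]
      refine Set.pow_subset_pow_left (s := i '' (E : Set N)) ?_ ?_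
      · rintro _ ⟨u, hu, rfl⟩
        exact (hE u).1 hu
      · rw [← Set.image_pow]
        exact ⟨v, hνs _ v hv, rfl⟩
    change _ ∈ (F : Set Γ) ^ (n + 1 + (2 * n + 3) * l)
    rw [pow_add]
    exact Set.mul_mem_mul (hg q hq').1 h2
  · rw [← hδ]
    refine l1_mix_sub_mapDomain_le (π s * ·) (s * ·) (hζp _) ?_ (fun q _ => hΘp _ q) ?_
    · simp only [map_mul]
      exact hζe _ (Finset.mem_image_of_mem _ hs) _
    · intro q hq
      have hq0 := hζs _ q hq
      have hgq := hg q (Set.pow_subset_pow_right h1im (Nat.le_succ n) hq0)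
      have hgq' := hg (π s * q) (by
        rw [pow_succ']
        exact Set.mul_mem_mul (by simpa using ⟨s, hs, rfl⟩) hq0)
      obtain ⟨u, hu⟩ := hker ((g (π s * q))⁻¹ * s * g q) (by
        rw [map_mul, map_mul, map_inv, hgq.2, hgq'.2]; group)
      have huE : u ∈ E := by
        rw [hE, hu, show 2 * n + 3 = (n + 1) + 1 + (n + 1) by ring, pow_add, pow_add, pow_one]
        exact Set.mul_mem_mul (Set.mul_mem_mul (inv_mem_pow (fun t ht => hinv t ht) hgq'.1) hs)
          hgq.1
      have e1 : ρ ((g (π s * q))⁻¹ * (s * x)) = u * ρ ((g q)⁻¹ * x) := by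
        rw [← hρmul, hu]; congr 1; group
      have e2 : (Θ x q).mapDomain (s * ·) = ((ν (ρ ((g q)⁻¹ * x))).mapDomain (u * ·)).mapDomain
          (fun v => g (π s * q) * i v) := by
        simp only [Θ]
        rw [← Finsupp.mapDomain_comp, ← Finsupp.mapDomain_comp]
        congr 1
        funext v
        simp only [Function.comp, map_mul, hu]
        group
      have e3 : Θ (s * x) (π s * q) = (ν (u * ρ ((g q)⁻¹ * x))).mapDomain
          (fun v => g (π s * q) * i v) := by
        simp only [Θ, e1]
      rw [e2, e3, ← Finsupp.mapDomain_sub]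
      exact (l1_mapDomain_le _ _).trans (hνe u huE _)

/-! ### The free product embeds in an extension of `G × H` by a free group -/

section Embedding

variable (G H : Type*) [Group G] [Group H]

/-- The left translation action of `G × H` on the free group on `G × H`. -/
def translationAction : G × H →* MulAut (FreeGroup (G × H)) :=
  MonoidHom.mk' (fun q => FreeGroup.freeGroupCongr (Equiv.mulLeft q)) fun p q => by
    refine MulEquiv.toMonoidHom_injective (FreeGroup.ext_hom _ _ fun x => ?_)
    simp [mul_assoc]

@[simp] lemma translationAction_of (q x : G × H) :
    translationAction G H q (FreeGroup.of x) = FreeGroup.of (q * x) := by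
  simp [translationAction]

/-- The homomorphism from `G ∗ H` to `FreeGroup (G × H) ⋊ (G × H)` which is the inclusion on `G`
and the inclusion followed by conjugation by the generator at `1` on `H`. -/
def toSemidirect : Monoid.Coprod G H →*
    FreeGroup (G × H) ⋊[translationAction G H] (G × H) :=
  Monoid.Coprod.lift (SemidirectProduct.inr.comp (MonoidHom.inl G H))
    ((MulAut.conj (SemidirectProduct.inl (FreeGroup.of 1))).toMonoidHom.comp
      (SemidirectProduct.inr.comp (MonoidHom.inr G H)))

variable {G H}

/-- The element `h₁ g₁ h₂ g₂ ⋯` of the free product. -/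
def alternatingProd (l : List (H × G)) : Monoid.Coprod G H :=
  (l.map fun p => Monoid.Coprod.inr p.1 * Monoid.Coprod.inl p.2).prod

/-- The alternating product `h₁ g₁ h₂ g₂ ⋯` is reduced. -/
def IsAlternating : List (H × G) → Prop
  | [] => True
  | p :: l => p.1 ≠ 1 ∧ (l = [] ∨ p.2 ≠ 1) ∧ IsAlternating l

lemma exists_eq_inl_mul_alternatingProd (u : Monoid.Coprod G H) :
    ∃ (g : G) (l : List (H × G)), IsAlternating l ∧
      u = Monoid.Coprod.inl g * alternatingProd l := by
  induction u using Monoid.Coprod.induction_on' with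
  | one => exact ⟨1, [], trivial, by simp [alternatingProd]⟩
  | inl_mul g u ih =>
    obtain ⟨g₀, l, hl, rfl⟩ := ih
    exact ⟨g * g₀, l, hl, by rw [map_mul, mul_assoc]⟩
  | inr_mul h u ih =>
    obtain ⟨g₀, l, hl, rfl⟩ := ih
    by_cases hh : h = 1
    · exact ⟨g₀, l, hl, by simp [hh]⟩
    by_cases hc : l = [] ∨ g₀ ≠ 1
    · exact ⟨1, (h, g₀) :: l, ⟨hh, hc, hl⟩, by simp [alternatingProd, mul_assoc]⟩
    · push Not at hc
      obtain ⟨hne, rfl⟩ := hc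
      obtain ⟨⟨h', g'⟩, l', rfl⟩ := List.exists_cons_of_ne_nil hne
      by_cases hhh : h * h' = 1
      · refine ⟨g', l', hl.2.2, ?_⟩
        simp only [alternatingProd, List.map_cons, List.prod_cons, map_one, one_mul, ← mul_assoc]
        rw [← map_mul, hhh, map_one, one_mul]
      · refine ⟨1, (h * h', g') :: l', ⟨hhh, hl.2.1, hl.2.2⟩, ?_⟩
        simp only [alternatingProd, List.map_cons, List.prod_cons, map_one, one_mul, ← mul_assoc,
          map_mul]

/-- The word in the free group on `G × H` traced out by an alternating product. -/
def traceWord : G × H → List (H × G) → List ((G × H) × Bool)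
  | _, [] => []
  | q, p :: l => (q, true) :: (q * (1, p.1), false) :: traceWord (q * (1, p.1) * (p.2, 1)) l

lemma isReduced_traceWord (q : G × H) {l : List (H × G)} (hl : IsAlternating l) :
    FreeGroup.IsReduced (traceWord q l) := by
  induction l generalizing q with
  | nil => exact FreeGroup.IsReduced.nil
  | cons p l ih =>
    have h3 := ih (q * (1, p.1) * (p.2, 1)) hl.2.2
    rw [traceWord, FreeGroup.isReduced_cons_cons]
    refine ⟨fun h => ?_, ?_⟩
    · exact absurd (by simpa [Prod.ext_iff] using h) hl.1
    cases l with
    | nil => exact FreeGroup.IsReduced.singleton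
    | cons p' l' =>
      rw [traceWord] at h3 ⊢
      rw [FreeGroup.isReduced_cons_cons]
      refine ⟨fun h => ?_, h3⟩
      have h4 : p.2 ≠ 1 := by simpa using hl.2.1
      exact absurd (by simpa [Prod.ext_iff] using h) h4

lemma inr_mul_toSemidirect_alternatingProd (q : G × H) (l : List (H × G)) :
    ∃ e, SemidirectProduct.inr q * toSemidirect G H (alternatingProd l)
      = SemidirectProduct.inl (FreeGroup.mk (traceWord q l)) * SemidirectProduct.inr e := by
  induction l generalizing q with
  | nil => exact ⟨q, by simp [alternatingProd, traceWord, ← FreeGroup.one_eq_mk]⟩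
  | cons p l ih =>
    obtain ⟨e, he⟩ := ih (q * (1, p.1) * (p.2, 1))
    refine ⟨e, ?_⟩
    have h1 : alternatingProd (p :: l)
        = Monoid.Coprod.inr p.1 * Monoid.Coprod.inl p.2 * alternatingProd l := rfl
    have h2 : FreeGroup.mk (traceWord q (p :: l)) = FreeGroup.of q *
        (FreeGroup.of (q * (1, p.1)))⁻¹ *
        FreeGroup.mk (traceWord (q * (1, p.1) * (p.2, 1)) l) := by
      rw [traceWord, FreeGroup.of, FreeGroup.of, FreeGroup.inv_mk, FreeGroup.mul_mk,
        FreeGroup.mul_mk]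
      rfl
    have h3 : ∀ p x : G × H, (SemidirectProduct.inr p :
          FreeGroup (G × H) ⋊[translationAction G H] (G × H)) *
        SemidirectProduct.inl (FreeGroup.of x)
        = SemidirectProduct.inl (FreeGroup.of (p * x)) * SemidirectProduct.inr p := by
      intro p x
      rw [← translationAction_of, SemidirectProduct.inl_aut]
      simp
    have h4 : ∀ p x : G × H, (SemidirectProduct.inr p :
          FreeGroup (G × H) ⋊[translationAction G H] (G × H)) *
        (SemidirectProduct.inl (FreeGroup.of x))⁻¹
        = (SemidirectProduct.inl (FreeGroup.of (p * x)))⁻¹ * SemidirectProduct.inr p := by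
      intro p x
      rw [eq_inv_mul_iff_mul_eq, ← mul_assoc, ← h3, mul_assoc, mul_inv_cancel, mul_one]
    have h5 : toSemidirect G H (Monoid.Coprod.inr p.1 * Monoid.Coprod.inl p.2)
        = SemidirectProduct.inl (FreeGroup.of 1) * SemidirectProduct.inr (1, p.1) *
          (SemidirectProduct.inl (FreeGroup.of 1))⁻¹ * SemidirectProduct.inr (p.2, 1) := by
      simp [toSemidirect]
    rw [h1, map_mul, h5, h2, map_mul, map_mul, mul_assoc _ _ (SemidirectProduct.inr e), ← he,
      map_mul, map_mul, map_inv]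
    simp only [← mul_assoc]
    rw [h3, mul_one]
    congr 2
    rw [mul_assoc, mul_assoc, ← mul_assoc (SemidirectProduct.inr q), ← map_mul, h4, mul_one]
    simp only [map_mul, mul_assoc]

lemma toSemidirect_injective : Function.Injective (toSemidirect G H) := by
  rw [injective_iff_map_eq_one]
  intro u hu
  obtain ⟨g, l, hl, rfl⟩ := exists_eq_inl_mul_alternatingProd u
  obtain ⟨e, he⟩ := inr_mul_toSemidirect_alternatingProd (g, 1) l
  have h1 : toSemidirect G H (Monoid.Coprod.inl g) = SemidirectProduct.inr (g, 1) := by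
    simp [toSemidirect]
  rw [map_mul, h1, he] at hu
  have h2 := congrArg SemidirectProduct.left hu
  simp only [SemidirectProduct.mul_left, SemidirectProduct.left_inl, SemidirectProduct.left_inr,
    map_one, mul_one, SemidirectProduct.one_left] at h2
  have h3 : traceWord (g, 1) l = [] := by
    classical
    rw [← (isReduced_traceWord (g, 1) hl).reduce_eq, ← FreeGroup.toWord_mk, h2,
      FreeGroup.toWord_one]
  cases l with
  | cons p l => simp [traceWord] at h3
  | nil =>
    have h4 := congrArg SemidirectProduct.right (he.trans hu)
    have : g = 1 := by simpa [alternatingProd, Prod.ext_iff] using h4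
    simp [this, alternatingProd]

/-- A free product is uniformly exact when its factors and all free groups are. -/
lemma UnifExact.coprod {K K₀ : ℕ → ℕ → ℕ} (hG : UnifExact K G) (hH : UnifExact K H)
    (hF : UnifExact K₀ (FreeGroup (G × H))) :
    UnifExact (extensionModulus K₀ (extensionModulus K K)) (Monoid.Coprod G H) := by
  have hGH : UnifExact (extensionModulus K K) (G × H) :=
    hG.extension hH (MonoidHom.inl G H) (fun a b h => congrArg Prod.fst h) (MonoidHom.snd G H)
      (fun _ => rfl) fun g hg => ⟨g.1, Prod.ext rfl hg.symm⟩
  have hW := hF.extension hGH (SemidirectProduct.inl (φ := translationAction G H))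
    SemidirectProduct.inl_injective SemidirectProduct.rightHom
    (fun _ => SemidirectProduct.rightHom_inl _) fun g hg => by
      have : g ∈ (SemidirectProduct.rightHom (φ := translationAction G H)).ker := hg
      rwa [← SemidirectProduct.range_inl_eq_ker_rightHom] at this
  exact hW.of_injective (toSemidirect G H) toSemidirect_injective

end Embedding

/-! ### Prefixes of reduced words -/

section Prefix

variable {α : Type*} [DecidableEq α]

open FreeGroup

/-- The element represented by the first `r` letters of the reduced word of `x`. -/
def pre (x : FreeGroup α) (r : ℕ) : FreeGroup α := mk (x.toWord.take r)

lemma toWord_mk_of_isReduced {L : List (α × Bool)} (h : IsReduced L) : (mk L).toWord = L := by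
  rw [toWord_mk, h.reduce_eq]

lemma toWord_pre (x : FreeGroup α) (r : ℕ) : (pre x r).toWord = x.toWord.take r :=
  toWord_mk_of_isReduced (isReduced_toWord.infix (List.take_prefix _ _).isInfix)

@[simp] lemma pre_zero (x : FreeGroup α) : pre x 0 = 1 := by
  simp [pre, ← one_eq_mk]

lemma pre_pre (x : FreeGroup α) (r r' : ℕ) : pre (pre x r) r' = pre x (min r' r) := by
  rw [pre, toWord_pre, List.take_take]; rfl

lemma norm_pre {x : FreeGroup α} {r : ℕ} (hr : r ≤ x.norm) : (pre x r).norm = r := by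
  rw [FreeGroup.norm, toWord_pre, List.length_take]
  exact min_eq_left hr

lemma norm_inv_pre_mul_pre_of_le {x : FreeGroup α} {r r' : ℕ} (h : r ≤ r') (h' : r' ≤ x.norm) :
    ((pre x r)⁻¹ * pre x r').norm = r' - r := by
  have h1 : pre x r' = pre x r * mk ((x.toWord.take r').drop r) := by
    rw [pre, pre, mul_mk]
    congr 1
    conv_lhs => rw [← List.take_append_drop r (x.toWord.take r')]
    rw [List.take_take, min_eq_left h]
  rw [h1, inv_mul_cancel_left, FreeGroup.norm, toWord_mk_of_isReduced, List.length_drop,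
    List.length_take]
  · have : r' ≤ x.toWord.length := h'
    omega
  · exact isReduced_toWord.infix
      ((List.drop_suffix _ _).isInfix.trans (List.take_prefix _ _).isInfix)

lemma norm_inv_pre_mul_pre {x : FreeGroup α} {r r' : ℕ} (h : r ≤ x.norm) (h' : r' ≤ x.norm) :
    (((pre x r)⁻¹ * pre x r').norm : ℤ) = |(r' : ℤ) - r| := by
  rcases le_total r r' with hr | hr
  · rw [norm_inv_pre_mul_pre_of_le hr h', Nat.cast_sub hr, abs_of_nonneg (by omega)]
  · rw [← norm_inv_eq, mul_inv_rev, inv_inv, norm_inv_pre_mul_pre_of_le hr h, Nat.cast_sub hr,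
      abs_of_nonpos (by omega), neg_sub]

lemma exists_cancellation {S X : List (α × Bool)} (hS : IsReduced S) (hX : IsReduced X) :
    ∃ U W Z, S = U ++ W ∧ X = invRev W ++ Z ∧ IsReduced (U ++ Z) := by
  induction S with
  | nil => exact ⟨[], [], X, rfl, rfl, hX⟩
  | cons p S ih =>
    obtain ⟨U, W, Z, rfl, hX', hUZ⟩ := ih (hS.infix (List.suffix_cons _ _).isInfix)
    cases U with
    | cons q U =>
      refine ⟨p :: q :: U, W, Z, rfl, hX', ?_⟩
      exact isReduced_cons_cons.2 ⟨(isReduced_cons_cons.1 hS).1, hUZ⟩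
    | nil =>
      cases Z with
      | nil => exact ⟨[p], W, [], rfl, hX', IsReduced.singleton⟩
      | cons z Z =>
        by_cases hpz : p.1 = z.1 → p.2 = z.2
        · exact ⟨[p], W, z :: Z, rfl, hX', isReduced_cons_cons.2 ⟨hpz, hUZ⟩⟩
        · push Not at hpz
          have hz : z = (p.1, !p.2) := by
            exact Prod.ext hpz.1.symm (Bool.eq_not.2 hpz.2.symm)
          refine ⟨[], p :: W, Z, rfl, ?_, hUZ.infix (List.suffix_cons _ _).isInfix⟩
          rw [hX', hz]
          simp [invRev]

/-- The product `s * x` is formed by cancelling `a'` letters, keeping `a` letters of `s` and `l`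
letters of `x`. -/
structure Cancels (s x : FreeGroup α) (a a' l : ℕ) : Prop where
  norm_right : x.norm = a' + l
  norm_mul : (s * x).norm = a + l
  le_norm_left : a ≤ s.norm
  le_norm_inv : a' ≤ s⁻¹.norm
  mul_pre : ∀ i, s * pre x (a' + i) = pre (s * x) (a + i)
  mul_pre_of_le : ∀ h ≤ a', ∃ r ≤ s.norm, s * pre x h = pre s r
  pre_right : pre x a' = pre s⁻¹ a'
  pre_mul : pre (s * x) a = pre s a
  norm_inv_mul : ∀ g r, a < r → r ≤ (s * x).norm → r ≤ g.norm → pre (s * x) r = pre g r →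
    (s⁻¹ * g).norm + a = g.norm + a'

lemma exists_cancels (s x : FreeGroup α) : ∃ a a' l, Cancels s x a a' l := by
  obtain ⟨U, W, Z, hS, hX, hUZ⟩ := exists_cancellation (isReduced_toWord (x := s))
    (isReduced_toWord (x := x))
  have hinvW : ∀ W : List (α × Bool), mk W * mk (invRev W) = 1 := fun W => by
    rw [← inv_mk, mul_inv_cancel]
  have hs : s = mk U * mk W := by rw [mul_mk, ← hS, mk_toWord]
  have hx : x = mk (invRev W) * mk Z := by rw [mul_mk, ← hX, mk_toWord]
  have hy : s * x = mk (U ++ Z) := by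
    rw [hs, hx, ← mul_mk, mul_assoc, ← mul_assoc (mk W), hinvW, one_mul]
  have hY : (s * x).toWord = U ++ Z := by rw [hy, toWord_mk_of_isReduced hUZ]
  have hlen : ∀ W : List (α × Bool), (invRev W).length = W.length := fun W => invRev_length
  have hSinv : s⁻¹.toWord = invRev W ++ invRev U := by
    rw [toWord_inv, hS, invRev_append]
  refine ⟨U.length, W.length, Z.length, ?_, ?_, ?_, ?_, ?_, ?_, ?_, ?_, ?_⟩
  · rw [FreeGroup.norm, hX, List.length_append, hlen]
  · rw [FreeGroup.norm, hY, List.length_append]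
  · rw [FreeGroup.norm, hS, List.length_append]; omega
  · rw [FreeGroup.norm, hSinv, List.length_append, hlen]; omega
  · intro i
    rw [pre, pre, hX, hY, ← hlen W, List.take_length_add_append, List.take_length_add_append,
      ← mul_mk, ← mul_mk, hs, mul_assoc, ← mul_assoc (mk W), hinvW, one_mul]
  · intro h hh
    refine ⟨U.length + (W.length - h), ?_, ?_⟩
    · rw [FreeGroup.norm, hS, List.length_append]; omega
    · have h1 : (invRev W).take h = invRev (W.drop (W.length - h)) := by
        rw [invRev, invRev, List.take_reverse, List.length_map, List.map_drop]
      rw [pre, pre, hX, List.take_append_of_le_length (by rwa [hlen]), h1, hS,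
        List.take_length_add_append, ← mul_mk, hs]
      conv_lhs => rw [← List.take_append_drop (W.length - h) W, ← mul_mk]
      rw [List.take_append_drop, mul_assoc, mul_assoc, hinvW, mul_one]
  · rw [pre, pre, hX, hSinv, List.take_append_of_le_length (by rw [hlen]),
      List.take_append_of_le_length (by rw [hlen])]
  · rw [pre, pre, hY, hS, List.take_append_of_le_length le_rfl,
      List.take_append_of_le_length le_rfl]
  · intro g r hr hrY hrg hpre
    have h1 : (U ++ Z).take r = g.toWord.take r := by
      rw [← hY, ← toWord_pre, ← toWord_pre, hpre]
    cases Z with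
    | nil =>
      rw [FreeGroup.norm, hY, List.append_nil] at hrY
      omega
    | cons z Z =>
      have h2 : ∃ R, g.toWord = U ++ z :: R := by
        refine ⟨Z.take (r - (U.length + 1)) ++ g.toWord.drop r, ?_⟩
        conv_lhs => rw [← List.take_append_drop r g.toWord, ← h1]
        obtain ⟨k, rfl⟩ : ∃ k, r = U.length + (k + 1) := ⟨r - U.length - 1, by omega⟩
        rw [List.take_length_add_append, List.take_succ_cons, List.append_assoc, List.cons_append]
        congr 5
        omega
      obtain ⟨R, hR⟩ := h2
      have h3 : s⁻¹ * g = mk (invRev W ++ z :: R) := by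
        rw [← mul_mk, ← mk_toWord (x := g), hR, ← mul_mk, hs, mul_inv_rev, inv_mk, inv_mk]
        rw [← inv_mk (L := U)]
        group
      have h4 : IsReduced (invRev W ++ [z] ++ R) := by
        refine IsReduced.append_overlap ?_ ?_ (by simp)
        · refine (isReduced_toWord (x := x)).infix ?_
          rw [hX]
          exact ⟨[], Z, by simp⟩
        · refine (isReduced_toWord (x := g)).infix ?_
          rw [hR]
          exact ⟨U, [], by simp⟩
      rw [List.append_assoc, List.singleton_append] at h4
      rw [FreeGroup.norm, FreeGroup.norm, h3, toWord_mk_of_isReduced h4, hR]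
      simp only [List.length_append, hlen, List.length_cons]
      omega

end Prefix

/-! ### The depth of an element relative to a finite set -/

section Depth

variable {α : Type*} [DecidableEq α]

/-- The set of prefixes of the elements of `P`. -/
def prefixSet (P : Finset (FreeGroup α)) : Finset (FreeGroup α) :=
  P.biUnion fun g => (Finset.range (g.norm + 1)).image (pre g)

lemma mem_prefixSet {P : Finset (FreeGroup α)} {v : FreeGroup α} :
    v ∈ prefixSet P ↔ ∃ g ∈ P, ∃ r ≤ g.norm, pre g r = v := by
  simp [prefixSet]

lemma prefixSet_mono {P P' : Finset (FreeGroup α)} (h : P ⊆ P') : prefixSet P ⊆ prefixSet P' :=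
  Finset.biUnion_subset_biUnion_of_subset_left _ h

lemma pre_mem_prefixSet {P : Finset (FreeGroup α)} {v : FreeGroup α} (hv : v ∈ prefixSet P)
    (r : ℕ) : pre v r ∈ prefixSet P := by
  obtain ⟨g, hg, r', hr', rfl⟩ := mem_prefixSet.1 hv
  exact mem_prefixSet.2 ⟨g, hg, min r r', (min_le_right _ _).trans hr', (pre_pre _ _ _).symm⟩

lemma one_mem_prefixSet {P : Finset (FreeGroup α)} (hP : P.Nonempty) : 1 ∈ prefixSet P := by
  obtain ⟨g, hg⟩ := hP
  exact mem_prefixSet.2 ⟨g, hg, 0, Nat.zero_le _, pre_zero g⟩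

/-- The length of the longest prefix of `x` which is a prefix of an element of `P`. -/
def depth (P : Finset (FreeGroup α)) (x : FreeGroup α) : ℕ :=
  Nat.findGreatest (fun r => pre x r ∈ prefixSet P) x.norm

lemma depth_le_norm (P : Finset (FreeGroup α)) (x : FreeGroup α) : depth P x ≤ x.norm :=
  Nat.findGreatest_le _

lemma pre_depth_mem {P : Finset (FreeGroup α)} (hP : P.Nonempty) (x : FreeGroup α) :
    pre x (depth P x) ∈ prefixSet P := by
  refine Nat.findGreatest_spec (P := fun r => pre x r ∈ prefixSet P) (Nat.zero_le _) ?_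
  rw [pre_zero]
  exact one_mem_prefixSet hP

lemma le_depth {P : Finset (FreeGroup α)} {x : FreeGroup α} {r : ℕ} (hr : r ≤ x.norm)
    (h : pre x r ∈ prefixSet P) : r ≤ depth P x :=
  Nat.le_findGreatest hr h

lemma pre_mem_of_le_depth {P : Finset (FreeGroup α)} (hP : P.Nonempty) {x : FreeGroup α} {r : ℕ}
    (h : r ≤ depth P x) : pre x r ∈ prefixSet P := by
  have := pre_mem_prefixSet (pre_depth_mem hP x) r
  rwa [pre_pre, min_eq_left h] at this

lemma depth_mono {P P' : Finset (FreeGroup α)} (hP : P.Nonempty) (h : P ⊆ P') (x : FreeGroup α) :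
    depth P x ≤ depth P' x :=
  le_depth (depth_le_norm P x) (prefixSet_mono h (pre_depth_mem hP x))

variable {F : Finset (FreeGroup α)}

lemma mul_mem_prefixSet (h1 : 1 ∈ F) {s v : FreeGroup α} (hs : s ∈ F) {n : ℕ}
    (hv : v ∈ prefixSet (F ^ n)) : s * v ∈ prefixSet (F ^ (n + 1)) := by
  obtain ⟨g, hg, r, hr, rfl⟩ := mem_prefixSet.1 hv
  obtain ⟨a, a', l, h⟩ := exists_cancels s g
  rcases le_total r a' with hra | hra
  · obtain ⟨r', hr', he⟩ := h.mul_pre_of_le r hra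
    refine mem_prefixSet.2 ⟨s, ?_, r', hr', he.symm⟩
    have := Finset.pow_subset_pow_right h1 (show 1 ≤ n + 1 by omega)
    rw [pow_one] at this
    exact this hs
  · obtain ⟨i, rfl⟩ := Nat.exists_eq_add_of_le hra
    refine mem_prefixSet.2 ⟨s * g, ?_, a + i, ?_, (h.mul_pre i).symm⟩
    · rw [pow_succ']
      exact Finset.mul_mem_mul hs hg
    · have := h.norm_right
      have := h.norm_mul
      omega

lemma depth_pow_mono (h1 : 1 ∈ F) (x : FreeGroup α) : Monotone fun n => depth (F ^ n) x :=
  fun _ _ h => depth_mono ⟨1, Finset.one_mem_pow h1⟩ (Finset.pow_subset_pow_right h1 h) x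

variable {s x : FreeGroup α} {a a' l : ℕ}

lemma Cancels.le_depth_mul (h : Cancels s x a a' l) (h1 : 1 ∈ F) (hs : s ∈ F) {n : ℕ}
    (hn : 1 ≤ n) : a ≤ depth (F ^ n) (s * x) := by
  refine le_depth (by rw [h.norm_mul]; omega) ?_
  rw [h.pre_mul]
  have := Finset.pow_subset_pow_right h1 hn
  rw [pow_one] at this
  exact mem_prefixSet.2 ⟨s, this hs, a, h.le_norm_left, rfl⟩

lemma Cancels.le_depth (h : Cancels s x a a' l) (h1 : 1 ∈ F) (hs : s⁻¹ ∈ F) {n : ℕ}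
    (hn : 1 ≤ n) : a' ≤ depth (F ^ n) x := by
  refine FreeProductExactness.le_depth (by rw [h.norm_right]; omega) ?_
  rw [h.pre_right]
  have := Finset.pow_subset_pow_right h1 hn
  rw [pow_one] at this
  exact mem_prefixSet.2 ⟨s⁻¹, this hs, a', h.le_norm_inv, rfl⟩

lemma Cancels.depth_add_le (h : Cancels s x a a' l) (h1 : 1 ∈ F) (hs : s ∈ F) (hs' : s⁻¹ ∈ F)
    {n : ℕ} (hn : 1 ≤ n) : depth (F ^ n) x + a ≤ depth (F ^ (n + 1)) (s * x) + a' := by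
  obtain ⟨i, hi⟩ := Nat.exists_eq_add_of_le (h.le_depth h1 hs' hn)
  have h2 := mul_mem_prefixSet h1 hs (pre_depth_mem ⟨1, Finset.one_mem_pow h1⟩ x (P := F ^ n))
  rw [hi, h.mul_pre] at h2
  have h3 := depth_le_norm (F ^ n) x
  have := h.norm_right
  have := FreeProductExactness.le_depth (by rw [h.norm_mul]; omega) h2
  omega

lemma Cancels.depth_mul_add_le (h : Cancels s x a a' l) (h1 : 1 ∈ F) (hs : s ∈ F) (hs' : s⁻¹ ∈ F)
    {n : ℕ} (hn : 1 ≤ n) : depth (F ^ n) (s * x) + a' ≤ depth (F ^ (n + 1)) x + a := by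
  obtain ⟨i, hi⟩ := Nat.exists_eq_add_of_le (h.le_depth_mul h1 hs hn)
  have h2 := mul_mem_prefixSet h1 hs'
    (pre_depth_mem ⟨1, Finset.one_mem_pow h1⟩ (s * x) (P := F ^ n))
  rw [hi, ← h.mul_pre, inv_mul_cancel_left] at h2
  have h3 := depth_le_norm (F ^ n) (s * x)
  have := h.norm_mul
  have := FreeProductExactness.le_depth (by rw [h.norm_right]; omega) h2
  omega

/-- The possible changes of length when an element of `F` acts. -/
def shifts (F P : Finset (FreeGroup α)) : Finset ℤ :=
  (F ×ˢ P).image fun p => (p.2.norm : ℤ) - (p.1⁻¹ * p.2).norm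

lemma card_shifts_le (F P : Finset (FreeGroup α)) : (shifts F P).card ≤ F.card * P.card :=
  Finset.card_image_le.trans (Finset.card_product _ _).le

lemma Cancels.sub_mem_shifts (h : Cancels s x a a' l) (hs : s ∈ F) {P : Finset (FreeGroup α)}
    (hP : P.Nonempty) (hlt : a < depth P (s * x)) : (a : ℤ) - a' ∈ shifts F P := by
  obtain ⟨g, hg, r, hr, he⟩ := mem_prefixSet.1 (pre_depth_mem hP (s * x))
  have hd := depth_le_norm P (s * x)
  have hr' : r = depth P (s * x) := by rw [← norm_pre hr, he, norm_pre hd]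
  have := h.norm_inv_mul g r (hr' ▸ hlt) (hr' ▸ hd) hr (by rw [he, hr'])
  refine Finset.mem_image.2 ⟨(s, g), Finset.mem_product.2 ⟨hs, hg⟩, ?_⟩
  simp only
  omega

/-- The length of the longest common prefix. -/
def commonLength (g g' : FreeGroup α) : ℕ :=
  Nat.findGreatest (fun r => r ≤ g'.norm ∧ pre g r = pre g' r) g.norm

/-- The lengths of the longest common prefixes of elements of `P`. -/
def branchHeights (P : Finset (FreeGroup α)) : Finset ℤ :=
  (P ×ˢ P).image fun p => (commonLength p.1 p.2 : ℤ)

lemma card_branchHeights_le (P : Finset (FreeGroup α)) :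
    (branchHeights P).card ≤ P.card * P.card :=
  Finset.card_image_le.trans (Finset.card_product _ _).le

lemma depth_mem_branchHeights {P P' : Finset (FreeGroup α)} (hP : P.Nonempty) (h : P ⊆ P')
    {x : FreeGroup α} (hlt : depth P x < depth P' x) :
    (depth P x : ℤ) ∈ branchHeights P' := by
  obtain ⟨g, hg, r, hr, he⟩ := mem_prefixSet.1 (pre_depth_mem hP x)
  obtain ⟨g', hg', r', hr', he'⟩ := mem_prefixSet.1 (pre_depth_mem (hP.mono h) x)
  have hd := depth_le_norm P x
  have hd' := depth_le_norm P' x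
  have hrd : r = depth P x := by rw [← norm_pre hr, he, norm_pre hd]
  have hrd' : r' = depth P' x := by rw [← norm_pre hr', he', norm_pre hd']
  have hpre' : ∀ q ≤ r', pre g' q = pre x q := fun q hq => by
    have := congrArg (pre · q) he'
    simp only [pre_pre] at this
    rwa [min_eq_left hq, ← hrd', min_eq_left hq] at this
  have hpre : ∀ q ≤ r, pre g q = pre x q := fun q hq => by
    have := congrArg (pre · q) he
    simp only [pre_pre] at this
    rwa [min_eq_left hq, ← hrd, min_eq_left hq] at this
  refine Finset.mem_image.2 ⟨(g, g'), Finset.mem_product.2 ⟨h hg, hg'⟩, ?_⟩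
  simp only [Nat.cast_inj]
  refine le_antisymm ?_ ?_
  · by_contra! hc
    set q := commonLength g g' with hq
    have hspec := Nat.findGreatest_spec (P := fun r => r ≤ g'.norm ∧ pre g r = pre g' r)
      (Nat.zero_le g.norm) ⟨Nat.zero_le _, by simp⟩
    have hqg : q ≤ g.norm := Nat.findGreatest_le _
    have h3 : pre g q = pre g' q := hspec.2
    have h4 : pre g (depth P x + 1) = pre g' (depth P x + 1) := by
      have := congrArg (pre · (depth P x + 1)) h3
      simpa only [pre_pre, min_eq_left (Nat.succ_le_of_lt hc)] using this
    rw [hpre' _ (by omega)] at h4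
    have := le_depth (P := P) (x := x) (r := depth P x + 1) (by omega)
      (h4 ▸ mem_prefixSet.2 ⟨g, hg, _, by omega, rfl⟩)
    omega
  · refine Nat.le_findGreatest (by omega) ⟨by omega, ?_⟩
    rw [hpre _ (by omega), hpre' _ (by omega)]

end Depth

/-! ### Random heights -/

section Height

/-- The height selected by a depth profile `d`: the depth `d I` itself if the profile is constant
on the window of radius `i` about `I`, and otherwise the highest point of `D` below `d N`. -/
noncomputable def height (d : ℕ → ℕ) (D : Finset ℤ) (I i N : ℕ) : ℕ :=
  open Classical in
  if d (I - i) = d (I + i) then d I else (sSup {h : ℤ | h ∈ D ∧ h ≤ d N}).toNat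

lemma exists_isGreatest {D : Finset ℤ} {c h : ℤ} (hD : h ∈ D) (hc : h ≤ c) :
    ∃ r, IsGreatest {h : ℤ | h ∈ D ∧ h ≤ c} r := by
  obtain ⟨r, hr, hmax⟩ := Finset.exists_max_image (D.filter (· ≤ c)) id
    ⟨h, Finset.mem_filter.2 ⟨hD, hc⟩⟩
  exact ⟨r, by simpa using hr, fun q hq => hmax q (by simpa using hq)⟩

lemma height_le_max {d : ℕ → ℕ} {D : Finset ℤ} {I i N M : ℕ} (hd : Monotone d) (hI : I ≤ M)
    (hN : N ≤ M) (h : d (I - i) ≠ d (I + i) → ∃ h ∈ D, h ≤ d N) :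
    height d D I i N ≤ d M := by
  unfold height
  split_ifs with hs
  · exact hd hI
  · obtain ⟨h, hD, hc⟩ := h hs
    obtain ⟨r, hr⟩ := exists_isGreatest hD hc
    rw [hr.csSup_eq]
    have := hr.1.2
    have := hd hN
    omega

lemma height_eq_of_const {d e : ℕ → ℕ} {D D' : Finset ℤ} {a a' I i N N' : ℕ} (hd : Monotone d)
    (he : Monotone e) (ha' : ∀ n, 1 ≤ n → a' ≤ d n)
    (hde : ∀ n, 1 ≤ n → d n + a ≤ e (n + 1) + a') (hed : ∀ n, 1 ≤ n → e n + a' ≤ d (n + 1) + a)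
    (hi : 0 < i) (hI : i < I) (hsd : d (I - i) = d (I + i)) (hse : e (I - i) = e (I + i)) :
    ∃ k, height d D I i N = a' + k ∧ height e D' I i N' = a + k := by
  unfold height
  rw [if_pos hsd, if_pos hse]
  have h1 := ha' I (by omega)
  have h2 := hde I (by omega)
  have h3 := hed I (by omega)
  have h4 : d (I + 1) ≤ d (I + i) := hd (by omega)
  have h5 : d (I - i) ≤ d I := hd (by omega)
  have h6 : e (I + 1) ≤ e (I + i) := he (by omega)
  have h7 : e (I - i) ≤ e I := he (by omega)
  exact ⟨d I - a', by omega, by omega⟩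

lemma height_eq_of_not_const {d e : ℕ → ℕ} {D D' : Finset ℤ} {a a' I i N : ℕ}
    (he : Monotone e)
    (hde : ∀ n, 1 ≤ n → d n + a ≤ e (n + 1) + a') (hed : ∀ n, 1 ≤ n → e n + a' ≤ d (n + 1) + a)
    (hsd : d (I - i) ≠ d (I + i)) (hse : e (I - i) ≠ e (I + i))
    (hD : ∀ h, h ∈ D ↔ h + (a - a') ∈ D') {h₀ : ℤ} (h₀D : h₀ ∈ D) (h₀a : (a' : ℤ) ≤ h₀)
    (h₀d : h₀ ≤ d (N + 2)) (hN : 0 < N)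
    (hjump : (D'.filter (· ≤ (e (N + 3) : ℤ))).card ≤ (D'.filter (· ≤ (e (N + 1) : ℤ))).card) :
    ∃ k, height d D I i (N + 2) = a' + k ∧ height e D' I i (N + 2) = a + k := by
  unfold height
  rw [if_neg hsd, if_neg hse]
  have hfil : D'.filter (· ≤ (e (N + 1) : ℤ)) = D'.filter (· ≤ (e (N + 3) : ℤ)) := by
    refine Finset.eq_of_subset_of_card_le (fun h hh => ?_) hjump
    rw [Finset.mem_filter] at hh ⊢
    have : e (N + 1) ≤ e (N + 3) := he (by omega)
    exact ⟨hh.1, by omega⟩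
  have hdown : ∀ h ∈ D', h ≤ (e (N + 3) : ℤ) → h ≤ (e (N + 1) : ℤ) := fun h hh hle => by
    have h3 : h ∈ D'.filter (· ≤ (e (N + 3) : ℤ)) := Finset.mem_filter.2 ⟨hh, hle⟩
    rw [← hfil] at h3
    exact (Finset.mem_filter.1 h3).2
  obtain ⟨r, hr⟩ := exists_isGreatest h₀D h₀d
  have hr0 := hr.2 ⟨h₀D, h₀d⟩
  have e1 : e (N + 1) ≤ e (N + 2) := he (by omega)
  have e2 : e (N + 2) ≤ e (N + 3) := he (by omega)
  have h1 : d (N + 2) + a ≤ e (N + 3) + a' := hde (N + 2) (by omega)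
  have h2 : e (N + 1) + a' ≤ d (N + 2) + a := hed (N + 1) (by omega)
  have hr' : IsGreatest {h : ℤ | h ∈ D' ∧ h ≤ e (N + 2)} (r + (a - a')) := by
    refine ⟨⟨(hD r).1 hr.1.1, ?_⟩, fun h hh => ?_⟩
    · have h3 := hr.1.2
      have h4 := hdown _ ((hD r).1 hr.1.1) (by omega)
      omega
    · have h3 := hdown h hh.1 (by have := hh.2; omega)
      have h4 : h - (a - a') ∈ {h : ℤ | h ∈ D ∧ h ≤ d (N + 2)} :=
        ⟨(hD _).2 (by simpa using hh.1), by omega⟩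
      have := hr.2 h4
      omega
  rw [hr.csSup_eq, hr'.csSup_eq]
  exact ⟨(r - a').toNat, by omega, by omega⟩

lemma card_filter_lt_add_two_le {f : ℕ → ℕ} (hf : Monotone f) (R : ℕ) :
    ((Finset.range R).filter fun n => f n < f (n + 2)).card + f 0 + f 1 ≤ f R + f (R + 1) := by
  induction R with
  | zero => simp
  | succ R ih =>
    have h1 : f R ≤ f (R + 2) := hf (by omega)
    rw [Finset.range_add_one, Finset.filter_insert]
    split_ifs with h
    · rw [Finset.card_insert_of_notMem (by simp)]
      rw [show R + 1 + 1 = R + 2 by ring]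
      omega
    · rw [show R + 1 + 1 = R + 2 by ring]
      omega

/-- At most one window radius separates two interleaved profiles. -/
lemma card_filter_const_ne_le {d e : ℕ → ℕ} {a a' I : ℕ} (hd : Monotone d) (he : Monotone e)
    (hde : ∀ n, 1 ≤ n → d n + a ≤ e (n + 1) + a')
    (hed : ∀ n, 1 ≤ n → e n + a' ≤ d (n + 1) + a) :
    ((Finset.univ : Finset (Fin I)).filter fun i : Fin I =>
      ¬ (d (I - i) = d (I + i) ↔ e (I - i) = e (I + i))).card ≤ 1 := by
  have key : ∀ (d e : ℕ → ℕ) (a a' : ℕ), Monotone d → Monotone e →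
      (∀ n, 1 ≤ n → d n + a ≤ e (n + 1) + a') → (∀ n, 1 ≤ n → e n + a' ≤ d (n + 1) + a) →
      ∀ i i' : ℕ, i < i' → i' < I → d (I - i') = d (I + i') →
      d (I - i) = d (I + i) ∧ e (I - i) = e (I + i) := by
    intro d e a a' hd he hde hed i i' hi hi' hc
    have h1 : d (I - i') ≤ d (I - i - 1) := hd (by omega)
    have h2 : d (I - i - 1) ≤ d (I - i) := hd (by omega)
    have h3 : d (I - i) ≤ d (I + i) := hd (by omega)
    have h4 : d (I + i) ≤ d (I + i + 1) := hd (by omega)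
    have h5 : d (I + i + 1) ≤ d (I + i') := hd (by omega)
    have h6 : e (I - i) ≤ e (I + i) := he (by omega)
    have h7 := hed (I + i) (by omega)
    have h8 := hde (I - i - 1) (by omega)
    rw [show I - i - 1 + 1 = I - i by omega] at h8
    exact ⟨by omega, by omega⟩
  have key2 : ∀ i i' : Fin I, i < i' →
      (d (I - i') = d (I + i') ∨ e (I - i') = e (I + i')) →
      (d (I - i) = d (I + i) ↔ e (I - i) = e (I + i)) := by
    intro i i' hi hc
    rcases hc with hc | hc
    · have := key d e a a' hd he hde hed i i' hi i'.2 hc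
      tauto
    · have := key e d a' a he hd hed hde i i' hi i'.2 hc
      tauto
  rw [Finset.card_le_one]
  intro i hi i' hi'
  rw [Finset.mem_filter] at hi hi'
  rcases lt_trichotomy i i' with h | h | h
  · exact absurd (key2 i i' h (by tauto)) hi.2
  · exact h
  · exact absurd (key2 i' i h (by tauto)) hi'.2

end Height

section Count

lemma card_filter_apply_eq_mul_le {C : Type*} [Fintype C] [DecidableEq C] {K : ℕ} (b : C)
    (k : Fin K) : ((Finset.univ : Finset (C → Fin K)).filter fun f => f b = k).card * K
      ≤ Fintype.card (C → Fin K) := by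
  have h : Function.Injective fun p : {f : C → Fin K // f b = k} × Fin K =>
      Function.update p.1.1 b p.2 := by
    rintro ⟨⟨f, hf⟩, i⟩ ⟨⟨g, hg⟩, j⟩ hfg
    have h1 : i = j := by simpa using congrFun hfg b
    refine Prod.ext (Subtype.ext (funext fun c => ?_)) h1
    by_cases hc : c = b
    · subst hc; exact hf.trans hg.symm
    · simpa [hc] using congrFun hfg c
  have := Fintype.card_le_of_injective _ h
  rwa [Fintype.card_prod, Fintype.card_fin, Fintype.card_subtype] at this

lemma card_filter_prod_le {X Y : Type*} [Fintype X] [Fintype Y] (p : X → Y → Prop)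
    [∀ x y, Decidable (p x y)] {k : ℕ}
    (h : ∀ x, ((Finset.univ : Finset Y).filter (p x)).card ≤ k) :
    ((Finset.univ : Finset (X × Y)).filter fun q => p q.1 q.2).card ≤ Fintype.card X * k := by
  rw [Finset.card_filter, Fintype.sum_prod_type]
  refine (Finset.sum_le_card_nsmul _ _ k fun x _ => ?_).trans_eq (by simp)
  rw [← Finset.card_filter]
  exact h x

end Count

section HeightSet

variable {C H : Finset ℤ} {K : ℕ}

/-- The integer with coordinates `f` in terms of the elements of `C`. -/
def translation (f : C → Fin (K + 1)) : ℤ := ∑ c, ((f c : ℕ) : ℤ) * c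

lemma translation_add_single {f : C → Fin (K + 1)} {b : C} (hb : f b ≠ Fin.last K) :
    translation (f + Pi.single b 1) = translation f + b := by
  have h : ∀ c, (((f + Pi.single b 1 : C → Fin (K + 1)) c : ℕ) : ℤ) * c
      = ((f c : ℕ) : ℤ) * c + if c = b then (c : ℤ) else 0 := by
    intro c
    by_cases hc : c = b
    · subst hc
      rw [Pi.add_apply, Pi.single_eq_same, Fin.val_add_one, if_neg hb]
      simp [add_mul]
    · simp [hc]
  simp only [translation, h, Finset.sum_add_distrib]
  simp

/-- A finite set of heights containing `H`, translated according to `f`. -/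
def heightSet (H : Finset ℤ) (f : C → Fin (K + 1)) : Finset ℤ :=
  (H ×ˢ (Finset.univ : Finset (C → Fin (K + 1)))).image
    fun p => p.1 + translation f - translation p.2

lemma subset_heightSet (f : C → Fin (K + 1)) : H ⊆ heightSet H f := fun h hh =>
  Finset.mem_image.2 ⟨(h, f), Finset.mem_product.2 ⟨hh, Finset.mem_univ _⟩, by simp⟩

lemma card_heightSet_le (f : C → Fin (K + 1)) :
    (heightSet H f).card ≤ H.card * (K + 1) ^ C.card := by
  refine Finset.card_image_le.trans (le_of_eq ?_)
  simp [Finset.card_product]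

lemma mem_heightSet_iff {f : C → Fin (K + 1)} {b : C} (hb : f b ≠ Fin.last K) (h : ℤ) :
    h ∈ heightSet H f ↔ h + b ∈ heightSet H (f + Pi.single b 1) := by
  simp only [heightSet, Finset.mem_image, translation_add_single hb]
  refine exists_congr fun p => and_congr_right fun _ => ?_
  constructor <;> intro h <;> omega

end HeightSet

section Selection

universe u

lemma exists_lt_succ_of_ne {d : ℕ → ℕ} {p q : ℕ} (hpq : p ≤ q) (h : d p ≠ d q) (hd : Monotone d) :
    ∃ n, p ≤ n ∧ n < q ∧ d n < d (n + 1) := by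
  by_contra! hc
  refine h ?_
  induction q, hpq using Nat.le_induction with
  | base => rfl
  | succ q hpq ih =>
    have h1 := hc q hpq (by omega)
    have h2 := hd (Nat.le_succ q)
    by_cases h3 : d p = d q
    · exact h3.trans (le_antisymm h2 h1)
    · exact absurd (ih h3 fun n hn hnq => hc n hn (by omega)) h3

lemma branchHeights_mono {α : Type u} [DecidableEq α] {P P' : Finset (FreeGroup α)} (h : P ⊆ P') :
    branchHeights P ⊆ branchHeights P' :=
  Finset.image_subset_image (Finset.product_subset_product h h)

lemma exists_branchHeight {α : Type u} [DecidableEq α] {F : Finset (FreeGroup α)} (h1 : 1 ∈ F)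
    {x : FreeGroup α} {I i : ℕ} (hi : i < I)
    (h : depth (F ^ (I - i)) x ≠ depth (F ^ (I + i)) x) :
    ∃ h ∈ branchHeights (F ^ (2 * I)),
      (depth (F ^ 1) x : ℤ) ≤ h ∧ h ≤ depth (F ^ (2 * I)) x := by
  have hmono := depth_pow_mono h1 x
  obtain ⟨n, hn, hn', hlt⟩ := exists_lt_succ_of_ne (d := fun n => depth (F ^ n) x) (by omega) h hmono
  refine ⟨depth (F ^ n) x, ?_, ?_, ?_⟩
  · exact branchHeights_mono (Finset.pow_subset_pow_right h1 (by omega))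
      (depth_mem_branchHeights ⟨1, Finset.one_mem_pow h1⟩
        (Finset.pow_subset_pow_right h1 (Nat.le_succ n)) hlt)
  · exact_mod_cast hmono (show 1 ≤ n by omega)
  · exact_mod_cast hmono (show n ≤ 2 * I by omega)

/-- Almost equivariant random prefixes: each element of a free group is assigned a random prefix
of itself which is also a prefix of an element of `F ^ M`. -/
lemma exists_random_prefix (m j : ℕ) : ∃ M : ℕ, ∀ (α : Type u) [DecidableEq α]
    (F : Finset (FreeGroup α)), 1 ∈ F → (∀ t ∈ F, t⁻¹ ∈ F) → F.card ≤ m →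
    ∃ ζ : FreeGroup α → FreeGroup α →₀ ℝ, (∀ x, IsProb (ζ x)) ∧
      (∀ x, ∀ v ∈ (ζ x).support, v ∈ prefixSet (F ^ M)) ∧
      ∀ s ∈ F, ∀ x, l1 (ζ (s * x) - (ζ x).mapDomain (s * ·)) ≤ 1 / ((j : ℝ) + 1) := by
  obtain ⟨I, hI⟩ : ∃ I, I = 12 * (j + 1) := ⟨_, rfl⟩
  obtain ⟨K, hK⟩ : ∃ K, K = 6 * j + 5 := ⟨_, rfl⟩
  obtain ⟨A, hA⟩ : ∃ A, A = m ^ (2 * I) * m ^ (2 * I) * (K + 1) ^ (m * m ^ (2 * I)) + 1 := ⟨_, rfl⟩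
  obtain ⟨R, hR⟩ : ∃ R, R = 12 * (j + 1) * A := ⟨_, rfl⟩
  have hIpos : 0 < I := by omega
  have hRpos : 0 < R := by
    rw [hR]
    exact Nat.mul_pos (by omega) (hA ▸ Nat.succ_pos _)
  refine ⟨2 * I + R + 2, fun α _ F h1 hinv hm => ?_⟩
  let C := shifts F (F ^ (2 * I))
  let H := branchHeights (F ^ (2 * I))
  have hPcard : (F ^ (2 * I)).card ≤ m ^ (2 * I) :=
    Finset.card_pow_le.trans (Nat.pow_le_pow_left hm _)
  have hHcard : H.card ≤ m ^ (2 * I) * m ^ (2 * I) :=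
    (card_branchHeights_le _).trans (Nat.mul_le_mul hPcard hPcard)
  have hCcard : C.card ≤ m * m ^ (2 * I) :=
    (card_shifts_le _ _).trans (Nat.mul_le_mul hm hPcard)
  have hDcard : ∀ f : C → Fin (K + 1), (heightSet H f).card ≤ A := fun f => by
    refine (card_heightSet_le f).trans ?_
    have := Nat.mul_le_mul hHcard (Nat.pow_le_pow_right (Nat.succ_pos K) hCcard)
    rw [hA]; exact this.trans (Nat.le_succ _)
  let d : FreeGroup α → ℕ → ℕ := fun x n => depth (F ^ n) x
  have hd : ∀ x, Monotone (d x) := fun x => depth_pow_mono h1 x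
  let Ω := (Fin I × (C → Fin (K + 1))) × Fin R
  let z : FreeGroup α → Ω → FreeGroup α := fun x ω =>
    pre x (height (d x) (heightSet H ω.1.2) I ω.1.1 (2 * I + ω.2 + 2))
  have : Nonempty (Fin I) := ⟨⟨0, hIpos⟩⟩
  have : Nonempty (Fin R) := ⟨⟨0, hRpos⟩⟩
  have : Nonempty Ω := inferInstance
  refine ⟨fun x => (unif Finset.univ).mapDomain (z x),
    fun x => (isProb_unif Finset.univ_nonempty).mapDomain _, fun x v hv => ?_, fun s hs x => ?_⟩
  · obtain ⟨ω, -, rfl⟩ := mem_support_mapDomain hv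
    refine pre_mem_of_le_depth ⟨1, Finset.one_mem_pow h1⟩ ?_
    have hω := ω.2.2
    refine height_le_max (d := d x) (M := 2 * I + R + 2) (hd x) (by omega) (by omega)
      fun h => ?_
    obtain ⟨h, hH, -, hle⟩ := exists_branchHeight h1 ω.1.1.2 h
    refine ⟨h, subset_heightSet _ hH, hle.trans ?_⟩
    exact_mod_cast hd x (show 2 * I ≤ 2 * I + ω.2 + 2 by omega)
  obtain ⟨a, a', l, hc⟩ := exists_cancels s x
  have hs' := hinv s hs
  have hde : ∀ n, 1 ≤ n → d x n + a ≤ d (s * x) (n + 1) + a' := fun n hn =>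
    hc.depth_add_le h1 hs hs' hn
  have hed : ∀ n, 1 ≤ n → d (s * x) n + a' ≤ d x (n + 1) + a := fun n hn =>
    hc.depth_mul_add_le h1 hs hs' hn
  have ha' : ∀ n, 1 ≤ n → a' ≤ d x n := fun n hn => hc.le_depth h1 hs' hn
  let N : Finset (Fin I) := Finset.univ.filter (fun i : Fin I => i = ⟨0, hIpos⟩) ∪
    Finset.univ.filter fun i : Fin I =>
      ¬ (d x (I - i) = d x (I + i) ↔ d (s * x) (I - i) = d (s * x) (I + i))
  have hNcard : N.card ≤ 2 := by
    refine (Finset.card_union_le _ _).trans (add_le_add (b := 1) (d := 1) ?_ ?_)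
    · rw [Finset.filter_eq' _ _, if_pos (Finset.mem_univ _), Finset.card_singleton]
    · exact card_filter_const_ne_le (hd x) (hd (s * x)) hde hed
  have hN : ∀ i, i ∉ N → 0 < (i : ℕ) ∧
      (d x (I - i) = d x (I + i) ↔ d (s * x) (I - i) = d (s * x) (I + i)) := by
    intro i hi
    simp only [N, Finset.mem_union, Finset.mem_filter, Finset.mem_univ, true_and, not_or,
      not_not] at hi
    refine ⟨Nat.pos_of_ne_zero fun h => hi.1 (Fin.ext h), hi.2⟩
  let B₁ : Finset Ω := (N ×ˢ Finset.univ) ×ˢ Finset.univ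
  have hΩ : Fintype.card Ω = I * Fintype.card (C → Fin (K + 1)) * R := by
    simp only [Ω, Fintype.card_prod, Fintype.card_fin]
  have hB₁ : B₁.card * (6 * (j + 1)) ≤ Fintype.card Ω := by
    rw [hΩ, Finset.card_product, Finset.card_product, Finset.card_univ, Finset.card_univ,
      Fintype.card_fin]
    calc N.card * Fintype.card (C → Fin (K + 1)) * R * (6 * (j + 1))
        ≤ 2 * Fintype.card (C → Fin (K + 1)) * R * (6 * (j + 1)) := by gcongr
      _ = I * Fintype.card (C → Fin (K + 1)) * R := by rw [hI]; ring
  have hconst : ∀ ω : Ω, ω ∉ B₁ → d x (I - ω.1.1) = d x (I + ω.1.1) →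
      ∀ ω' : Ω, ω'.1.1 = ω.1.1 → z (s * x) ω' = s * z x ω := by
    intro ω hω hst ω' hω'
    have hi : ω.1.1 ∉ N := fun h => hω
      (Finset.mem_product.2 ⟨Finset.mem_product.2 ⟨h, Finset.mem_univ _⟩, Finset.mem_univ _⟩)
    obtain ⟨k, hk, hk'⟩ := height_eq_of_const (D := heightSet H ω.1.2) (D' := heightSet H ω'.1.2)
      (N := 2 * I + ω.2 + 2) (N' := 2 * I + ω'.2 + 2) (hd x) (hd (s * x)) ha' hde hed
      (hN _ hi).1 ω.1.1.2 hst ((hN _ hi).2.1 hst)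
    simp only [z]
    rw [hω', hk, hk', hc.mul_pre]
  have hshift : ∀ ω : Ω, ω ∉ B₁ → d x (I - ω.1.1) ≠ d x (I + ω.1.1) → (a : ℤ) - a' ∈ C := by
    intro ω hω hst
    have hi : ω.1.1 ∉ N := fun h => hω
      (Finset.mem_product.2 ⟨Finset.mem_product.2 ⟨h, Finset.mem_univ _⟩, Finset.mem_univ _⟩)
    refine hc.sub_mem_shifts hs ⟨1, Finset.one_mem_pow h1⟩ ?_
    have h2 : a ≤ d (s * x) (I - ω.1.1) := hc.le_depth_mul h1 hs (by omega)
    have h3 : d (s * x) (I - ω.1.1) ≤ d (s * x) (I + ω.1.1) := hd _ (by omega)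
    have h4 : d (s * x) (I + ω.1.1) ≤ d (s * x) (2 * I) := hd _ (by omega)
    have h5 : d (s * x) (I - ω.1.1) ≠ d (s * x) (I + ω.1.1) := fun h => hst ((hN _ hi).2.2 h)
    change a < d (s * x) (2 * I)
    omega
  suffices h : ∃ (σ : Equiv.Perm Ω) (B : Finset Ω), B.card * (2 * (j + 1)) ≤ Fintype.card Ω ∧
      ∀ ω, ω ∉ B → z (s * x) (σ ω) = s * z x ω by
    obtain ⟨σ, B, hBcard, hB⟩ := h
    rw [← Finsupp.mapDomain_comp]
    refine (l1_mapDomain_unif_sub_le _ _ σ hB).trans ?_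
    have hpos : (0 : ℝ) < Fintype.card Ω := by exact_mod_cast Fintype.card_pos
    rw [div_le_div_iff₀ hpos (by positivity)]
    have : (B.card : ℝ) * (2 * (j + 1)) ≤ Fintype.card Ω := by exact_mod_cast hBcard
    linarith
  by_cases hb : (a : ℤ) - a' ∈ C
  swap
  · refine ⟨Equiv.refl _, B₁, by nlinarith, fun ω hω => hconst ω hω ?_ _ rfl⟩
    by_contra h
    exact hb (hshift ω hω h)
  let τ : Equiv.Perm (C → Fin (K + 1)) := Equiv.addRight (Pi.single ⟨_, hb⟩ 1)
  let σ : Equiv.Perm Ω := Equiv.prodCongr (Equiv.prodCongr (Equiv.refl _) τ) (Equiv.refl _)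
  let L : Finset (C → Fin (K + 1)) := Finset.univ.filter fun f => f ⟨_, hb⟩ = Fin.last K
  let B₂ : Finset Ω := (Finset.univ ×ˢ L) ×ˢ Finset.univ
  let jump : Fin I × (C → Fin (K + 1)) → Fin R → Prop := fun p n =>
    ((heightSet H (τ p.2)).filter (· ≤ (d (s * x) (2 * I + n + 1) : ℤ))).card
      < ((heightSet H (τ p.2)).filter (· ≤ (d (s * x) (2 * I + n + 3) : ℤ))).card
  let B₃ : Finset Ω := Finset.univ.filter fun ω => jump ω.1 ω.2
  have hB₂ : B₂.card * (6 * (j + 1)) ≤ Fintype.card Ω := by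
    have hL : L.card * (K + 1) ≤ Fintype.card (C → Fin (K + 1)) :=
      card_filter_apply_eq_mul_le _ _
    rw [hΩ, Finset.card_product, Finset.card_product, Finset.card_univ, Finset.card_univ,
      Fintype.card_fin, Fintype.card_fin]
    have hK' : 6 * (j + 1) = K + 1 := by omega
    calc I * L.card * R * (6 * (j + 1)) = I * (L.card * (K + 1)) * R := by rw [hK']; ring
      _ ≤ _ := by gcongr
  have hB₃ : B₃.card * (6 * (j + 1)) ≤ Fintype.card Ω := by
    have h2 : ∀ p, ((Finset.univ : Finset (Fin R)).filter (jump p)).card ≤ 2 * A := by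
      intro p
      let f : ℕ → ℕ := fun n =>
        ((heightSet H (τ p.2)).filter (· ≤ (d (s * x) (2 * I + n + 1) : ℤ))).card
      have hf : Monotone f := fun n n' hn => by
        refine Finset.card_le_card fun h hh => ?_
        rw [Finset.mem_filter] at hh ⊢
        refine ⟨hh.1, hh.2.trans ?_⟩
        exact_mod_cast hd (s * x) (show 2 * I + n + 1 ≤ 2 * I + n' + 1 by omega)
      have hfA : ∀ n, f n ≤ A := fun n => (Finset.card_filter_le _ _).trans (hDcard _)
      have h3 := card_filter_lt_add_two_le hf R
      have h4 : ((Finset.univ : Finset (Fin R)).filter (jump p)).card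
          ≤ ((Finset.range R).filter fun n => f n < f (n + 2)).card := by
        refine Finset.card_le_card_of_injOn Fin.val (fun n hn => ?_) Fin.val_injective.injOn
        simp only [Finset.coe_filter, Finset.mem_univ, true_and, Set.mem_ofPred_eq] at hn
        simp only [Finset.coe_filter, Finset.mem_range, Set.mem_ofPred_eq]
        exact ⟨n.2, hn⟩
      have := hfA R
      have := hfA (R + 1)
      omega
    have h5 := card_filter_prod_le jump h2
    rw [hΩ]
    calc B₃.card * (6 * (j + 1))
        ≤ Fintype.card (Fin I × (C → Fin (K + 1))) * (2 * A) * (6 * (j + 1)) :=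
          Nat.mul_le_mul_right _ h5
      _ = I * Fintype.card (C → Fin (K + 1)) * R := by
          rw [Fintype.card_prod, Fintype.card_fin, hR]; ring
  refine ⟨σ, B₁ ∪ B₂ ∪ B₃, ?_, fun ω hω => ?_⟩
  · have h2 := Finset.card_union_le (B₁ ∪ B₂) B₃
    have h3 := Finset.card_union_le B₁ B₂
    nlinarith
  · rw [Finset.mem_union, Finset.mem_union, not_or, not_or] at hω
    obtain ⟨⟨hω₁, hω₂⟩, hω₃⟩ := hω
    by_cases hst : d x (I - ω.1.1) = d x (I + ω.1.1)
    · exact hconst ω hω₁ hst _ rfl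
    have hi : ω.1.1 ∉ N := fun h => hω₁
      (Finset.mem_product.2 ⟨Finset.mem_product.2 ⟨h, Finset.mem_univ _⟩, Finset.mem_univ _⟩)
    have hlast : ω.1.2 ⟨_, hb⟩ ≠ Fin.last K := fun h => hω₂
      (Finset.mem_product.2 ⟨Finset.mem_product.2 ⟨Finset.mem_univ _, Finset.mem_filter.2 ⟨Finset.mem_univ _, h⟩⟩, Finset.mem_univ _⟩)
    have hjump : ¬ jump ω.1 ω.2 := fun h => hω₃ (by simp [B₃, h])
    obtain ⟨h₀, h₀H, h₀a, h₀d⟩ := exists_branchHeight h1 ω.1.1.2 hst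
    have h₀a' : (a' : ℤ) ≤ depth (F ^ 1) x := by exact_mod_cast ha' 1 le_rfl
    have h₀d' : (depth (F ^ (2 * I)) x : ℤ) ≤ d x (2 * I + ω.2 + 2) := by
      exact_mod_cast hd x (show 2 * I ≤ 2 * I + ω.2 + 2 by omega)
    obtain ⟨k, hk, hk'⟩ := height_eq_of_not_const (D := heightSet H ω.1.2)
      (D' := heightSet H (τ ω.1.2)) (N := 2 * I + ω.2) (hd (s * x)) hde hed hst
      (fun h => hst ((hN _ hi).2.2 h)) (mem_heightSet_iff hlast) (subset_heightSet _ h₀H)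
      (h₀a'.trans h₀a) (h₀d.trans h₀d') (by omega) (not_lt.1 hjump)
    change pre (s * x) (height (d (s * x)) (heightSet H (τ ω.1.2)) I ω.1.1 (2 * I + ω.2 + 2))
      = s * pre x (height (d x) (heightSet H ω.1.2) I ω.1.1 (2 * I + ω.2 + 2))
    rw [hk, hk', hc.mul_pre]

end Selection

/-! ### Orbits of a partial action of polynomial growth -/

section Reach

variable {Γ : Type*} [Group Γ] [DecidableEq Γ]

/-- The elements which can be reached from `v` by at most `n` left multiplications by elements of
`F`, without leaving `T`. -/
def reach (F T : Finset Γ) : ℕ → Γ → Finset Γ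
  | 0, v => {v}
  | n + 1, v => reach F T n v ∪ (F.filter fun s => s * v ∈ T).biUnion fun s => reach F T n (s * v)

variable {F T : Finset Γ}

lemma reach_subset_succ (n : ℕ) (v : Γ) : reach F T n v ⊆ reach F T (n + 1) v :=
  Finset.subset_union_left

lemma reach_mul_subset_succ {s v : Γ} (hs : s ∈ F) (hv : s * v ∈ T) (n : ℕ) :
    reach F T n (s * v) ⊆ reach F T (n + 1) v := fun _ hu =>
  Finset.mem_union_right _ (Finset.mem_biUnion.2 ⟨s, Finset.mem_filter.2 ⟨hs, hv⟩, hu⟩)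

lemma reach_subset_mul_succ {s v : Γ} (hs : s⁻¹ ∈ F) (hv : v ∈ T) (n : ℕ) :
    reach F T n v ⊆ reach F T (n + 1) (s * v) := by
  have := reach_mul_subset_succ (T := T) (v := s * v) hs (by rwa [inv_mul_cancel_left]) n
  rwa [inv_mul_cancel_left] at this

lemma reach_nonempty (n : ℕ) (v : Γ) : (reach F T n v).Nonempty := by
  induction n with
  | zero => exact ⟨v, Finset.mem_singleton_self v⟩
  | succ n ih => exact ih.mono (reach_subset_succ n v)

lemma mul_inv_mem_pow_of_mem_reach (h1 : 1 ∈ F) (hF : ∀ t ∈ F, t⁻¹ ∈ F) {n : ℕ} {u v : Γ}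
    (hu : u ∈ reach F T n v) : v * u⁻¹ ∈ F ^ n := by
  induction n generalizing v with
  | zero =>
    rw [Finset.mem_singleton.1 hu]
    simp
  | succ n ih =>
    rcases Finset.mem_union.1 hu with hu | hu
    · exact Finset.pow_subset_pow_right h1 (Nat.le_succ n) (ih hu)
    · obtain ⟨s, hs, hu⟩ := Finset.mem_biUnion.1 hu
      have := Finset.mul_mem_mul (hF s (Finset.mem_filter.1 hs).1) (ih hu)
      rwa [← pow_succ', mul_assoc, inv_mul_cancel_left] at this

lemma sum_range_add_two_sub (f : ℕ → ℝ) (J : ℕ) :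
    ∑ n ∈ Finset.range J, (f (n + 2) - f n) = f (J + 1) + f J - f 1 - f 0 := by
  induction J with
  | zero => simp
  | succ J ih =>
    rw [Finset.sum_range_succ, ih]
    ring

/-- The average of the uniform measures on the sets reached after `1, …, J` steps. -/
noncomputable def reachAverage (F T : Finset Γ) (J : ℕ) (v : Γ) : Γ →₀ ℝ :=
  mix (unif (Finset.range J)) fun n => unif (reach F T (n + 1) v)

lemma isProb_reachAverage {J : ℕ} (hJ : 0 < J) (v : Γ) : IsProb (reachAverage F T J v) :=
  (isProb_unif (Finset.nonempty_range_iff.2 hJ.ne')).mix fun _ _ => isProb_unif (reach_nonempty _ _)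

lemma mul_inv_mem_pow_of_mem_support (h1 : 1 ∈ F) (hF : ∀ t ∈ F, t⁻¹ ∈ F) {J : ℕ} {u v : Γ}
    (hu : u ∈ (reachAverage F T J v).support) : v * u⁻¹ ∈ F ^ J := by
  obtain ⟨n, hn, hu⟩ := mem_support_mix hu
  have hn' := Finset.mem_range.1 (support_unif_subset _ hn)
  exact Finset.pow_subset_pow_right h1 hn'
    (mul_inv_mem_pow_of_mem_reach h1 hF (support_unif_subset _ hu))

lemma l1_unif_reach_sub_le {s v : Γ} (hs : s ∈ F) (hs' : s⁻¹ ∈ F) (hv : v ∈ T) (hsv : s * v ∈ T)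
    (n : ℕ) : l1 (unif (reach F T (n + 1) (s * v)) - unif (reach F T (n + 1) v))
      ≤ 4 * (Real.log (reach F T (n + 2) v).card - Real.log (reach F T n v).card) := by
  have h := reach_subset_mul_succ hs' hv n
  have h' := reach_mul_subset_succ hs hsv (n + 1)
  have hb : (0 : ℝ) < (reach F T n v).card := by exact_mod_cast (reach_nonempty n v).card_pos
  have key : ∀ t : Finset Γ, reach F T n v ⊆ t → t ⊆ reach F T (n + 2) v →
      l1 (unif (reach F T n v) - unif t)
        ≤ 2 * (Real.log (reach F T (n + 2) v).card - Real.log (reach F T n v).card) := by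
    intro t h1 h2
    have ht : (0 : ℝ) < t.card := by exact_mod_cast ((reach_nonempty n v).mono h1).card_pos
    rw [l1_unif_sub_unif (reach_nonempty n v) h1]
    have h3 := Real.log_le_sub_one_of_pos (div_pos hb ht)
    rw [Real.log_div hb.ne' ht.ne'] at h3
    have h4 : Real.log t.card ≤ Real.log (reach F T (n + 2) v).card :=
      Real.log_le_log ht (by exact_mod_cast Finset.card_le_card h2)
    linarith
  have h1 := key _ h h'
  have h2 := key _ (reach_subset_succ n v) (reach_subset_succ (n + 1) v)
  rw [l1_sub_comm] at h1
  have := l1_sub_le_add (unif (reach F T (n + 1) (s * v))) (unif (reach F T n v))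
    (unif (reach F T (n + 1) v))
  linarith

lemma l1_reachAverage_sub_le {s v : Γ} (hs : s ∈ F) (hs' : s⁻¹ ∈ F) (hv : v ∈ T)
    (hsv : s * v ∈ T) {J : ℕ} :
    l1 (reachAverage F T J (s * v) - reachAverage F T J v)
      ≤ 8 * Real.log (reach F T (J + 1) v).card / J := by
  have h0 : ∀ n, 0 ≤ Real.log (reach F T n v).card := fun n => Real.log_natCast_nonneg _
  have hmono : Real.log (reach F T J v).card ≤ Real.log (reach F T (J + 1) v).card :=
    Real.log_le_log (by exact_mod_cast (reach_nonempty J v).card_pos)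
      (by exact_mod_cast Finset.card_le_card (reach_subset_succ J v))
  have hsum := sum_range_add_two_sub (fun n => Real.log (reach F T n v).card) J
  rw [reachAverage, reachAverage, mix_eq_sum _ _ (support_unif_subset _),
    mix_eq_sum _ _ (support_unif_subset _), ← Finset.sum_sub_distrib]
  refine (l1_sum_le _ _).trans ?_
  calc _ ≤ ∑ n ∈ Finset.range J,
        4 / (J : ℝ) * (Real.log (reach F T (n + 2) v).card - Real.log (reach F T n v).card) := by
        refine Finset.sum_le_sum fun n hn => ?_
        rw [← smul_sub, l1_smul, unif_apply, if_pos hn, Finset.card_range,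
          abs_of_nonneg (by positivity)]
        refine (mul_le_mul_of_nonneg_left (l1_unif_reach_sub_le hs hs' hv hsv n)
          (by positivity)).trans (le_of_eq (by ring))
    _ = 4 * (Real.log (reach F T (J + 1) v).card + Real.log (reach F T J v).card
          - Real.log (reach F T 1 v).card - Real.log (reach F T 0 v).card) / J := by
        rw [← Finset.mul_sum, hsum]; ring
    _ ≤ _ := by
        refine div_le_div_of_nonneg_right ?_ (Nat.cast_nonneg J)
        linarith [h0 0, h0 1]

end Reach

section Growth

/-- A partial isometry of the integers is the restriction of an isometry. -/
lemma exists_eq_mul_add {S : ℤ → ℤ → Prop}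
    (hS : ∀ a b a' b', S a b → S a' b' → |a - a'| = |b - b'|) :
    ∃ ε c : ℤ, (ε = 1 ∨ ε = -1) ∧ ∀ a b, S a b → b = ε * a + c := by
  by_cases hne : ∃ a b a' b', S a b ∧ S a' b' ∧ a ≠ a'
  · obtain ⟨a, b, a', b', h, h', hne⟩ := hne
    rcases abs_eq_abs.1 (hS _ _ _ _ h h') with h1 | h1
    · refine ⟨1, b - a, Or.inl rfl, fun x y hxy => ?_⟩
      rcases abs_eq_abs.1 (hS _ _ _ _ hxy h) with h2 | h2 <;>
      rcases abs_eq_abs.1 (hS _ _ _ _ hxy h') with h3 | h3 <;> omega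
    · refine ⟨-1, b + a, Or.inr rfl, fun x y hxy => ?_⟩
      rcases abs_eq_abs.1 (hS _ _ _ _ hxy h) with h2 | h2 <;>
      rcases abs_eq_abs.1 (hS _ _ _ _ hxy h') with h3 | h3 <;> omega
  · push Not at hne
    by_cases hex : ∃ a b, S a b
    · obtain ⟨a, b, h⟩ := hex
      refine ⟨1, b - a, Or.inl rfl, fun x y hxy => ?_⟩
      have h2 := hne _ _ _ _ hxy h
      have h3 := hS _ _ _ _ hxy h
      rw [h2, sub_self, abs_zero] at h3
      have := abs_eq_zero.1 h3.symm
      omega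
    · push Not at hex
      exact ⟨1, 0, Or.inl rfl, fun x y hxy => absurd hxy (hex x y)⟩

variable {α : Type*} [DecidableEq α]

lemma exists_eq_mul_add_of_mul_pre (h g g' : FreeGroup α) :
    ∃ ε c : ℤ, (ε = 1 ∨ ε = -1) ∧ ∀ r r' : ℕ, r ≤ g.norm → r' ≤ g'.norm →
      h * pre g r = pre g' r' → (r' : ℤ) = ε * r + c := by
  obtain ⟨ε, c, hε, hc⟩ := exists_eq_mul_add (S := fun a b => ∃ r r' : ℕ, a = r ∧ b = r' ∧
    r ≤ g.norm ∧ r' ≤ g'.norm ∧ h * pre g r = pre g' r') (by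
      rintro _ _ _ _ ⟨r₁, r₁', rfl, rfl, h₁, h₁', he₁⟩ ⟨r₂, r₂', rfl, rfl, h₂, h₂', he₂⟩
      rw [← norm_inv_pre_mul_pre h₂ h₁, ← norm_inv_pre_mul_pre h₂' h₁', ← he₁, ← he₂]
      congr 2
      group)
  exact ⟨ε, c, hε, fun r r' hr hr' he => hc _ _ ⟨r, r', rfl, rfl, hr, hr', he⟩⟩

lemma card_reach_prefixSet_le (F P : Finset (FreeGroup α)) {v : FreeGroup α}
    (hv : v ∈ prefixSet P) (n : ℕ) :
    (reach F (prefixSet P) n v).card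
      ≤ P.card * 2 * (2 * n + 1) ^ (F.card * (P.card * P.card)) := by
  choose ε c hε hc using fun q : FreeGroup α × FreeGroup α × FreeGroup α =>
    exists_eq_mul_add_of_mul_pre q.1 q.2.1 q.2.2
  let Q := F ×ˢ P ×ˢ P
  have key : ∀ n, ∀ g ∈ P, ∀ r ≤ g.norm, ∀ u ∈ reach F (prefixSet P) n (pre g r),
      ∃ g' ∈ P, ∃ r' : ℕ, u = pre g' r' ∧ ∃ e : ℤ, (e = 1 ∨ e = -1) ∧ ∃ a : Q → ℤ,
        (∀ q, |a q| ≤ n) ∧ (r' : ℤ) = e * r + ∑ q, a q * c q := by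
    intro n
    induction n with
    | zero =>
      intro g hg r hr u hu
      exact ⟨g, hg, r, Finset.mem_singleton.1 hu, 1, Or.inl rfl, 0, by simp, by simp⟩
    | succ n ih =>
      intro g hg r hr u hu
      rcases Finset.mem_union.1 hu with hu | hu
      · obtain ⟨g', hg', r', hu, e, he, a, ha, h⟩ := ih g hg r hr u hu
        exact ⟨g', hg', r', hu, e, he, a, fun q => (ha q).trans (by push_cast; omega), h⟩
      · obtain ⟨s, hs, hu⟩ := Finset.mem_biUnion.1 hu
        obtain ⟨hsF, hsT⟩ := Finset.mem_filter.1 hs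
        obtain ⟨g₁, hg₁, r₁, hr₁, he₁⟩ := mem_prefixSet.1 hsT
        rw [← he₁] at hu
        obtain ⟨g', hg', r', hu, e, he, a, ha, h⟩ := ih g₁ hg₁ r₁ hr₁ u hu
        let q₀ : Q := ⟨(s, g, g₁), Finset.mem_product.2 ⟨hsF, Finset.mem_product.2 ⟨hg, hg₁⟩⟩⟩
        have h₁ : (r₁ : ℤ) = ε q₀ * r + c q₀ := hc _ r r₁ hr hr₁ he₁.symm
        refine ⟨g', hg', r', hu, e * ε q₀, ?_, a + Pi.single q₀ e, fun q => ?_, ?_⟩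
        · rcases he with rfl | rfl <;> rcases hε q₀ with h | h <;> simp [h]
        · rw [Pi.add_apply]
          have h2 : |(Pi.single q₀ e : Q → ℤ) q| ≤ 1 := by
            by_cases hq : q = q₀
            · subst hq
              rw [Pi.single_eq_same]
              rcases he with rfl | rfl <;> simp
            · rw [Pi.single_eq_of_ne hq]
              simp
          have := abs_add_le (a q) ((Pi.single q₀ e : Q → ℤ) q)
          have := ha q
          push_cast
          omega
        · have h2 : ∑ q, (Pi.single q₀ e : Q → ℤ) q * c q = e * c q₀ := by
            rw [Finset.sum_eq_single q₀]
            · rw [Pi.single_eq_same]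
            · intro q _ hq
              rw [Pi.single_eq_of_ne hq, zero_mul]
            · exact fun hq => absurd (Finset.mem_univ _) hq
          simp only [Pi.add_apply, add_mul, Finset.sum_add_distrib]
          rw [h, h₁, h2]
          ring
  obtain ⟨g, hg, r, hr, rfl⟩ := mem_prefixSet.1 hv
  let A : Finset (Q → ℤ) := Fintype.piFinset fun _ => Finset.Icc (-(n : ℤ)) n
  have hA : A.card = (2 * n + 1) ^ (F.card * (P.card * P.card)) := by
    simp only [A]
    rw [Fintype.card_piFinset, Finset.prod_const, Finset.card_univ, Int.card_Icc, Fintype.card_coe, Finset.card_product,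
      Finset.card_product]
    congr 1
    omega
  have hsub : reach F (prefixSet P) n (pre g r) ⊆ (P ×ˢ ({1, -1} : Finset ℤ) ×ˢ A).image
      fun p : FreeGroup α × ℤ × (Q → ℤ) => pre p.1 (p.2.1 * r + ∑ q, p.2.2 q * c q).toNat := by
    intro u hu
    obtain ⟨g', hg', r', rfl, e, he, a, ha, h⟩ := key n g hg r hr u hu
    refine Finset.mem_image.2 ⟨(g', e, a), Finset.mem_product.2 ⟨hg', Finset.mem_product.2
      ⟨by simpa using he, Fintype.mem_piFinset.2 fun q => Finset.mem_Icc.2 (abs_le.1 (ha q))⟩⟩, ?_⟩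
    simp only
    rw [← h, Int.toNat_natCast]
  refine (Finset.card_le_card hsub).trans (Finset.card_image_le.trans (le_of_eq ?_))
  rw [Finset.card_product, Finset.card_product, hA, Finset.card_pair (by norm_num), mul_assoc]

lemma exists_log_le (c p : ℕ) {ε : ℝ} (hε : 0 < ε) :
    ∃ J : ℕ, 0 < J ∧ ∀ b : ℕ, 0 < b → b ≤ c * (2 * (J + 1) + 1) ^ p → Real.log b ≤ ε * J := by
  have h := tendsto_pow_const_div_const_pow_of_one_lt p (Real.one_lt_exp_iff.2 hε)
  have hpos : (0 : ℝ) < 1 / (c * 3 ^ p + 1) := by positivity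
  obtain ⟨J, hJ, hJ3⟩ := ((h.eventually_le_const hpos).and (Filter.eventually_ge_atTop 3)).exists
  refine ⟨J, by omega, fun b hb hbJ => ?_⟩
  rw [Real.log_le_iff_le_exp (by exact_mod_cast hb), mul_comm, Real.exp_nat_mul]
  rw [div_le_div_iff₀ (by positivity) (by positivity), one_mul] at hJ
  have h1 : b ≤ c * (3 * J) ^ p :=
    hbJ.trans (Nat.mul_le_mul_left _ (Nat.pow_le_pow_left (by omega) _))
  have h2 : (b : ℝ) ≤ c * (3 * J) ^ p := by exact_mod_cast h1
  have h3 : (0 : ℝ) ≤ (J : ℝ) ^ p := by positivity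
  rw [mul_pow] at h2
  nlinarith

/-- Almost invariant probability vectors for the partial action of `F` on the prefixes of the
elements of `F ^ M`. -/
lemma exists_almost_invariant (m j M : ℕ) : ∃ J : ℕ, ∀ (α : Type*) [DecidableEq α]
    (F : Finset (FreeGroup α)), 1 ∈ F → (∀ t ∈ F, t⁻¹ ∈ F) → F.card ≤ m →
    ∃ β : FreeGroup α → FreeGroup α →₀ ℝ, (∀ v, IsProb (β v)) ∧
      (∀ v, ∀ u ∈ (β v).support, v * u⁻¹ ∈ F ^ J) ∧
      ∀ s ∈ F, ∀ v ∈ prefixSet (F ^ M), l1 (β (s * v) - β v) ≤ 1 / ((j : ℝ) + 1) := by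
  obtain ⟨J, hJ, hlog⟩ := exists_log_le (m ^ (M + 1) * 2) (m * (m ^ (M + 1) * m ^ (M + 1)))
    (ε := 1 / (8 * ((j : ℝ) + 1))) (by positivity)
  refine ⟨J, fun α _ F h1 hF hm => ⟨reachAverage F (prefixSet (F ^ (M + 1))) J,
    isProb_reachAverage hJ, fun v u hu => mul_inv_mem_pow_of_mem_support h1 hF hu,
    fun s hs v hv => ?_⟩⟩
  have hv' := prefixSet_mono (Finset.pow_subset_pow_right h1 (Nat.le_succ M)) hv
  have hP : (F ^ (M + 1)).card ≤ m ^ (M + 1) :=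
    Finset.card_pow_le.trans (Nat.pow_le_pow_left hm _)
  refine (l1_reachAverage_sub_le hs (hF s hs) hv' (mul_mem_prefixSet h1 hs hv)).trans ?_
  have h2 := hlog _ (reach_nonempty (F := F) (T := prefixSet (F ^ (M + 1))) (J + 1) v).card_pos
    ((card_reach_prefixSet_le F _ hv' (J + 1)).trans (Nat.mul_le_mul (Nat.mul_le_mul_right _ hP)
      (Nat.pow_le_pow_right (Nat.succ_pos _) (Nat.mul_le_mul hm (Nat.mul_le_mul hP hP)))))
  have hJ' : (0 : ℝ) < J := by exact_mod_cast hJ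
  rw [div_le_iff₀ hJ']
  calc _ ≤ 8 * (1 / (8 * ((j : ℝ) + 1)) * J) := by gcongr
    _ = _ := by field_simp

end Growth

/-! ### Uniform exactness of free groups -/

section FreeGroup

universe u

lemma exists_unifExact_freeGroup : ∃ K : ℕ → ℕ → ℕ, ∀ α : Type u, UnifExact K (FreeGroup α) := by
  classical
  choose M hM using fun m j => exists_random_prefix.{u} m (2 * j + 1)
  choose J hJ using fun m j => exists_almost_invariant.{u} m (2 * j + 1) (M m j)
  refine ⟨J, fun α m j F h1 hF hm => ?_⟩
  obtain ⟨ζ, hζ, hζP, hζs⟩ := hM m j α F h1 hF hm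
  obtain ⟨β, hβ, hβF, hβs⟩ := hJ m j α F h1 hF hm
  let Θ : FreeGroup α → FreeGroup α →₀ ℝ := fun v => (β v).mapDomain fun u => v * u⁻¹
  have hΘ : ∀ v, IsProb (Θ v) := fun v => (hβ v).mapDomain _
  refine ⟨fun x => mix (ζ x) Θ, fun x => (hζ x).mix fun v _ => hΘ v, fun x t ht => ?_,
    fun s hs x => ?_⟩
  · obtain ⟨v, -, ht⟩ := mem_support_mix ht
    obtain ⟨u, hu, rfl⟩ := mem_support_mapDomain ht
    exact_mod_cast hβF v u hu
  · refine (l1_mix_sub_mapDomain_le (s * ·) (s * ·) (hζ x) (hζs s hs x) (fun v _ => hΘ v)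
      fun v hv => (?_ : _ ≤ 1 / (((2 * j + 1 : ℕ) : ℝ) + 1))).trans (le_of_eq ?_)
    · refine le_trans ?_ (hβs s hs v (hζP x v hv))
      have h2 : (Θ v).mapDomain (s * ·) = (β v).mapDomain fun u => s * v * u⁻¹ := by
        rw [← Finsupp.mapDomain_comp]
        congr 1
        funext u
        simp [mul_assoc]
      rw [h2, ← Finsupp.mapDomain_sub]
      exact l1_mapDomain_le _ _
    · push_cast
      field_simp
      ring

end FreeGroup

end FreeProductExactness

/-- The class of uniformly exact groups is closed under free products, with modulus
depending only on the given modulus: for every `k` there is `k'` such that whenever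
groups `G` and `H` are in `UE(k)`, the free product `G ∗ H` is in `UE(k')`. -/
theorem isUEModulus_freeProduct (k : ℕ → ℕ) :
    ∃ k' : ℕ → ℕ, ∀ (G H : Type*) [Group G] [Group H],
      IsUEModulus k G → IsUEModulus k H → IsUEModulus k' (Monoid.Coprod G H) := by
  let K : ℕ → ℕ → ℕ := fun m j => (j + 1) * (Finset.range (m ^ (j + 1) + 1)).sup k + (j + 1)
  obtain ⟨K₀, hK₀⟩ := FreeProductExactness.exists_unifExact_freeGroup
  refine ⟨fun m => FreeProductExactness.extensionModulus K₀
    (FreeProductExactness.extensionModulus K K) m (m * m), fun G H _ _ hG hH => ?_⟩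
  exact ((FreeProductExactness.IsUEModulus.unifExact hG).coprod
    (FreeProductExactness.IsUEModulus.unifExact hH) (hK₀ _)).isUEModulus
end

section
/- Let T be an ℝ-tree with more than one point on which a group Γ acts by isometries, and assume that the pointwise stabilizer of every nondegenerate arc of T is amenable. Then: (a) for every point x ∈ T that is not a branching point, the stabilizer Γ^x = {g ∈ Γ : gx = x} has a normal subgroup N that is a directed union of pointwise stabilizers of nondegenerate arcs and such that Γ^x/N is abelian; in particular Γ^x is amenable; (b) for every boundary point x ∈ ∂T, the stabilizer {g ∈ Γ : g·x = x} of the equivalence class x of rays is amenable. -/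
/-- A group `G` is amenable: there is a left-invariant mean on the space `ℓ∞(G)` of
bounded real-valued functions on `G`, i.e. a positive unital linear functional that is
invariant under left translations. -/
def IsAmenableGroup (G : Type*) [Group G] : Prop :=
  ∃ m : lp (fun _ : G => ℝ) ⊤ →ₗ[ℝ] ℝ,
    (∀ f : lp (fun _ : G => ℝ) ⊤, (∀ x, 0 ≤ f x) → 0 ≤ m f) ∧
    (∀ f : lp (fun _ : G => ℝ) ⊤, (∀ x, f x = 1) → m f = 1) ∧
    (∀ (g : G) (f fg : lp (fun _ : G => ℝ) ⊤),
      (∀ x, fg x = f (g⁻¹ * x)) → m fg = m f)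

/-- `f` is an isometric parametrization of a geodesic from `x` to `y`. -/
def IsGeodesicParam (T : Type*) [MetricSpace T] (f : ℝ → T) (x y : T) : Prop :=
  f 0 = x ∧ f (dist x y) = y ∧
    ∀ s ∈ Set.Icc 0 (dist x y), ∀ t ∈ Set.Icc 0 (dist x y),
      dist (f s) (f t) = |s - t|

/-- An `ℝ`-tree: a nonempty geodesic `0`-hyperbolic metric space. -/
def IsRTree (T : Type*) [MetricSpace T] : Prop :=
  Nonempty T ∧
  (∀ x y : T, ∃ f : ℝ → T, IsGeodesicParam T f x y) ∧
  (∀ x y z w : T,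
    dist x y + dist z w ≤ max (dist x z + dist y w) (dist x w + dist y z))

/-- `A` is the arc joining `x` to `y`: the image of a geodesic from `x` to `y`. -/
def IsArc (T : Type*) [MetricSpace T] (x y : T) (A : Set T) : Prop :=
  ∃ f : ℝ → T, IsGeodesicParam T f x y ∧ A = f '' Set.Icc 0 (dist x y)

/-- `w` is a branching point: `T \ {w}` has at least three connected components. -/
def IsBranchPoint (T : Type*) [MetricSpace T] (w : T) : Prop :=
  ∃ x y z : T, x ≠ w ∧ y ≠ w ∧ z ≠ w ∧
    connectedComponentIn ({w}ᶜ : Set T) x ≠ connectedComponentIn ({w}ᶜ : Set T) y ∧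
    connectedComponentIn ({w}ᶜ : Set T) x ≠ connectedComponentIn ({w}ᶜ : Set T) z ∧
    connectedComponentIn ({w}ᶜ : Set T) y ≠ connectedComponentIn ({w}ᶜ : Set T) z

/-- `f` is an isometric parametrization of a ray of length `d ∈ (0, ∞]`: an isometric
embedding of `[0, d)` such that `lim_{t → d} f t` does not exist in `T`. -/
def IsRayParam (T : Type*) [MetricSpace T] (d : ENNReal) (f : ℝ → T) : Prop :=
  0 < d ∧
  (∀ s t : ℝ, 0 ≤ s → ENNReal.ofReal s < d → 0 ≤ t → ENNReal.ofReal t < d →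
    dist (f s) (f t) = |s - t|) ∧
  ¬∃ L : T, ∀ ε : ℝ, 0 < ε → ∃ t₀ : ℝ, 0 ≤ t₀ ∧ ENNReal.ofReal t₀ < d ∧
    ∀ t : ℝ, t₀ ≤ t → ENNReal.ofReal t < d → dist (f t) L < ε

/-- `R ⊆ T` is a ray. -/
def IsRay (T : Type*) [MetricSpace T] (R : Set T) : Prop :=
  ∃ (d : ENNReal) (f : ℝ → T), IsRayParam T d f ∧
    R = f '' {t : ℝ | 0 ≤ t ∧ ENNReal.ofReal t < d}

/-- Precomposition with `φ` as a linear map between spaces of bounded functions. -/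
def boundedPullback {α β : Type*} (φ : α → β) :
    lp (fun _ : β => ℝ) ⊤ →ₗ[ℝ] lp (fun _ : α => ℝ) ⊤ where
  toFun f := ⟨fun a => f (φ a), memℓp_infty ⟨‖f‖, by
    rintro _ ⟨a, rfl⟩
    exact lp.norm_apply_le_norm ENNReal.top_ne_zero f _⟩⟩
  map_add' _ _ := rfl
  map_smul' _ _ := rfl

@[simp]
theorem boundedPullback_apply {α β : Type*} (φ : α → β) (f : lp (fun _ : β => ℝ) ⊤) (a : α) :
    boundedPullback φ f a = f (φ a) := rfl

/-- A mean on a set: a positive unital functional on its bounded functions. -/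
def IsMean {α : Type*} (m : lp (fun _ : α => ℝ) ⊤ →ₗ[ℝ] ℝ) : Prop :=
  (∀ f : lp (fun _ : α => ℝ) ⊤, (∀ x, 0 ≤ f x) → 0 ≤ m f) ∧
    ∀ f : lp (fun _ : α => ℝ) ⊤, (∀ x, f x = 1) → m f = 1

/-- Left translation of bounded functions on a group. -/
def leftTranslate {G : Type*} [Group G] (g : G) :
    lp (fun _ : G => ℝ) ⊤ →ₗ[ℝ] lp (fun _ : G => ℝ) ⊤ :=
  boundedPullback (fun x => g⁻¹ * x)

@[simp]
theorem leftTranslate_apply {G : Type*} [Group G] (g : G) (f : lp (fun _ : G => ℝ) ⊤) (x : G) :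
    leftTranslate g f x = f (g⁻¹ * x) := rfl

theorem leftTranslate_leftTranslate {G : Type*} [Group G] (a b : G)
    (f : lp (fun _ : G => ℝ) ⊤) :
    leftTranslate a (leftTranslate b f) = leftTranslate (a * b) f := by
  ext x
  simp [mul_assoc]

/-- There is a mean on `G` invariant under left translation by the elements of `S`. -/
def HasInvariantMean {G : Type*} [Group G] (S : Set G) : Prop :=
  ∃ m : lp (fun _ : G => ℝ) ⊤ →ₗ[ℝ] ℝ, IsMean m ∧ ∀ g ∈ S, ∀ f, m (leftTranslate g f) = m f

theorem IsMean.comp_boundedPullback {α β : Type*} {m : lp (fun _ : α => ℝ) ⊤ →ₗ[ℝ] ℝ}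
    (hm : IsMean m) (φ : α → β) : IsMean (m ∘ₗ boundedPullback φ) :=
  ⟨fun _ hf => hm.1 _ fun x => hf (φ x), fun _ hf => hm.2 _ fun x => hf (φ x)⟩

theorem IsMean.abs_apply_le {α : Type*} {m : lp (fun _ : α => ℝ) ⊤ →ₗ[ℝ] ℝ}
    (hm : IsMean m) (f : lp (fun _ : α => ℝ) ⊤) : |m f| ≤ ‖f‖ := by
  let e : lp (fun _ : α => ℝ) ⊤ := ⟨fun _ => 1, memℓp_infty ⟨1, by
    rintro _ ⟨a, rfl⟩
    simp⟩⟩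
  have he : m e = 1 := hm.2 e fun _ => rfl
  have hb : ∀ x, |f x| ≤ ‖f‖ := fun x => lp.norm_apply_le_norm ENNReal.top_ne_zero f x
  have hsub : 0 ≤ m (‖f‖ • e - f) := hm.1 _ fun x => by
    have h1 : (‖f‖ • e - f) x = ‖f‖ * 1 - f x := rfl
    linarith [(abs_le.1 (hb x)).2]
  have hadd : 0 ≤ m (‖f‖ • e + f) := hm.1 _ fun x => by
    have h1 : (‖f‖ • e + f) x = ‖f‖ * 1 + f x := rfl
    linarith [(abs_le.1 (hb x)).1]
  rw [map_sub, map_smul, he, smul_eq_mul] at hsub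
  rw [map_add, map_smul, he, smul_eq_mul] at hadd
  exact abs_le.2 ⟨by linarith, by linarith⟩

/-- Means that are asymptotically invariant along a filter accumulate at an invariant mean. -/
theorem HasInvariantMean.of_tendsto {G : Type*} [Group G] {ι : Type*} (l : Filter ι) [l.NeBot]
    (m : ι → lp (fun _ : G => ℝ) ⊤ →ₗ[ℝ] ℝ) (hm : ∀ i, IsMean (m i)) (S : Set G)
    (hS : ∀ g ∈ S, ∀ f,
      Filter.Tendsto (fun i => m i (leftTranslate g f) - m i f) l (nhds 0)) :
    HasInvariantMean S := by
  let U : Ultrafilter ι := Ultrafilter.of l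
  have hlim : ∀ f, ∃ y, Filter.Tendsto (fun i => m i f) U (nhds y) := fun f => by
    obtain ⟨y, -, hy⟩ := (isCompact_Icc (a := -‖f‖) (b := ‖f‖)).ultrafilter_le_nhds
      (U.map fun i => m i f) (by
        simp only [Filter.le_principal_iff]
        exact Filter.mem_map.2 (Filter.univ_mem' fun i => abs_le.1 ((hm i).abs_apply_le f)))
    exact ⟨y, hy⟩
  choose M hM using hlim
  refine ⟨⟨⟨M, fun f g => ?_⟩, fun c f => ?_⟩, ⟨fun f hf => ?_, fun f hf => ?_⟩, fun g hg f => ?_⟩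
  · refine tendsto_nhds_unique (hM (f + g)) ?_
    simpa using (hM f).add (hM g)
  · refine tendsto_nhds_unique (hM (c • f)) ?_
    simpa using (hM f).const_mul c
  · exact ge_of_tendsto' (hM f) fun i => (hm i).1 f hf
  · refine tendsto_nhds_unique (hM f) ?_
    simp [fun i => (hm i).2 f hf]
  · exact sub_eq_zero.1 (tendsto_nhds_unique ((hM _).sub (hM f))
      ((hS g hg f).mono_left (Ultrafilter.of_le l)))

theorem HasInvariantMean.of_eventually {G : Type*} [Group G] {ι : Type*} (l : Filter ι) [l.NeBot]
    (A : ι → Set G) (hA : ∀ i, HasInvariantMean (A i)) (S : Set G)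
    (hS : ∀ g ∈ S, ∀ᶠ i in l, g ∈ A i) : HasInvariantMean S := by
  choose m hm hinv using hA
  refine .of_tendsto l m hm S fun g hg f => ?_
  refine tendsto_const_nhds.congr' ?_
  filter_upwards [hS g hg] with i hi
  rw [hinv i g hi f, sub_self]

theorem HasInvariantMean.mono {G : Type*} [Group G] {S S' : Set G} (h : HasInvariantMean S)
    (hS : S' ⊆ S) : HasInvariantMean S' :=
  let ⟨m, hm, hinv⟩ := h
  ⟨m, hm, fun g hg => hinv g (hS hg)⟩

theorem HasInvariantMean.insert {G : Type*} [Group G] {H : Subgroup G} {S : Set G}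
    (hS : HasInvariantMean S) (hSH : S ⊆ H) (hcomm : ∀ a ∈ H, ∀ b ∈ H, a * b * a⁻¹ * b⁻¹ ∈ S)
    {g : G} (hg : g ∈ H) : HasInvariantMean (insert g S) := by
  obtain ⟨m, hm, hinv⟩ := hS
  let M : ℕ → lp (fun _ : G => ℝ) ⊤ →ₗ[ℝ] ℝ := fun n =>
    ((n : ℝ) + 1)⁻¹ • ∑ i ∈ Finset.range (n + 1), m ∘ₗ leftTranslate (g ^ i)
  have hMf : ∀ n f, M n f =
      ((n : ℝ) + 1)⁻¹ * ∑ i ∈ Finset.range (n + 1), m (leftTranslate (g ^ i) f) := by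
    simp [M]
  refine .of_tendsto Filter.atTop M (fun n => ⟨fun f hf => ?_, fun f hf => ?_⟩) _ ?_
  · rw [hMf]
    exact mul_nonneg (by positivity) (Finset.sum_nonneg fun i _ => hm.1 _ fun x => hf _)
  · have hone : ∀ i, m (leftTranslate (g ^ i) f) = 1 := fun i => hm.2 _ fun x => hf _
    rw [hMf, Finset.sum_congr rfl fun i _ => hone i]
    have : (n : ℝ) + 1 ≠ 0 := by positivity
    simp [this]
  · rintro s (rfl | hs) f
    · have hbound : ∀ n : ℕ, ‖M n (leftTranslate s f) - M n f‖ ≤ 2 * ‖f‖ * (1 / ((n : ℝ) + 1)) := by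
        intro n
        have heq : M n (leftTranslate s f) - M n f =
            ((n : ℝ) + 1)⁻¹ * (m (leftTranslate (s ^ (n + 1)) f) - m f) := by
          rw [hMf, hMf, ← mul_sub, ← Finset.sum_sub_distrib]
          congr 1
          have hstep : ∀ i, leftTranslate (s ^ i) (leftTranslate s f)
              = leftTranslate (s ^ (i + 1)) f := fun i => by
            rw [leftTranslate_leftTranslate, pow_succ]
          simp only [hstep]
          rw [Finset.sum_range_sub (fun i => m (leftTranslate (s ^ i) f))]
          congr 2
          ext x
          simp
        have h1 : |m (leftTranslate (s ^ (n + 1)) f)| ≤ ‖f‖ :=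
          (hm.comp_boundedPullback _).abs_apply_le f
        have h2 := hm.abs_apply_le f
        rw [heq, norm_mul, Real.norm_eq_abs, Real.norm_eq_abs,
          abs_of_pos (by positivity : 0 < ((n : ℝ) + 1)⁻¹), one_div, mul_comm]
        refine mul_le_mul_of_nonneg_right ?_ (by positivity)
        exact (abs_sub _ _).trans (by linarith)
      refine squeeze_zero_norm hbound ?_
      simpa using tendsto_one_div_add_atTop_nhds_zero_nat.const_mul (2 * ‖f‖)
    · refine tendsto_const_nhds.congr fun n => ?_
      rw [hMf, hMf, ← mul_sub, ← Finset.sum_sub_distrib, Finset.sum_eq_zero, mul_zero]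
      intro i _
      have hsplit : leftTranslate (g ^ i) (leftTranslate s f) =
          leftTranslate (g ^ i * s * (g ^ i)⁻¹ * s⁻¹)
            (leftTranslate s (leftTranslate (g ^ i) f)) := by
        simp only [leftTranslate_leftTranslate]
        congr 2
        group
      rw [hsplit, hinv _ (hcomm _ (H.pow_mem hg i) _ (hSH hs)), hinv s hs, sub_self]

/-- A group is amenable as soon as it has a mean invariant under all commutators. -/
theorem HasInvariantMean.of_commutators {G : Type*} [Group G] {H : Subgroup G} {S : Set G}
    (hS : HasInvariantMean S) (hcomm : ∀ a ∈ H, ∀ b ∈ H, a * b * a⁻¹ * b⁻¹ ∈ S) :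
    HasInvariantMean (H : Set G) := by
  classical
  have hfin : ∀ F : Finset H, HasInvariantMean ((S ∩ H) ∪ ((↑) '' (F : Set H)) : Set G) := by
    intro F
    induction F using Finset.induction_on with
    | empty => simpa using hS.mono Set.inter_subset_left
    | insert a F _ ih =>
      rw [Finset.coe_insert, Set.image_insert_eq, Set.union_insert]
      refine ih.insert (H := H) ?_ (fun a ha b hb => ?_) a.2
      · rintro x (hx | ⟨y, -, rfl⟩)
        exacts [hx.2, y.2]
      · exact Or.inl ⟨hcomm a ha b hb,
          H.mul_mem (H.mul_mem (H.mul_mem ha hb) (H.inv_mem ha)) (H.inv_mem hb)⟩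
  refine .of_eventually Filter.atTop _ hfin _ fun g hg => ?_
  filter_upwards [Filter.eventually_ge_atTop ({⟨g, hg⟩} : Finset H)] with F hF
  exact Or.inr ⟨⟨g, hg⟩, hF (by simp), rfl⟩

theorem IsAmenableGroup.hasInvariantMean {G : Type*} [Group G] {H : Subgroup G}
    (h : IsAmenableGroup H) : HasInvariantMean (H : Set G) := by
  obtain ⟨m, hpos, hone, hinv⟩ := h
  refine ⟨m ∘ₗ boundedPullback (Subtype.val : H → G),
    IsMean.comp_boundedPullback ⟨hpos, hone⟩ _, fun g hg f => ?_⟩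
  exact hinv ⟨g, hg⟩ _ _ fun x => rfl

theorem HasInvariantMean.isAmenableGroup {G : Type*} [Group G] {H : Subgroup G}
    (h : HasInvariantMean (H : Set G)) : IsAmenableGroup H := by
  obtain ⟨m, hm, hinv⟩ := h
  obtain ⟨T, hT, -⟩ := H.exists_isComplement_right 1
  let φ : G → H := fun x => (hT.equiv x).1
  have hφ : ∀ (k : H) (x : G), φ (k⁻¹ * x) = k⁻¹ * φ x := fun k x => by
    simpa [φ] using congrArg Prod.fst (hT.equiv_mul_left k⁻¹ x)
  have hmean := hm.comp_boundedPullback φ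
  refine ⟨m ∘ₗ boundedPullback φ, hmean.1, hmean.2, fun g f fg hfg => ?_⟩
  have heq : boundedPullback φ fg = leftTranslate (g : G) (boundedPullback φ f) := by
    ext x
    change fg (φ x) = f (φ ((g : G)⁻¹ * x))
    rw [hfg, ← hφ g x, Subgroup.coe_inv]
  simp only [LinearMap.comp_apply, heq]
  exact hinv g g.2 _

/-- `p` and `q` lie in the same direction at `x`. -/
def SameDirection {T : Type*} [MetricSpace T] (x p q : T) : Prop :=
  dist p q < dist p x + dist q x

theorem SameDirection.symm {T : Type*} [MetricSpace T] {x p q : T}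
    (h : SameDirection x p q) : SameDirection x q p := by
  unfold SameDirection at *
  rw [dist_comm q p]
  linarith

theorem SameDirection.refl {T : Type*} [MetricSpace T] {x p : T} (h : p ≠ x) :
    SameDirection x p p := by
  have := dist_pos.2 h
  unfold SameDirection
  rw [dist_self]
  linarith

theorem SameDirection.trans {T : Type*} [MetricSpace T] (hT : IsRTree T) {x p q r : T}
    (h : SameDirection x p q) (h' : SameDirection x q r) : SameDirection x p r := by
  unfold SameDirection at *
  have h4 := hT.2.2 p r q x
  rw [dist_comm r q] at h4
  rcases max_cases (dist p q + dist r x) (dist p x + dist q r) with ⟨h5, -⟩ | ⟨h5, -⟩ <;>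
    rw [h5] at h4 <;> linarith

theorem sameDirection_of_connectedComponentIn_eq {T : Type*} [MetricSpace T] (hT : IsRTree T)
    {x p q : T} (hp : p ≠ x) (hq : q ≠ x)
    (h : connectedComponentIn ({x}ᶜ : Set T) p = connectedComponentIn ({x}ᶜ : Set T) q) :
    SameDirection x p q := by
  have hopen : ∀ r, IsOpen {y | SameDirection x r y} := fun r =>
    isOpen_lt (by fun_prop) (by fun_prop)
  have hopen' : IsOpen {y | y ≠ x ∧ ¬SameDirection x p y} := by
    rw [isOpen_iff_mem_nhds]
    rintro y ⟨hy, hpy⟩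
    filter_upwards [(hopen y).mem_nhds (SameDirection.refl hy), isOpen_ne.mem_nhds hy] with z hz hzx
    exact ⟨hzx, fun h => hpy (h.trans hT hz.symm)⟩
  have hpc : IsPreconnected (connectedComponentIn ({x}ᶜ : Set T) p) :=
    isPreconnected_connectedComponentIn
  have hqmem : q ∈ connectedComponentIn ({x}ᶜ : Set T) p := h ▸ mem_connectedComponentIn hq
  by_contra hpq
  obtain ⟨z, -, hz, hzn⟩ := hpc _ _ (hopen p) hopen'
    (fun y hy => by
      have := connectedComponentIn_subset _ _ hy
      by_cases hpy : SameDirection x p y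
      exacts [Or.inl hpy, Or.inr ⟨this, hpy⟩])
    ⟨p, mem_connectedComponentIn hp, SameDirection.refl hp⟩ ⟨q, hqmem, hq, hpq⟩
  exact hzn.2 hz

/-- An isometry fixing `x` and the direction of `p` at `x` fixes an initial part of `[x, p]`. -/
theorem smul_eq_of_sameDirection {T : Type*} [MetricSpace T] (hT : IsRTree T)
    {Γ : Type*} [Group Γ] [MulAction Γ T]
    (hiso : ∀ (g : Γ) (x y : T), dist (g • x) (g • y) = dist x y) {x p : T} {f : ℝ → T}
    (hf : IsGeodesicParam T f x p) {g : Γ} (hg : g • x = x) {t : ℝ} (ht : 0 ≤ t)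
    (htp : t ≤ dist x p) (htg : 2 * t ≤ dist (g • p) x + dist p x - dist (g • p) p) :
    g • f t = f t := by
  obtain ⟨h0, h1, hd⟩ := hf
  have hx : dist (f t) x = t := by
    have := hd t ⟨ht, htp⟩ 0 ⟨le_rfl, dist_nonneg⟩
    rwa [h0, sub_zero, abs_of_nonneg ht] at this
  have hp : dist (f t) p = dist x p - t := by
    have := hd t ⟨ht, htp⟩ (dist x p) ⟨dist_nonneg, le_rfl⟩
    rwa [h1, abs_sub_comm, abs_of_nonneg (by linarith)] at this
  have hgx : dist (g • f t) x = t := by rwa [← hiso g (f t) x, hg] at hx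
  have hgp : dist (g • f t) (g • p) = dist x p - t := by rw [hiso, hp]
  have hpx : dist (g • p) x = dist x p := by rw [dist_comm x p, ← hiso g p x, hg]
  have hA := hT.2.2 (f t) (g • p) p x
  have hB := hT.2.2 (g • f t) (f t) (g • p) x
  rw [hx, hp, hpx] at hA
  rw [hgx, hgp, hpx, hx] at hB
  rw [hpx] at htg
  rw [dist_comm p x] at htg hA
  have hA' : dist (f t) (g • p) ≤ dist x p - t := by
    rcases max_cases (dist x p - t + dist x p) (t + dist (g • p) p) with ⟨h5, -⟩ | ⟨h5, -⟩ <;>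
      rw [h5] at hA <;> linarith
  have hB' : dist (g • f t) (f t) ≤ 0 := by
    rcases max_cases (dist x p - t + t) (t + dist (f t) (g • p)) with ⟨h5, -⟩ | ⟨h5, -⟩ <;>
      rw [h5] at hB <;> linarith
  exact dist_le_zero.1 hB'

theorem hasInvariantMean_pointwise_stabilizer {T : Type*} [MetricSpace T]
    {Γ : Type*} [Group Γ] [MulAction Γ T]
    (harc : ∀ x y : T, x ≠ y → ∀ A : Set T, IsArc T x y A →
      ∀ H : Subgroup Γ, (H : Set Γ) = {g : Γ | ∀ z ∈ A, g • z = z} → IsAmenableGroup H)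
    {x y : T} (hxy : x ≠ y) {A : Set T} (hA : IsArc T x y A) :
    HasInvariantMean {g : Γ | ∀ z ∈ A, g • z = z} := by
  have hcoe : (fixingSubgroup Γ A : Set Γ) = {g : Γ | ∀ z ∈ A, g • z = z} := by
    ext g
    exact mem_fixingSubgroup_iff Γ
  rw [← hcoe]
  exact (harc x y hxy A hA _ hcoe).hasInvariantMean

theorem stabilizer_of_not_isBranchPoint {T : Type*} [MetricSpace T] (hT : IsRTree T)
    (hpts : ∃ p q : T, p ≠ q) {Γ : Type*} [Group Γ] [MulAction Γ T]
    (hiso : ∀ (g : Γ) (x y : T), dist (g • x) (g • y) = dist x y)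
    (harc : ∀ x y : T, x ≠ y → ∀ A : Set T, IsArc T x y A →
      ∀ H : Subgroup Γ, (H : Set Γ) = {g : Γ | ∀ z ∈ A, g • z = z} → IsAmenableGroup H)
    {x : T} (hx : ¬IsBranchPoint T x) :
    (∃ N : Subgroup Γ, N ≤ MulAction.stabilizer Γ x ∧
      (∀ g ∈ MulAction.stabilizer Γ x, ∀ n ∈ N, g * n * g⁻¹ ∈ N) ∧
      (∀ a ∈ MulAction.stabilizer Γ x, ∀ b ∈ MulAction.stabilizer Γ x,
        a * b * a⁻¹ * b⁻¹ ∈ N) ∧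
      (∃ (ι : Type) (p q : ι → T) (A : ι → Set T), Nonempty ι ∧
        (∀ i, p i ≠ q i) ∧ (∀ i, IsArc T (p i) (q i) (A i)) ∧
        (∀ i j, ∃ l, {g : Γ | ∀ z ∈ A i, g • z = z} ∪
            {g : Γ | ∀ z ∈ A j, g • z = z} ⊆ {g : Γ | ∀ z ∈ A l, g • z = z}) ∧
        (N : Set Γ) = ⋃ i, {g : Γ | ∀ z ∈ A i, g • z = z})) ∧
      IsAmenableGroup (MulAction.stabilizer Γ x) := by
  obtain ⟨p, hp⟩ : ∃ p, p ≠ x := by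
    obtain ⟨p, q, hpq⟩ := hpts
    by_cases h : p = x
    exacts [⟨q, fun hq => hpq (h.trans hq.symm)⟩, ⟨p, h⟩]
  have hD : 0 < dist x p := dist_pos.2 hp.symm
  obtain ⟨f, hf⟩ := hT.2.1 x p
  -- at most two directions at `x`
  have htwo : ∀ a b c : T, a ≠ x → b ≠ x → c ≠ x →
      SameDirection x a b ∨ SameDirection x a c ∨ SameDirection x b c := by
    intro a b c ha hb hc
    by_contra! hcon
    exact hx ⟨a, b, c, ha, hb, hc,
      fun h => hcon.1 (sameDirection_of_connectedComponentIn_eq hT ha hb h),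
      fun h => hcon.2.1 (sameDirection_of_connectedComponentIn_eq hT ha hc h),
      fun h => hcon.2.2 (sameDirection_of_connectedComponentIn_eq hT hb hc h)⟩
  have hne : ∀ g : Γ, g • x = x → g • p ≠ x := fun g hg h =>
    hp ((MulAction.injective g) (h.trans hg.symm))
  have hsmul : ∀ (g : Γ), g • x = x → ∀ a b,
      (SameDirection x (g • a) (g • b) ↔ SameDirection x a b) := by
    intro g hg a b
    have h1 : ∀ a, dist (g • a) x = dist a x := fun a => by rw [← hiso g a x, hg]
    simp only [SameDirection, h1, hiso]
  -- the sign of an element of the stabilizer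
  have hmul : ∀ g h : Γ, g • x = x → h • x = x →
      (SameDirection x ((g * h) • p) p ↔
        (SameDirection x (g • p) p ↔ SameDirection x (h • p) p)) := by
    intro g h hg hh
    have hgh : (g * h) • x = x := by rw [mul_smul, hh, hg]
    have key := hsmul g hg (h • p) p
    rw [← mul_smul] at key
    by_cases h1 : SameDirection x (h • p) p
    · simp only [h1, iff_true] at key ⊢
      exact ⟨fun h2 => key.symm.trans hT h2, fun h2 => key.trans hT h2⟩
    · simp only [h1, iff_false] at key ⊢
      constructor
      · exact fun h2 h3 => key (h2.trans hT h3.symm)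
      · intro h2
        rcases htwo _ _ _ (hne _ hgh) (hne _ hg) hp with h3 | h3 | h3
        exacts [absurd h3 key, h3, absurd h3 h2]
  have hone : SameDirection x ((1 : Γ) • p) p := by
    rw [one_smul]
    exact SameDirection.refl hp
  have hinvx : ∀ g : Γ, g • x = x → g⁻¹ • x = x := fun g hg => inv_smul_eq_iff.2 hg.symm
  have hinv : ∀ g : Γ, g • x = x →
      (SameDirection x (g⁻¹ • p) p ↔ SameDirection x (g • p) p) := by
    intro g hg
    have := hmul g g⁻¹ hg (hinvx g hg)
    rw [mul_inv_cancel] at this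
    exact (this.1 hone).symm
  let N : Subgroup Γ :=
    { carrier := {g | g • x = x ∧ SameDirection x (g • p) p}
      one_mem' := ⟨one_smul _ _, hone⟩
      mul_mem' := fun {a b} ha hb => ⟨by rw [mul_smul, hb.1, ha.1],
        (hmul a b ha.1 hb.1).2 (iff_of_true ha.2 hb.2)⟩
      inv_mem' := fun {a} ha => ⟨hinvx a ha.1, (hinv a ha.1).2 ha.2⟩ }
  let r : ℕ → ℝ := fun n => dist x p * (1 / ((n : ℝ) + 1))
  have hr0 : ∀ n, 0 < r n := fun n => by positivity
  have hr1 : ∀ n, r n ≤ dist x p := fun n => by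
    refine mul_le_of_le_one_right hD.le ?_
    rw [div_le_one (by positivity)]
    linarith [(Nat.cast_nonneg n : (0 : ℝ) ≤ n)]
  have hranti : Antitone r := fun i j hij => by
    have : (i : ℝ) ≤ j := by exact_mod_cast hij
    exact mul_le_mul_of_nonneg_left (one_div_le_one_div_of_le (by positivity) (by linarith)) hD.le
  have hrlim : Filter.Tendsto r Filter.atTop (nhds 0) := by
    simpa [r] using tendsto_one_div_add_atTop_nhds_zero_nat.const_mul (dist x p)
  let A : ℕ → Set T := fun n => f '' Set.Icc 0 (r n)
  have hdist : ∀ n, dist x (f (r n)) = r n := fun n => by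
    have := hf.2.2 0 ⟨le_rfl, hD.le⟩ (r n) ⟨(hr0 n).le, hr1 n⟩
    rwa [hf.1, zero_sub, abs_neg, abs_of_pos (hr0 n)] at this
  have hxq : ∀ n, x ≠ f (r n) := fun n => dist_pos.1 (by rw [hdist]; exact hr0 n)
  have hA : ∀ n, IsArc T x (f (r n)) (A n) := fun n => by
    refine ⟨f, ⟨hf.1, by rw [hdist], fun s hs t ht => ?_⟩, by rw [hdist]⟩
    rw [hdist] at hs ht
    exact hf.2.2 s ⟨hs.1, hs.2.trans (hr1 n)⟩ t ⟨ht.1, ht.2.trans (hr1 n)⟩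
  have hmono : ∀ i j, i ≤ j →
      {g : Γ | ∀ z ∈ A i, g • z = z} ⊆ {g : Γ | ∀ z ∈ A j, g • z = z} :=
    fun i j hij g hg z hz =>
      hg z (Set.image_mono (Set.Icc_subset_Icc_right (hranti hij)) hz)
  have hNev : ∀ g ∈ N, ∀ᶠ n in Filter.atTop, g ∈ {g : Γ | ∀ z ∈ A n, g • z = z} := by
    rintro g ⟨hgx, hgp⟩
    have hδ : 0 < (dist (g • p) x + dist p x - dist (g • p) p) / 2 := by
      unfold SameDirection at hgp
      linarith
    filter_upwards [hrlim.eventually (gt_mem_nhds hδ)] with n hn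
    rintro _ ⟨t, ht, rfl⟩
    exact smul_eq_of_sameDirection hT hiso hf hgx ht.1 (ht.2.trans (hr1 n)) (by linarith [ht.2])
  have hNU : (N : Set Γ) = ⋃ i, {g : Γ | ∀ z ∈ A i, g • z = z} := by
    ext g
    rw [Set.mem_iUnion]
    refine ⟨fun hg => (hNev g hg).exists, ?_⟩
    rintro ⟨n, hn⟩
    have hgx : g • x = x := hn x ⟨0, ⟨le_rfl, (hr0 n).le⟩, hf.1⟩
    have hgq : g • f (r n) = f (r n) := hn _ ⟨r n, ⟨(hr0 n).le, le_rfl⟩, rfl⟩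
    have hqp : SameDirection x (f (r n)) p := by
      have h1 := hf.2.2 (r n) ⟨(hr0 n).le, hr1 n⟩ (dist x p) ⟨hD.le, le_rfl⟩
      rw [hf.2.1, abs_sub_comm, abs_of_nonneg (by linarith [hr1 n])] at h1
      unfold SameDirection
      rw [h1, dist_comm _ x, hdist, dist_comm p x]
      linarith [hr0 n]
    have h2 := (hsmul g hgx _ _).2 hqp
    rw [hgq] at h2
    exact ⟨hgx, h2.symm.trans hT hqp⟩
  have hcomm : ∀ a ∈ MulAction.stabilizer Γ x, ∀ b ∈ MulAction.stabilizer Γ x,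
      a * b * a⁻¹ * b⁻¹ ∈ N := by
    intro a ha b hb
    rw [MulAction.mem_stabilizer_iff] at ha hb
    have hab : (a * b) • x = x := by rw [mul_smul, hb, ha]
    have haba : (a * b * a⁻¹) • x = x := by rw [mul_smul, hinvx a ha, hab]
    refine ⟨by rw [mul_smul, hinvx b hb, haba], ?_⟩
    rw [hmul _ _ haba (hinvx b hb), hmul _ _ hab (hinvx a ha), hmul _ _ ha hb, hinv a ha, hinv b hb]
    tauto
  refine ⟨⟨N, fun g hg => hg.1, fun g hg n hn => ?_, hcomm, ℕ, fun _ => x, fun n => f (r n), A,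
    ⟨0⟩, hxq, hA, fun i j => ⟨max i j, Set.union_subset (hmono _ _ (le_max_left _ _))
      (hmono _ _ (le_max_right _ _))⟩, hNU⟩, ?_⟩
  · have := N.mul_mem (hcomm g hg n hn.1) hn
    rwa [inv_mul_cancel_right] at this
  · have hN : HasInvariantMean (N : Set Γ) := .of_eventually Filter.atTop _
      (fun n => hasInvariantMean_pointwise_stabilizer harc (hxq n) (hA n)) _ hNev
    exact (hN.of_commutators hcomm).isAmenableGroup

theorem eq_add_or_eq_sub_of_isometric {d : ENNReal} {u : ℝ → ℝ}
    (hu : ∀ s t : ℝ, 0 ≤ s → ENNReal.ofReal s < d → 0 ≤ t → ENNReal.ofReal t < d →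
      |u s - u t| = |s - t|) (hd : 0 < d) :
    (∀ t, 0 ≤ t → ENNReal.ofReal t < d → u t = u 0 + t) ∨
      (∀ t, 0 ≤ t → ENNReal.ofReal t < d → u t = u 0 - t) := by
  by_contra! hcon
  obtain ⟨⟨t, ht, htd, htn⟩, s, hs, hsd, hsn⟩ := hcon
  have h0 : ENNReal.ofReal 0 < d := by simpa using hd
  have h1 := hu t 0 ht htd le_rfl h0
  have h2 := hu s 0 hs hsd le_rfl h0
  have h3 := hu s t hs hsd ht htd
  rw [sub_zero, abs_of_nonneg ht] at h1
  rw [sub_zero, abs_of_nonneg hs] at h2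
  have h1' : u t = u 0 - t := by
    rcases abs_cases (u t - u 0) with h | h
    · exact absurd (by linarith) htn
    · linarith
  have h2' : u s = u 0 + s := by
    rcases abs_cases (u s - u 0) with h | h
    · linarith
    · exact absurd (by linarith) hsn
  have hs0 : 0 < s := lt_of_le_of_ne hs fun h => hsn (by rw [h2', ← h]; ring)
  have ht0 : 0 < t := lt_of_le_of_ne ht fun h => htn (by rw [h1', ← h]; ring)
  rw [h1', h2'] at h3
  rcases abs_cases (s - t) with h | h <;> rcases abs_cases (u 0 + s - (u 0 - t)) with h' | h' <;>
    linarith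

theorem IsRayParam.no_endpoint {T : Type*} [MetricSpace T] {d : ENNReal} {h : ℝ → T}
    (hh : IsRayParam T d h) {e : ℝ} (he : d = ENNReal.ofReal e) (L : T) :
    ¬∀ t, 0 ≤ t → t < e → dist (h t) L ≤ e - t := by
  intro hL
  have he0 : 0 < e := by
    have := hh.1
    rwa [he, ENNReal.ofReal_pos] at this
  refine hh.2.2 ⟨L, fun ε hε => ⟨max 0 (e - ε / 2), le_max_left _ _, ?_, fun t ht htd => ?_⟩⟩
  · rw [he]
    exact (ENNReal.ofReal_lt_ofReal_iff he0).2 (max_lt he0 (by linarith))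
  · have ht0 : 0 ≤ t := (le_max_left _ _).trans ht
    rw [he, ENNReal.ofReal_lt_ofReal_iff he0] at htd
    linarith [hL t ht0 htd, (le_max_right 0 (e - ε / 2)).trans ht]

/-- A ray contained in an isometrically parametrized segment is a terminal part
of it, parametrized in the same direction. -/
theorem IsRayParam.eq_add_of_subset {T : Type*} [MetricSpace T] {d d' : ENNReal} {f h : ℝ → T}
    (hf : ∀ s t : ℝ, 0 ≤ s → ENNReal.ofReal s < d → 0 ≤ t → ENNReal.ofReal t < d →
      dist (f s) (f t) = |s - t|)
    (hh : IsRayParam T d' h)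
    (hsub : ∀ t, 0 ≤ t → ENNReal.ofReal t < d' → ∃ s, 0 ≤ s ∧ ENNReal.ofReal s < d ∧ f s = h t) :
    ∃ u, 0 ≤ u ∧ ENNReal.ofReal u < d ∧ ∀ t, 0 ≤ t →
      ((ENNReal.ofReal t < d' ↔ ENNReal.ofReal (u + t) < d) ∧
        (ENNReal.ofReal t < d' → h t = f (u + t))) := by
  choose! u hu0 hud hu using hsub
  have hz : ENNReal.ofReal 0 < d' := by simpa using hh.1
  have hiso : ∀ s t : ℝ, 0 ≤ s → ENNReal.ofReal s < d' → 0 ≤ t → ENNReal.ofReal t < d' →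
      |u s - u t| = |s - t| := fun s t hs hsd ht htd => by
    rw [← hh.2.1 s t hs hsd ht htd, ← hu s hs hsd, ← hu t ht htd,
      hf _ _ (hu0 s hs hsd) (hud s hs hsd) (hu0 t ht htd) (hud t ht htd)]
  have hu00 := hu0 0 le_rfl hz
  have hud0 := hud 0 le_rfl hz
  have hlt : ∀ e : ℝ, d' = ENNReal.ofReal e → ∀ t, 0 ≤ t → t < e → ENNReal.ofReal t < d' :=
    fun e he t ht hte => by
      rw [he]
      exact (ENNReal.ofReal_lt_ofReal_iff (ht.trans_lt hte)).2 hte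
  have hinc : ∀ t, 0 ≤ t → ENNReal.ofReal t < d' → u t = u 0 + t := by
    refine (eq_add_or_eq_sub_of_isometric hiso hh.1).resolve_right fun hdec => ?_
    have hle : d' ≤ ENNReal.ofReal (u 0) := by
      by_contra! hlt
      obtain ⟨w, hw0, hw1, hw2⟩ := ENNReal.lt_iff_exists_real_btwn.1 hlt
      have h1 := hu0 w hw0 hw2
      rw [hdec w hw0 hw2] at h1
      exact absurd hw1 (not_lt.2 (ENNReal.ofReal_le_ofReal (by linarith)))
    have hd' : d' ≠ ⊤ := ne_top_of_le_ne_top ENNReal.ofReal_ne_top hle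
    have he : d' = ENNReal.ofReal d'.toReal := (ENNReal.ofReal_toReal hd').symm
    have heu : d'.toReal ≤ u 0 := by
      rw [he] at hle
      exact (ENNReal.ofReal_le_ofReal_iff hu00).1 hle
    have he0 : 0 ≤ d'.toReal := ENNReal.toReal_nonneg
    refine hh.no_endpoint he (f (u 0 - d'.toReal)) fun t ht hte => ?_
    have htd := hlt _ he t ht hte
    have hdt := hdec t ht htd
    rw [← hu t ht htd, hf _ _ (hu0 t ht htd) (hud t ht htd) (by linarith)
      ((ENNReal.ofReal_le_ofReal (by linarith)).trans_lt hud0), hdt]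
    rw [abs_of_nonneg (by linarith)]
    linarith
  refine ⟨u 0, hu00, hud0, fun t ht => ⟨⟨fun htd => ?_, fun htd => ?_⟩, fun htd => ?_⟩⟩
  · rw [← hinc t ht htd]
    exact hud t ht htd
  · by_contra! hle
    have hd' : d' ≠ ⊤ := ne_top_of_le_ne_top ENNReal.ofReal_ne_top hle
    have he : d' = ENNReal.ofReal d'.toReal := (ENNReal.ofReal_toReal hd').symm
    have het : d'.toReal ≤ t := by
      rw [he] at hle
      exact (ENNReal.ofReal_le_ofReal_iff ht).1 hle
    have he0 : 0 ≤ d'.toReal := ENNReal.toReal_nonneg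
    refine hh.no_endpoint he (f (u 0 + d'.toReal)) fun s hs hse => ?_
    have hsd := hlt _ he s hs hse
    rw [← hu s hs hsd, hf _ _ (hu0 s hs hsd) (hud s hs hsd) (by linarith)
      ((ENNReal.ofReal_le_ofReal (by linarith)).trans_lt htd), hinc s hs hsd, abs_sub_comm]
    rw [abs_of_nonneg (by linarith)]
    linarith
  · rw [← hinc t ht htd, hu t ht htd]

/-- An isometry fixing the end of a ray acts on a terminal part of the ray as a translation, which
is trivial if the ray has finite length. -/
theorem exists_translation_of_isRay_inter {T : Type*} [MetricSpace T]
    {Γ : Type*} [Group Γ] [MulAction Γ T]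
    (hiso : ∀ (g : Γ) (x y : T), dist (g • x) (g • y) = dist x y) {d : ENNReal} {f : ℝ → T}
    (hf : IsRayParam T d f) {g : Γ}
    (hg : IsRay T (((g • ·) '' (f '' {t : ℝ | 0 ≤ t ∧ ENNReal.ofReal t < d})) ∩
      f '' {t : ℝ | 0 ≤ t ∧ ENNReal.ofReal t < d})) :
    ∃ c s : ℝ, 0 ≤ s ∧ ENNReal.ofReal s < d ∧ (d ≠ ⊤ → c = 0) ∧
      ∀ t, s ≤ t → ENNReal.ofReal t < d → g • f t = f (t + c) := by
  obtain ⟨d', h, hh, heq⟩ := hg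
  have hmem : ∀ t, 0 ≤ t → ENNReal.ofReal t < d' →
      h t ∈ ((g • ·) '' (f '' {t : ℝ | 0 ≤ t ∧ ENNReal.ofReal t < d})) ∩
      f '' {t : ℝ | 0 ≤ t ∧ ENNReal.ofReal t < d} := fun t ht htd => by
    rw [heq]
    exact ⟨t, ⟨ht, htd⟩, rfl⟩
  obtain ⟨u, hu0, hud, hu⟩ := hh.eq_add_of_subset hf.2.1 fun t ht htd => by
    obtain ⟨-, s, hs, hst⟩ := hmem t ht htd
    exact ⟨s, hs.1, hs.2, hst⟩
  obtain ⟨v, hv0, hvd, hv⟩ := hh.eq_add_of_subset (f := fun t => g • f t) (d := d)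
    (fun s t hs hsd ht htd => by rw [hiso, hf.2.1 s t hs hsd ht htd]) fun t ht htd => by
    obtain ⟨⟨_, ⟨s, hs, rfl⟩, hst⟩, -⟩ := hmem t ht htd
    exact ⟨s, hs.1, hs.2, hst⟩
  refine ⟨u - v, v, hv0, hvd, fun hd => ?_, fun t ht htd => ?_⟩
  · have he : d = ENNReal.ofReal d.toReal := (ENNReal.ofReal_toReal hd).symm
    have he0 : 0 < d.toReal := ENNReal.toReal_pos hf.1.ne' hd
    have hiff : ∀ t, 0 ≤ t → (u + t < d.toReal ↔ v + t < d.toReal) := fun t ht => by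
      have := (hu t ht).1.symm.trans (hv t ht).1
      rwa [he, ENNReal.ofReal_lt_ofReal_iff he0, ENNReal.ofReal_lt_ofReal_iff he0] at this
    rw [he, ENNReal.ofReal_lt_ofReal_iff he0] at hud hvd
    have h1 := hiff (d.toReal - u) (by linarith)
    have h2 := hiff (d.toReal - v) (by linarith)
    simp only [add_sub_cancel, lt_self_iff_false, iff_false, false_iff, not_lt] at h1 h2
    linarith
  · have h1 := hv (t - v) (by linarith)
    have h2 := hu (t - v) (by linarith)
    rw [add_sub_cancel] at h1
    have h3 := h1.1.2 htd
    rw [← h1.2 h3, h2.2 h3]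
    congr 1
    ring

theorem stabilizer_of_boundary_point {T : Type*} [MetricSpace T]
    {Γ : Type*} [Group Γ] [MulAction Γ T]
    (hiso : ∀ (g : Γ) (x y : T), dist (g • x) (g • y) = dist x y)
    (harc : ∀ x y : T, x ≠ y → ∀ A : Set T, IsArc T x y A →
      ∀ H : Subgroup Γ, (H : Set Γ) = {g : Γ | ∀ z ∈ A, g • z = z} → IsAmenableGroup H)
    {R : Set T} (hR : IsRay T R) {H : Subgroup Γ}
    (hH : (H : Set Γ) = {g : Γ | IsRay T (((g • ·) '' R) ∩ R)}) : IsAmenableGroup H := by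
  obtain ⟨d, f, hf, rfl⟩ := hR
  let D := {s : ℝ // 0 ≤ s ∧ ENNReal.ofReal s < d}
  have hD : Nonempty D := ⟨⟨0, le_rfl, by simpa using hf.1⟩⟩
  let N : D → Set Γ := fun s => {g | ∀ t, s.1 ≤ t → ENNReal.ofReal t < d → g • f t = f t}
  have hN : ∀ s, HasInvariantMean (N s) := by
    rintro ⟨s, hs0, hsd⟩
    obtain ⟨w, hw0, hsw, hwd⟩ := ENNReal.lt_iff_exists_real_btwn.1 hsd
    have hsw' : s < w := (ENNReal.ofReal_lt_ofReal_iff_of_nonneg hs0).1 hsw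
    have hdist : dist (f s) (f w) = w - s := by
      rw [hf.2.1 s w hs0 hsd hw0 hwd, abs_sub_comm, abs_of_pos (by linarith)]
    have hlt : ∀ t ≤ w - s, ENNReal.ofReal (s + t) < d := fun t ht =>
      (ENNReal.ofReal_le_ofReal (by linarith)).trans_lt hwd
    refine (hasInvariantMean_pointwise_stabilizer harc (x := f s) (y := f w)
      (A := (fun t => f (s + t)) '' Set.Icc 0 (dist (f s) (f w)))
      (dist_pos.1 (by rw [hdist]; linarith))
      ⟨fun t => f (s + t), ⟨by simp, by simp [hdist], fun a ha b hb => ?_⟩, rfl⟩).mono ?_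
    · rw [hdist] at ha hb
      rw [hf.2.1 _ _ (by linarith [ha.1]) (hlt a ha.2) (by linarith [hb.1]) (hlt b hb.2),
        add_sub_add_left_eq_sub]
    · rintro g hg _ ⟨t, ht, rfl⟩
      rw [hdist] at ht
      exact hg (s + t) (by simpa using ht.1) (hlt t ht.2)
  have hU : HasInvariantMean {g : Γ | ∃ s, g ∈ N s} := by
    refine .of_eventually Filter.atTop N hN _ ?_
    rintro g ⟨s, hs⟩
    filter_upwards [Filter.eventually_ge_atTop s] with s' hss' t ht htd
    exact hs t (le_trans hss' ht) htd
  refine (hU.of_commutators (H := H) fun a ha b hb => ?_).isAmenableGroup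
  have hex : ∀ g ∈ H, ∃ c s : ℝ, 0 ≤ s ∧ ENNReal.ofReal s < d ∧ (d ≠ ⊤ → c = 0) ∧
      ∀ t, s ≤ t → ENNReal.ofReal t < d → g • f t = f (t + c) := fun g hg =>
    exists_translation_of_isRay_inter hiso hf (hH.subset hg)
  obtain ⟨α, sa, hsa0, hsad, hα, hfa⟩ := hex a ha
  obtain ⟨β, sb, hsb0, hsbd, hβ, hfb⟩ := hex b hb
  have hlt : ∀ t c : ℝ, (d ≠ ⊤ → c = 0) → ENNReal.ofReal t < d → ENNReal.ofReal (t + c) < d := by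
    intro t c hc ht
    by_cases hd : d = ⊤
    · exact hd ▸ ENNReal.ofReal_lt_top
    · rwa [hc hd, add_zero]
  refine ⟨⟨max sa sb + (2 * |α| + 2 * |β|), by positivity, hlt _ _ (fun hd => ?_) ?_⟩,
    fun t ht htd => ?_⟩
  · simp [hα hd, hβ hd]
  · rcases max_choice sa sb with h | h <;> rwa [h]
  · have ht' : ENNReal.ofReal (t + (-α - β)) < d :=
      hlt _ _ (fun hd => by simp [hα hd, hβ hd]) htd
    have hα1 := neg_abs_le α
    have hα2 := le_abs_self α
    have hβ1 := neg_abs_le β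
    have hβ2 := le_abs_self β
    have hm1 := le_max_left sa sb
    have hm2 := le_max_right sa sb
    dsimp only at ht
    have hab : a • b • f (t + (-α - β)) = f t := by
      rw [hfb _ (by linarith) ht', hfa _ (by linarith) (hlt _ _ hβ ht')]
      congr 1
      ring
    have hba : b • a • f (t + (-α - β)) = f t := by
      rw [hfa _ (by linarith) ht', hfb _ (by linarith) (hlt _ _ hα ht')]
      congr 1
      ring
    conv_lhs => rw [← hba]
    simp only [mul_smul, inv_smul_smul]
    exact hab

/-- Let `T` be an `ℝ`-tree with more than one point on which `Γ` acts by isometries,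
such that the pointwise stabilizer of every nondegenerate arc is amenable.  Then:
(a) the stabilizer `Γ^x` of every non-branching point `x ∈ T` contains a normal
subgroup `N` that is a directed union of pointwise stabilizers of nondegenerate arcs
with `Γ^x / N` abelian, and `Γ^x` is amenable;
(b) the stabilizer of every boundary point (equivalence class of rays, where two rays
are equivalent iff their intersection is a ray) is amenable. -/
theorem stabilizers_amenable_of_rTree
    (T : Type*) [MetricSpace T] (hT : IsRTree T) (hpts : ∃ p q : T, p ≠ q)
    (Γ : Type*) [Group Γ] [MulAction Γ T]
    (hiso : ∀ (g : Γ) (x y : T), dist (g • x) (g • y) = dist x y)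
    (harc : ∀ x y : T, x ≠ y → ∀ A : Set T, IsArc T x y A →
      ∀ H : Subgroup Γ, (H : Set Γ) = {g : Γ | ∀ z ∈ A, g • z = z} →
        IsAmenableGroup H) :
    (∀ x : T, ¬IsBranchPoint T x →
      (∃ N : Subgroup Γ, N ≤ MulAction.stabilizer Γ x ∧
        (∀ g ∈ MulAction.stabilizer Γ x, ∀ n ∈ N, g * n * g⁻¹ ∈ N) ∧
        (∀ a ∈ MulAction.stabilizer Γ x, ∀ b ∈ MulAction.stabilizer Γ x,
          a * b * a⁻¹ * b⁻¹ ∈ N) ∧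
        (∃ (ι : Type) (p q : ι → T) (A : ι → Set T), Nonempty ι ∧
          (∀ i, p i ≠ q i) ∧ (∀ i, IsArc T (p i) (q i) (A i)) ∧
          (∀ i j, ∃ l, {g : Γ | ∀ z ∈ A i, g • z = z} ∪
              {g : Γ | ∀ z ∈ A j, g • z = z} ⊆ {g : Γ | ∀ z ∈ A l, g • z = z}) ∧
          (N : Set Γ) = ⋃ i, {g : Γ | ∀ z ∈ A i, g • z = z})) ∧
      IsAmenableGroup (MulAction.stabilizer Γ x)) ∧
    (∀ R : Set T, IsRay T R →
      ∀ H : Subgroup Γ, (H : Set Γ) = {g : Γ | IsRay T (((g • ·) '' R) ∩ R)} →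
        IsAmenableGroup H) := by
  exact ⟨fun _ hx => stabilizer_of_not_isBranchPoint hT hpts hiso harc hx,
    fun _ hR _ hH => stabilizer_of_boundary_point hiso harc hR hH⟩
end

section
/- Let Γ be a group, let F, E ⊆ Γ be finite subsets with 1 ∈ F = F⁻¹ and 1 ∈ E = E⁻¹, and let ε > 0. Suppose there exists a map η : Γ → (Γ → ℝ) such that each η^x := η(x) is nonnegative with Σ_t η^x(t) = 1 and supp η^x ⊆ E for all x ∈ Γ, and Σ_{s ∈ F} sup_{x ∈ Γ} ‖η^{sx} − s·η^x‖₁ ≤ ε. Then for every m ∈ ℕ and every family (a_s)_{s ∈ F} of m × m complex matrices, the bounded operator S on ℓ²(Fin m × Γ) defined by (Sξ)(i, x) = Σ_{s ∈ F} Σ_{j} (a_s)_{ij} ξ(j, s⁻¹x) satisfies (1 − ε)·‖S‖ ≤ ‖(1 ⊗ P_E) S (1 ⊗ P_E)‖ ≤ ‖S‖, where 1 ⊗ P_E denotes the orthogonal projection of ℓ²(Fin m × Γ) onto the functions supported in Fin m × E. In particular (m = 1), for every f : Γ → ℂ supported in F, (1 − ε)·‖λ(f)‖ ≤ ‖P_E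 λ(f) P_E‖ ≤ ‖λ(f)‖. -/
noncomputable section

open scoped ComplexConjugate

/-- The sesquilinear form on `ℂᵐ` given by a matrix `A`. -/
def matForm {m : ℕ} (A : Matrix (Fin m) (Fin m) ℂ) (α β : EuclideanSpace ℂ (Fin m)) : ℂ :=
  ∑ i, conj (α i) * ∑ j, A i j * β j

theorem matForm_smul_smul {m : ℕ} (A : Matrix (Fin m) (Fin m) ℂ) (c d : ℝ)
    (α β : EuclideanSpace ℂ (Fin m)) :
    matForm A ((c : ℂ) • α) ((d : ℂ) • β) = ((c * d : ℝ) : ℂ) * matForm A α β := by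
  simp only [matForm, PiLp.smul_apply, smul_eq_mul, map_mul, Complex.conj_ofReal, Finset.mul_sum,
    Complex.ofReal_mul]
  refine Finset.sum_congr rfl fun i _ => Finset.sum_congr rfl fun j _ => ?_
  ring

@[simp]
theorem matForm_zero_right {m : ℕ} (A : Matrix (Fin m) (Fin m) ℂ)
    (α : EuclideanSpace ℂ (Fin m)) : matForm A α 0 = 0 := by
  simp [matForm]

@[simp]
theorem matForm_zero_left {m : ℕ} (A : Matrix (Fin m) (Fin m) ℂ)
    (β : EuclideanSpace ℂ (Fin m)) : matForm A 0 β = 0 := by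
  simp [matForm]

/-- The restriction of a `ℂᵐ`-valued function to a finite set `K`, as a vector of
`ℓ²(Fin m × Γ)`. -/
def finVec {Γ : Type*} [DecidableEq Γ] {m : ℕ} (K : Finset Γ)
    (u : Γ → EuclideanSpace ℂ (Fin m)) : lp (fun _ : Fin m × Γ => ℂ) 2 :=
  ∑ p ∈ Finset.univ ×ˢ K, lp.single 2 p (u p.2 p.1)

section finVec

variable {Γ : Type*} [DecidableEq Γ] {m : ℕ}

theorem finVec_apply (K : Finset Γ) (u : Γ → EuclideanSpace ℂ (Fin m)) (i : Fin m) (x : Γ) :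
    finVec K u (i, x) = if x ∈ K then u x i else 0 := by
  simp only [finVec, lp.coeFn_sum, Finset.sum_apply, lp.single_apply, Pi.single_apply]
  rw [Finset.sum_ite_eq]
  simp

theorem finVec_apply_of_eq_zero (K : Finset Γ) (v : Γ → EuclideanSpace ℂ (Fin m))
    (hv : ∀ x ∉ K, v x = 0) (i : Fin m) (x : Γ) : finVec K v (i, x) = v x i := by
  rw [finVec_apply]
  split_ifs with h
  · rfl
  · simp [hv x h]

theorem norm_finVec_sq (K : Finset Γ) (u : Γ → EuclideanSpace ℂ (Fin m)) :
    ‖finVec K u‖ ^ 2 = ∑ x ∈ K, ‖u x‖ ^ 2 := by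
  have h := lp.norm_sum_single (E := fun _ : Fin m × Γ => ℂ) (p := 2) (by norm_num)
    (fun p => u p.2 p.1) (Finset.univ ×ˢ K)
  simp only [ENNReal.toReal_ofNat, Real.rpow_ofNat] at h
  rw [finVec, h, Finset.sum_product_right]
  exact Finset.sum_congr rfl fun x _ => (EuclideanSpace.norm_sq_eq (u x)).symm

theorem norm_finVec (K : Finset Γ) (u : Γ → EuclideanSpace ℂ (Fin m)) :
    ‖finVec K u‖ = √(∑ x ∈ K, ‖u x‖ ^ 2) := by
  rw [← norm_finVec_sq, Real.sqrt_sq (norm_nonneg _)]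

theorem inner_finVec_left (K : Finset Γ) (u : Γ → EuclideanSpace ℂ (Fin m))
    (f : lp (fun _ : Fin m × Γ => ℂ) 2) :
    inner ℂ (finVec K u) f = ∑ x ∈ K, ∑ i, conj (u x i) * f (i, x) := by
  rw [finVec, sum_inner, Finset.sum_product_right]
  refine Finset.sum_congr rfl fun x _ => Finset.sum_congr rfl fun i _ => ?_
  rw [lp.inner_single_left, RCLike.inner_apply, mul_comm]

/-- An element of `ℓ²(Fin m × Γ)` viewed as a `ℂᵐ`-valued function on `Γ`. -/
def fiber (f : lp (fun _ : Fin m × Γ => ℂ) 2) (x : Γ) : EuclideanSpace ℂ (Fin m) :=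
  WithLp.toLp 2 fun i => f (i, x)

theorem norm_finVec_fiber_le (K : Finset Γ) (f : lp (fun _ : Fin m × Γ => ℂ) 2) :
    ‖finVec K (fiber f)‖ ≤ ‖f‖ := by
  have h := lp.sum_rpow_le_norm_rpow (E := fun _ : Fin m × Γ => ℂ) (p := 2) (by norm_num) f
    (Finset.univ ×ˢ K)
  have h' := lp.norm_sum_single (E := fun _ : Fin m × Γ => ℂ) (p := 2) (by norm_num)
    (fun p => f p) (Finset.univ ×ˢ K)
  simp only [ENNReal.toReal_ofNat, Real.rpow_ofNat] at h h'
  rw [← h'] at h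
  exact le_of_sq_le_sq h (norm_nonneg _)

theorem tendsto_finVec_fiber (f : lp (fun _ : Fin m × Γ => ℂ) 2) :
    Filter.Tendsto (fun K : Finset Γ => finVec K (fiber f)) Filter.atTop (nhds f) := by
  have h := lp.hasSum_single (E := fun _ : Fin m × Γ => ℂ) (p := 2) (by norm_num) f
  have h2 : Filter.Tendsto (fun K : Finset Γ => (Finset.univ : Finset (Fin m)) ×ˢ K)
      Filter.atTop Filter.atTop := by
    refine Filter.tendsto_atTop_finset_of_monotone (fun K L hKL => ?_) fun p => ⟨{p.2}, by simp⟩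
    exact Finset.product_subset_product_right hKL
  rw [HasSum, SummationFilter.unconditional_filter] at h
  exact h.comp h2

theorem opNorm_le_of_finVec (T : lp (fun _ : Fin m × Γ => ℂ) 2 →L[ℂ] lp (fun _ : Fin m × Γ => ℂ) 2)
    {C : ℝ} (hC : 0 ≤ C)
    (h : ∀ (K : Finset Γ) (u v : Γ → EuclideanSpace ℂ (Fin m)), (∀ x ∉ K, u x = 0) →
      (∀ x ∉ K, v x = 0) →
      ‖inner ℂ (finVec K u) (T (finVec K v))‖ ≤ C * ‖finVec K u‖ * ‖finVec K v‖) :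
    ‖T‖ ≤ C := by
  have h1 : ∀ f g, ‖inner ℂ f (T g)‖ ≤ C * ‖f‖ * ‖g‖ := by
    intro f g
    have hf := tendsto_finVec_fiber f
    have hg := tendsto_finVec_fiber g
    refine le_of_tendsto_of_tendsto' (hf.inner ((T.continuous.tendsto g).comp hg)).norm
      ((hf.norm.const_mul C).mul hg.norm) fun K => ?_
    have key : ∀ f : lp (fun _ : Fin m × Γ => ℂ) 2,
        finVec K (fun x => if x ∈ K then fiber f x else 0) = finVec K (fiber f) := by
      intro f
      ext ⟨i, x⟩
      rw [finVec_apply, finVec_apply]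
      split_ifs <;> rfl
    have := h K (fun x => if x ∈ K then fiber f x else 0) (fun x => if x ∈ K then fiber g x else 0)
      (fun x hx => if_neg hx) (fun x hx => if_neg hx)
    rwa [key, key] at this
  refine ContinuousLinearMap.opNorm_le_bound _ hC fun g => ?_
  have h2 := h1 (T g) g
  rw [inner_self_eq_norm_sq_to_K] at h2
  simp only [Complex.coe_algebraMap, norm_pow, Complex.norm_real, norm_norm] at h2
  rcases (norm_nonneg (T g)).eq_or_lt with h0 | h0
  · rw [← h0]; positivity
  · refine le_of_mul_le_mul_left ?_ h0
    linarith

end finVec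

theorem sum_mul_right_eq {Γ M : Type*} [Group Γ] [AddCommMonoid M] (K E : Finset Γ) (g : Γ)
    (f : Γ → M) (hK : ∀ x ∉ K, f x = 0) (hE : ∀ x ∉ E, f (x * g) = 0) :
    ∑ x ∈ E, f (x * g) = ∑ y ∈ K, f y := by
  have h1 : ∑ᶠ x, f (x * g) = ∑ᶠ y, f y := finsum_comp_equiv (Equiv.mulRight g) (f := f)
  rwa [finsum_eq_sum_of_support_subset (s := E), finsum_eq_sum_of_support_subset (s := K)] at h1
  · intro y hy
    by_contra hyK
    exact hy (hK y hyK)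
  · intro x hx
    by_contra hxE
    exact hx (hE x hxE)

theorem sum_mul_left_eq {Γ M : Type*} [Group Γ] [AddCommMonoid M] (K E : Finset Γ) (g : Γ)
    (f : Γ → M) (hK : ∀ x ∉ K, f x = 0) (hE : ∀ x ∉ E, f (g * x) = 0) :
    ∑ x ∈ E, f (g * x) = ∑ y ∈ K, f y := by
  have h1 : ∑ᶠ x, f (g * x) = ∑ᶠ y, f y := finsum_comp_equiv (Equiv.mulLeft g) (f := f)
  rwa [finsum_eq_sum_of_support_subset (s := E), finsum_eq_sum_of_support_subset (s := K)] at h1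
  · intro y hy
    by_contra hyK
    exact hy (hK y hyK)
  · intro x hx
    by_contra hxE
    exact hx (hE x hxE)

theorem sum_norm_sq_translate_le {Γ V : Type*} [Group Γ] [NormedAddCommGroup V] (K : Finset Γ)
    (g : Γ) (v : Γ → V) (hv : ∀ x ∉ K, v x = 0) :
    ∑ x ∈ K, ‖v (g * x)‖ ^ 2 ≤ ∑ x ∈ K, ‖v x‖ ^ 2 := by
  classical
  have : ∑ x ∈ K ∪ K.image (g⁻¹ * ·), ‖v (g * x)‖ ^ 2 = ∑ x ∈ K, ‖v x‖ ^ 2 := by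
    refine sum_mul_left_eq K _ g (fun x => ‖v x‖ ^ 2) (fun x hx => by simp [hv x hx]) ?_
    intro x hx
    have : g * x ∉ K := fun h => hx (Finset.mem_union_right _
      (Finset.mem_image.2 ⟨g * x, h, by simp⟩))
    simp [hv _ this]
  rw [← this]
  exact Finset.sum_le_sum_of_subset_of_nonneg Finset.subset_union_left fun _ _ _ => sq_nonneg _

theorem sum_norm_mul_norm_le {ι V : Type*} [NormedAddCommGroup V] (K : Finset ι) (u v : ι → V)
    {P Q : ℝ} (hP : ∑ x ∈ K, ‖u x‖ ^ 2 ≤ P ^ 2) (hQ : ∑ x ∈ K, ‖v x‖ ^ 2 ≤ Q ^ 2)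
    (hP0 : 0 ≤ P) (hQ0 : 0 ≤ Q) : ∑ x ∈ K, ‖u x‖ * ‖v x‖ ≤ P * Q := by
  refine (Real.sum_mul_le_sqrt_mul_sqrt K _ _).trans ?_
  exact mul_le_mul (Real.sqrt_le_iff.2 ⟨hP0, hP⟩) (Real.sqrt_le_iff.2 ⟨hQ0, hQ⟩)
    (Real.sqrt_nonneg _) hP0

theorem abs_sub_sqrt_mul_sqrt_le {p q : ℝ} (hp : 0 ≤ p) (hq : 0 ≤ q) :
    |p - √p * √q| ≤ |p - q| := by
  have h1 : p - √p * √q = √p * (√p - √q) := by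
    rw [mul_sub, Real.mul_self_sqrt hp]
  have h2 : p - q = (√p + √q) * (√p - √q) := by
    nlinarith [Real.mul_self_sqrt hp, Real.mul_self_sqrt hq]
  rw [h1, h2, abs_mul, abs_mul, abs_of_nonneg (Real.sqrt_nonneg p),
    abs_of_nonneg (add_nonneg (Real.sqrt_nonneg p) (Real.sqrt_nonneg q))]
  exact mul_le_mul_of_nonneg_right (by linarith [Real.sqrt_nonneg q]) (abs_nonneg _)

section convolution

variable {Γ : Type*} [Group Γ] [DecidableEq Γ] {m : ℕ} (F E : Finset Γ)
  (a : Γ → Matrix (Fin m) (Fin m) ℂ)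
  (S B : lp (fun _ : Fin m × Γ => ℂ) 2 →L[ℂ] lp (fun _ : Fin m × Γ => ℂ) 2)

/-- The sesquilinear form of `∑_{s ∈ F} a_s ⊗ λ(s)`, with the sum over `Γ` restricted to `K`. -/
def convForm (K : Finset Γ) (u v : Γ → EuclideanSpace ℂ (Fin m)) : ℂ :=
  ∑ x ∈ K, ∑ s ∈ F, matForm (a s) (u x) (v (s⁻¹ * x))

theorem inner_finVec_eq_convForm (K L : Finset Γ) (u v : Γ → EuclideanSpace ℂ (Fin m))
    (h : ∀ x ∈ K, ∀ i, S (finVec L v) (i, x) = ∑ s ∈ F, ∑ j, a s i j * v (s⁻¹ * x) j) :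
    inner ℂ (finVec K u) (S (finVec L v)) = convForm F a K u v := by
  rw [inner_finVec_left, convForm]
  refine Finset.sum_congr rfl fun x hx => ?_
  simp only [matForm]
  rw [Finset.sum_comm]
  refine Finset.sum_congr rfl fun i _ => ?_
  rw [h x hx, Finset.mul_sum]

variable
  (hS : ∀ (ξ : lp (fun _ : Fin m × Γ => ℂ) 2) (i : Fin m) (x : Γ),
    S ξ (i, x) = ∑ s ∈ F, ∑ j : Fin m, a s i j * ξ (j, s⁻¹ * x))
  (hB : ∀ (ξ : lp (fun _ : Fin m × Γ => ℂ) 2) (i : Fin m) (x : Γ),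
    B ξ (i, x) = if x ∈ E then
      ∑ s ∈ F, ∑ j : Fin m, a s i j * (if s⁻¹ * x ∈ E then ξ (j, s⁻¹ * x) else 0)
    else 0)

include hS in
theorem inner_conv_eq_convForm (K L : Finset Γ) (u v : Γ → EuclideanSpace ℂ (Fin m))
    (hv : ∀ x ∉ L, v x = 0) :
    inner ℂ (finVec K u) (S (finVec L v)) = convForm F a K u v := by
  refine inner_finVec_eq_convForm F a S K L u v fun x _ i => ?_
  simp only [hS, finVec_apply_of_eq_zero L v hv]

include hB in
theorem inner_compression_eq_convForm (u v : Γ → EuclideanSpace ℂ (Fin m))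
    (hv : ∀ x ∉ E, v x = 0) :
    inner ℂ (finVec E u) (B (finVec E v)) = convForm F a E u v := by
  refine inner_finVec_eq_convForm F a B E E u v fun x hx i => ?_
  rw [hB, if_pos hx]
  refine Finset.sum_congr rfl fun s _ => Finset.sum_congr rfl fun j _ => ?_
  split_ifs with h
  · rw [finVec_apply_of_eq_zero E v hv]
  · simp [hv _ h]

include hS in
theorem norm_matForm_le {s : Γ} (hs : s ∈ F) (α β : EuclideanSpace ℂ (Fin m)) :
    ‖matForm (a s) α β‖ ≤ ‖S‖ * (‖α‖ * ‖β‖) := by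
  have h := inner_conv_eq_convForm F a S hS {s} {1} (fun _ => α) (fun x => if x = 1 then β else 0)
    (fun x hx => if_neg (by simpa using hx))
  have h2 : convForm F a {s} (fun _ => α) (fun x => if x = 1 then β else 0)
      = matForm (a s) α β := by
    rw [convForm, Finset.sum_singleton, Finset.sum_eq_single s]
    · simp
    · intro t _ hts
      rw [if_neg, matForm_zero_right]
      rwa [inv_mul_eq_one]
    · exact fun h => absurd hs h
  rw [h2] at h
  rw [← h]
  refine (norm_inner_le_norm _ _).trans ?_
  have h3 := S.le_opNorm (finVec {1} (fun x => if x = 1 then β else 0))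
  rw [norm_finVec {1}] at h3
  rw [norm_finVec {s}]
  simp only [Finset.sum_singleton, if_true, Real.sqrt_sq (norm_nonneg _)] at h3 ⊢
  calc _ ≤ ‖α‖ * (‖S‖ * ‖β‖) := mul_le_mul_of_nonneg_left h3 (norm_nonneg _)
    _ = _ := by ring

include hB in
theorem norm_convForm_le_compression (K : Finset Γ) (g : Γ)
    (u v : Γ → EuclideanSpace ℂ (Fin m)) (hu : ∀ x ∉ K, u x = 0) (hv : ∀ x ∉ K, v x = 0)
    (hug : ∀ x, x * g ∉ E → u x = 0) (hvg : ∀ x, x * g ∉ E → v x = 0) :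
    ‖convForm F a K u v‖ ≤ ‖B‖ * (‖finVec K u‖ * ‖finVec K v‖) := by
  have hnorm : ∀ w : Γ → EuclideanSpace ℂ (Fin m), (∀ x ∉ K, w x = 0) →
      (∀ x, x * g ∉ E → w x = 0) → ‖finVec E fun y => w (y * g⁻¹)‖ = ‖finVec K w‖ := by
    intro w hw hwg
    rw [norm_finVec, norm_finVec, sum_mul_right_eq K E g⁻¹ (fun x => ‖w x‖ ^ 2)]
    · exact fun x hx => by simp [hw x hx]
    · exact fun x hx => by simp [hwg (x * g⁻¹) (by simpa using hx)]
  have hform : convForm F a E (fun y => u (y * g⁻¹)) (fun y => v (y * g⁻¹))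
      = convForm F a K u v := by
    simp only [convForm, mul_assoc _ _ g⁻¹]
    refine sum_mul_right_eq K E g⁻¹ (fun x => ∑ s ∈ F, matForm (a s) (u x) (v (s⁻¹ * x))) ?_ ?_
    · exact fun x hx => by simp [hu x hx]
    · exact fun x hx => by simp [hug (x * g⁻¹) (by simpa using hx)]
  rw [← hform, ← inner_compression_eq_convForm F E a B hB _ _
    (fun x hx => hvg _ (by simpa using hx)), ← hnorm u hu hug, ← hnorm v hv hvg]
  refine (norm_inner_le_norm _ _).trans ?_
  have h3 := mul_le_mul_of_nonneg_left (B.le_opNorm (finVec E fun y => v (y * g⁻¹)))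
    (norm_nonneg (finVec E fun y => u (y * g⁻¹)))
  linarith

include hS hB in
theorem norm_compression_le : ‖B‖ ≤ ‖S‖ := by
  refine ContinuousLinearMap.opNorm_le_bound _ (norm_nonneg _) fun f => ?_
  have h : B f = finVec E (fiber (S (finVec E (fiber f)))) := by
    ext ⟨i, x⟩
    rw [hB, finVec_apply]
    refine if_congr Iff.rfl ?_ rfl
    simp only [fiber, hS, finVec_apply]
  rw [h]
  exact (norm_finVec_fiber_le _ _).trans ((S.le_opNorm _).trans
    (mul_le_mul_of_nonneg_left (norm_finVec_fiber_le _ _) (norm_nonneg _)))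

end convolution

section approximateMean

variable {Γ : Type*} [Group Γ] [DecidableEq Γ] {F E : Finset Γ} {η : Γ → Γ → ℝ}
  (hpos : ∀ x t, 0 ≤ η x t) (hsupp : ∀ x, Function.support (η x) ⊆ (E : Set Γ))
  (hsum : ∀ x, ∑ᶠ t, η x t = 1)

include hsupp in
omit [Group Γ] [DecidableEq Γ] in
theorem mean_eq_zero {x t : Γ} (ht : t ∉ E) : η x t = 0 := by
  by_contra h
  exact ht (hsupp x h)

include hsupp hsum in
omit [Group Γ] [DecidableEq Γ] in
theorem sum_mean_eq_one {W : Finset Γ} (hW : E ⊆ W) (x : Γ) : ∑ t ∈ W, η x t = 1 := by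
  rw [← hsum x, finsum_eq_sum_of_support_subset]
  exact (hsupp x).trans (by exact_mod_cast hW)

include hsupp in
theorem finsum_abs_sub_translate_eq (s y : Γ) :
    ∑ᶠ t, |η (s * y) t - η y (s⁻¹ * t)|
      = ∑ t ∈ E ∪ E.image (s * ·), |η (s * y) t - η y (s⁻¹ * t)| := by
  refine finsum_eq_sum_of_support_subset _ fun t ht => ?_
  by_contra h
  simp only [Finset.coe_union, Set.mem_union, Finset.mem_coe, not_or] at h
  refine ht ?_
  have h2 : s⁻¹ * t ∉ E := fun h' => h.2 (Finset.mem_image.2 ⟨s⁻¹ * t, h', by simp⟩)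
  simp [mean_eq_zero hsupp h.1, mean_eq_zero hsupp h2]

include hpos hsupp hsum in
theorem finsum_abs_sub_translate_le_two (s y : Γ) :
    ∑ᶠ t, |η (s * y) t - η y (s⁻¹ * t)| ≤ 2 := by
  rw [finsum_abs_sub_translate_eq hsupp]
  have h1 := sum_mean_eq_one hsupp hsum (W := E ∪ E.image (s * ·)) Finset.subset_union_left (s * y)
  have h2 : ∑ t ∈ E ∪ E.image (s * ·), η y (s⁻¹ * t) = ∑ t ∈ E, η y t := by
    refine sum_mul_left_eq E _ s⁻¹ (η y) (fun t ht => mean_eq_zero hsupp ht) fun t ht => ?_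
    refine mean_eq_zero hsupp fun h' => ht (Finset.mem_union_right _ ?_)
    exact Finset.mem_image.2 ⟨s⁻¹ * t, h', by simp⟩
  rw [sum_mean_eq_one hsupp hsum subset_rfl] at h2
  calc _ ≤ ∑ t ∈ E ∪ E.image (s * ·), (η (s * y) t + η y (s⁻¹ * t)) := by
        refine Finset.sum_le_sum fun t _ => ?_
        rw [abs_le]
        constructor <;> linarith [hpos (s * y) t, hpos y (s⁻¹ * t)]
    _ = 2 := by rw [Finset.sum_add_distrib, h1, h2]; norm_num

/-- The positive definite kernel `φ(x, s⁻¹x) = ∑_t (η^x(t) η^{s⁻¹x}(s⁻¹t))^{1/2}`. -/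
def meanKernel (E : Finset Γ) (η : Γ → Γ → ℝ) (s x : Γ) : ℝ :=
  ∑ t ∈ E, √(η x t) * √(η (s⁻¹ * x) (s⁻¹ * t))

include hpos hsupp hsum in
theorem abs_one_sub_meanKernel_le (s x : Γ) :
    |1 - meanKernel E η s x| ≤ ⨆ y : Γ, ∑ᶠ t, |η (s * y) t - η y (s⁻¹ * t)| := by
  have hbdd : BddAbove (Set.range fun y => ∑ᶠ t, |η (s * y) t - η y (s⁻¹ * t)|) :=
    ⟨2, by rintro _ ⟨y, rfl⟩; exact finsum_abs_sub_translate_le_two hpos hsupp hsum s y⟩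
  refine le_trans ?_ (le_ciSup hbdd (s⁻¹ * x))
  rw [finsum_abs_sub_translate_eq hsupp, mul_inv_cancel_left, meanKernel,
    ← sum_mean_eq_one hsupp hsum subset_rfl x, ← Finset.sum_sub_distrib]
  refine (Finset.abs_sum_le_sum_abs _ _).trans ?_
  refine (Finset.sum_le_sum fun t _ => abs_sub_sqrt_mul_sqrt_le (hpos _ _) (hpos _ _)).trans ?_
  exact Finset.sum_le_sum_of_subset_of_nonneg Finset.subset_union_left fun _ _ _ => abs_nonneg _

/-- The function `u` multiplied by the weight `x ↦ η^x(xg)^{1/2}`. -/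
def weighted {m : ℕ} (η : Γ → Γ → ℝ) (g : Γ) (u : Γ → EuclideanSpace ℂ (Fin m)) (x : Γ) :
    EuclideanSpace ℂ (Fin m) :=
  ((√(η x (x * g)) : ℝ) : ℂ) • u x

/-- The finite set `K⁻¹E`. -/
def quotients (K E : Finset Γ) : Finset Γ := Finset.image₂ (fun x t => x⁻¹ * t) K E

include hsupp in
theorem mean_eq_zero_of_notMem_quotients {K : Finset Γ} {x g : Γ} (hx : x ∈ K)
    (hg : g ∉ quotients K E) : η x (x * g) = 0 := by
  refine mean_eq_zero hsupp fun h => hg ?_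
  exact Finset.mem_image₂.2 ⟨x, hx, x * g, h, by simp⟩

include hpos hsupp hsum in
theorem sum_norm_finVec_weighted_sq {m : ℕ} (K : Finset Γ)
    (u : Γ → EuclideanSpace ℂ (Fin m)) :
    ∑ g ∈ quotients K E, ‖finVec K (weighted η g u)‖ ^ 2 = ‖finVec K u‖ ^ 2 := by
  simp only [norm_finVec_sq]
  rw [Finset.sum_comm]
  refine Finset.sum_congr rfl fun x hx => ?_
  have h : ∀ g, ‖weighted η g u x‖ ^ 2 = η x (x * g) * ‖u x‖ ^ 2 := by
    intro g
    rw [weighted, norm_smul, mul_pow, Complex.norm_real, Real.norm_eq_abs, sq_abs,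
      Real.sq_sqrt (hpos _ _)]
  simp only [h]
  rw [← Finset.sum_mul, sum_mul_left_eq E _ x (η x) (fun t ht => mean_eq_zero hsupp ht)
    (fun g hg => mean_eq_zero_of_notMem_quotients hsupp hx hg),
    sum_mean_eq_one hsupp hsum subset_rfl, one_mul]

include hsupp in
theorem sum_convForm_weighted {m : ℕ} (a : Γ → Matrix (Fin m) (Fin m) ℂ) (K : Finset Γ)
    (u v : Γ → EuclideanSpace ℂ (Fin m)) :
    ∑ g ∈ quotients K E, convForm F a K (weighted η g u) (weighted η g v)
      = ∑ x ∈ K, ∑ s ∈ F, (meanKernel E η s x : ℂ) * matForm (a s) (u x) (v (s⁻¹ * x)) := by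
  simp only [convForm]
  rw [Finset.sum_comm]
  refine Finset.sum_congr rfl fun x hx => ?_
  rw [Finset.sum_comm]
  refine Finset.sum_congr rfl fun s _ => ?_
  simp only [weighted, matForm_smul_smul]
  rw [← Finset.sum_mul, ← Complex.ofReal_sum, meanKernel]
  simp only [mul_assoc s⁻¹ x]
  rw [sum_mul_left_eq E _ x (fun t => √(η x t) * √(η (s⁻¹ * x) (s⁻¹ * t)))
    (fun t ht => by simp [mean_eq_zero hsupp ht])
    (fun g hg => by simp [mean_eq_zero_of_notMem_quotients hsupp hx hg])]

end approximateMean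

/-- Approximate invariant means give norm estimates for compressions: if
`η : Γ → Prob(Γ)` has all `η^x` supported in `E` and
`∑_{s ∈ F} sup_x ‖η^{sx} - s·η^x‖₁ ≤ ε`, then for every `m` and every family
`(a_s)_{s ∈ F}` of `m × m` complex matrices, the operator
`S = ∑_{s ∈ F} a_s ⊗ λ(s)` on `ℓ²(Fin m × Γ)` and its compression
`B = (1 ⊗ P_E) S (1 ⊗ P_E)` satisfy `(1 - ε)‖S‖ ≤ ‖B‖ ≤ ‖S‖`. -/
theorem compression_norm_estimate
    (Γ : Type*) [Group Γ] [DecidableEq Γ]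
    (F E : Finset Γ)
    (hF1 : (1 : Γ) ∈ F) (hFsymm : ∀ t ∈ F, t⁻¹ ∈ F)
    (hE1 : (1 : Γ) ∈ E) (hEsymm : ∀ t ∈ E, t⁻¹ ∈ E)
    (ε : ℝ) (hε : 0 < ε)
    (η : Γ → Γ → ℝ)
    (hpos : ∀ x t, 0 ≤ η x t)
    (hsupp : ∀ x, Function.support (η x) ⊆ (E : Set Γ))
    (hsum : ∀ x, ∑ᶠ t, η x t = 1)
    (hinv : (∑ s ∈ F, ⨆ x : Γ, ∑ᶠ t, |η (s * x) t - η x (s⁻¹ * t)|) ≤ ε)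
    (m : ℕ) (a : Γ → Matrix (Fin m) (Fin m) ℂ)
    (S B : lp (fun _ : Fin m × Γ => ℂ) 2 →L[ℂ] lp (fun _ : Fin m × Γ => ℂ) 2)
    (hS : ∀ (ξ : lp (fun _ : Fin m × Γ => ℂ) 2) (i : Fin m) (x : Γ),
      S ξ (i, x) = ∑ s ∈ F, ∑ j : Fin m, a s i j * ξ (j, s⁻¹ * x))
    (hB : ∀ (ξ : lp (fun _ : Fin m × Γ => ℂ) 2) (i : Fin m) (x : Γ),
      B ξ (i, x) = if x ∈ E then
        ∑ s ∈ F, ∑ j : Fin m, a s i j *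
          (if s⁻¹ * x ∈ E then ξ (j, s⁻¹ * x) else 0)
      else 0) :
    (1 - ε) * ‖S‖ ≤ ‖B‖ ∧ ‖B‖ ≤ ‖S‖ := by
  refine ⟨?_, norm_compression_le F E a S B hS hB⟩
  suffices h : ‖S‖ ≤ ‖B‖ + ε * ‖S‖ by linarith
  refine opNorm_le_of_finVec S (by positivity) fun K u v hu hv => ?_
  rw [inner_conv_eq_convForm F a S hS K K u v hv]
  set δ : Γ → ℝ := fun s => ⨆ x : Γ, ∑ᶠ t, |η (s * x) t - η x (s⁻¹ * t)| with hδ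
  have hmain : ‖∑ g ∈ quotients K E, convForm F a K (weighted η g u) (weighted η g v)‖
      ≤ ‖B‖ * (‖finVec K u‖ * ‖finVec K v‖) := by
    have hvanish : ∀ g, ∀ w : Γ → EuclideanSpace ℂ (Fin m), ∀ x, x * g ∉ E →
        weighted η g w x = 0 := fun g w x hx => by simp [weighted, mean_eq_zero hsupp hx]
    refine (norm_sum_le_of_le _ fun g _ => norm_convForm_le_compression F E a B hB K g _ _
      (fun x hx => by simp [weighted, hu x hx]) (fun x hx => by simp [weighted, hv x hx])
      (hvanish g u) (hvanish g v)).trans ?_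
    rw [← Finset.mul_sum]
    refine mul_le_mul_of_nonneg_left ?_ (norm_nonneg _)
    exact sum_norm_mul_norm_le _ _ _
      (sum_norm_finVec_weighted_sq hpos hsupp hsum K u).le
      (sum_norm_finVec_weighted_sq hpos hsupp hsum K v).le (norm_nonneg _) (norm_nonneg _)
  have hrem : ‖convForm F a K u v
      - ∑ g ∈ quotients K E, convForm F a K (weighted η g u) (weighted η g v)‖
      ≤ ε * ‖S‖ * (‖finVec K u‖ * ‖finVec K v‖) := by
    rw [sum_convForm_weighted hsupp, convForm]
    simp only [← Finset.sum_sub_distrib, ← one_sub_mul]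
    rw [Finset.sum_comm]
    have hterm : ∀ s ∈ F, ‖∑ x ∈ K, (1 - (meanKernel E η s x : ℂ))
        * matForm (a s) (u x) (v (s⁻¹ * x))‖
        ≤ δ s * (‖S‖ * (‖finVec K u‖ * ‖finVec K v‖)) := by
      intro s hs
      have hδ0 : 0 ≤ δ s :=
        (abs_nonneg _).trans (abs_one_sub_meanKernel_le hpos hsupp hsum s 1)
      calc _ ≤ ∑ x ∈ K, δ s * (‖S‖ * (‖u x‖ * ‖v (s⁻¹ * x)‖)) := by
            refine norm_sum_le_of_le _ fun x _ => ?_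
            rw [norm_mul, ← Complex.ofReal_one, ← Complex.ofReal_sub, Complex.norm_real]
            exact mul_le_mul (abs_one_sub_meanKernel_le hpos hsupp hsum s x)
              (norm_matForm_le F a S hS hs _ _) (norm_nonneg _) hδ0
        _ = δ s * (‖S‖ * ∑ x ∈ K, ‖u x‖ * ‖v (s⁻¹ * x)‖) := by
            rw [← Finset.mul_sum, ← Finset.mul_sum]
        _ ≤ _ := by
            gcongr
            refine sum_norm_mul_norm_le K u (fun x => v (s⁻¹ * x)) (norm_finVec_sq K u).ge ?_
              (norm_nonneg _) (norm_nonneg _)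
            rw [norm_finVec_sq]
            exact sum_norm_sq_translate_le K s⁻¹ v hv
    refine (norm_sum_le_of_le _ hterm).trans ?_
    rw [← Finset.sum_mul, mul_assoc ε]
    exact mul_le_mul_of_nonneg_right hinv (by positivity)
  calc _ = ‖(convForm F a K u v
        - ∑ g ∈ quotients K E, convForm F a K (weighted η g u) (weighted η g v))
        + ∑ g ∈ quotients K E, convForm F a K (weighted η g u) (weighted η g v)‖ := by
        rw [sub_add_cancel]
    _ ≤ _ := (norm_add_le _ _).trans (add_le_add hrem hmain)
    _ = _ := by ring
end
end
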